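/- Let n ≥ 2, b > 1 and p > (n+b)/(n−2+b). Then there exists a constant C, depending only on p, n, b, such that for every bounded measurable f : ℝⁿ₊ → ℝ with support contained in B₁(0), the function u = T_b f satisfies ‖u‖_{L^p_{μ_b}(ℝⁿ₊)} + ‖Du‖_{L^p_{μ_b}(ℝⁿ₊)} + Σ_{i,j=1}^n ‖∂_{ij}u‖_{L^p_{μ_b}(ℝⁿ₊)} + ‖(∂_n u)/x_n‖_{L^p_{μ_b}(ℝⁿ₊)} ≤ C ‖f‖_{L^p_{μ_b}(ℝⁿ₊)}. -/

import Mathlib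

open MeasureTheory
open scoped ENNReal

noncomputable section

/-- Euclidean n-space. -/
abbrev Eu (n : ℕ) := EuclideanSpace ℝ (Fin n)

/-- Partial derivative ∂ψ/∂xᵢ. -/
def pd {n : ℕ} (ψ : Eu n → ℝ) (i : Fin n) (x : Eu n) : ℝ :=
  fderiv ℝ ψ x (EuclideanSpace.single i 1)

/-- Second partial derivative ∂²ψ/∂xᵢ∂xⱼ. -/
def pd2 {n : ℕ} (ψ : Eu n → ℝ) (i j : Fin n) (x : Eu n) : ℝ :=
  pd (pd ψ j) i x


/-- The constant `D_b = 2^{b-2} π^{-n/2} Γ((n+b-2)/2)/Γ(b/2)`. -/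
def Db (n : ℕ) (b : ℝ) : ℝ :=
  2 ^ (b - 2) * Real.pi ^ (-(n : ℝ) / 2) *
    Real.Gamma (((n : ℝ) + b - 2) / 2) / Real.Gamma (b / 2)

/-- Reflection `y* = (y₁,…,y_{n-1},−y_n)` across the hyperplane `{y_n = 0}`. -/
def reflLn {n : ℕ} (ln : Fin n) (y : Eu n) : Eu n :=
  (EuclideanSpace.equiv (Fin n) ℝ).symm (fun i => if i = ln then -(y i) else y i)

/-- Horiuchi's Green function `K_b(x,y)`. -/
def Kb (n : ℕ) (ln : Fin n) (b : ℝ) (x y : Eu n) : ℝ :=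
  Db n b * ∫ τ in (0 : ℝ)..1,
    (‖x - y‖ ^ 2 * (1 - τ) + ‖x - reflLn ln y‖ ^ 2 * τ) ^ (-(((n : ℝ) - 2 + b) / 2)) *
      (τ * (1 - τ)) ^ (b / 2 - 1)

/-- The solution operator `T_b f(x) = ∫_{ℝⁿ₊} K_b(x,y) yₙ^b f(y) dy`. -/
def Tb (n : ℕ) (ln : Fin n) (b : ℝ) (f : Eu n → ℝ) (x : Eu n) : ℝ :=
  ∫ y in {y : Eu n | 0 < y ln}, Kb n ln b x y * (y ln) ^ b * f y

/-- The measure `μ_b` on `ℝⁿ₊` with density `xₙ^b` w.r.t. Lebesgue measure. -/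
def mub (n : ℕ) (ln : Fin n) (b : ℝ) : Measure (Eu n) :=
  (volume.restrict {x : Eu n | 0 < x ln}).withDensity
    fun x => ENNReal.ofReal ((x ln) ^ b)

namespace HalfSpaceCZ

open Set Filter Topology

/-- The open half-space. -/
def Hs {n : ℕ} (ln : Fin n) : Set (Eu n) := {x | 0 < x ln}

lemma isOpen_Hs {n : ℕ} (ln : Fin n) : IsOpen (Hs ln) :=
  isOpen_lt continuous_const (by fun_prop)

lemma measurableSet_Hs {n : ℕ} (ln : Fin n) : MeasurableSet (Hs ln) := (isOpen_Hs ln).measurableSet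

/-- The measure `(τ(1-τ))^{b/2-1} dτ` on `(0,1)`. -/
def kap (b : ℝ) : Measure ℝ :=
  (volume.restrict (Ioo 0 1)).withDensity fun τ => ENNReal.ofReal ((τ * (1 - τ)) ^ (b / 2 - 1))

/-- The quadratic form in the kernel. -/
def Qf {n : ℕ} (ln : Fin n) (x y : Eu n) (τ : ℝ) : ℝ := ‖x - y‖ ^ 2 + 4 * τ * (x ln) * (y ln)

/-- Half of the `i`-th derivative of `Qf` in `x`. -/
def Xf {n : ℕ} (ln : Fin n) (i : Fin n) (x y : Eu n) (τ : ℝ) : ℝ :=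
  x i - y i + if i = ln then 2 * τ * y ln else 0

lemma ae_mub {n : ℕ} (ln : Fin n) (b : ℝ) : ∀ᵐ x ∂(mub n ln b), x ∈ Hs ln := by
  have : mub n ln b ≪ volume.restrict (Hs ln) := withDensity_absolutelyContinuous _ _
  exact this.ae_le (ae_restrict_mem (measurableSet_Hs ln))

lemma ae_kap (b : ℝ) : ∀ᵐ τ ∂(kap b), τ ∈ Ioo (0:ℝ) 1 := by
  have : kap b ≪ volume.restrict (Ioo 0 1) := withDensity_absolutelyContinuous _ _
  exact this.ae_le (ae_restrict_mem measurableSet_Ioo)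

lemma measurable_wt {n : ℕ} (ln : Fin n) (b : ℝ) :
    Measurable fun x : Eu n => ENNReal.ofReal ((x ln) ^ b) := by fun_prop

lemma lintegral_mub {n : ℕ} (ln : Fin n) (b : ℝ) {g : Eu n → ℝ≥0∞} (hg : Measurable g) :
    ∫⁻ x, g x ∂(mub n ln b) = ∫⁻ x in Hs ln, ENNReal.ofReal ((x ln) ^ b) * g x := by
  rw [mub, lintegral_withDensity_eq_lintegral_mul _ (measurable_wt ln b) hg]; rfl

instance sigmaFinite_mub (n : ℕ) (ln : Fin n) (b : ℝ) : SigmaFinite (mub n ln b) :=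
  SigmaFinite.withDensity_ofReal _

lemma mub_apply {n : ℕ} (ln : Fin n) (b : ℝ) {s : Set (Eu n)} (hs : MeasurableSet s) :
    mub n ln b s = ∫⁻ x in s ∩ Hs ln, ENNReal.ofReal ((x ln) ^ b) := by
  rw [mub, withDensity_apply _ hs, Measure.restrict_restrict hs]; rfl

lemma measurable_kapdens (b : ℝ) :
    Measurable fun τ : ℝ => ENNReal.ofReal ((τ * (1 - τ)) ^ (b / 2 - 1)) := by fun_prop

lemma kapdens_le {b : ℝ} : ∃ c : ℝ, 0 < c ∧ ∀ τ ∈ Ioo (0:ℝ) 1,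
    (τ * (1 - τ)) ^ (b / 2 - 1) ≤ c * (τ ^ (b / 2 - 1) + (1 - τ) ^ (b / 2 - 1)) ∧
    (τ ≤ 1 / 2 → (τ * (1 - τ)) ^ (b / 2 - 1) ≤ c * τ ^ (b / 2 - 1)) := by
  set a := b / 2 - 1
  have key : ∀ t : ℝ, 1 / 2 ≤ t → t ≤ 1 → t ^ a ≤ 1 + (1 / 2) ^ a := by
    intro t h1 h2
    rcases le_total 0 a with h | h
    · have := Real.rpow_le_one (by linarith) h2 h
      have := Real.rpow_nonneg (by norm_num : (0:ℝ) ≤ 1 / 2) a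
      linarith
    · have := Real.rpow_le_rpow_of_nonpos (by norm_num) h1 h
      linarith
  have hc : 0 < 1 + (1 / 2 : ℝ) ^ a := by positivity
  refine ⟨1 + (1 / 2) ^ a, hc, fun τ hτ => ?_⟩
  obtain ⟨h0, h1⟩ := hτ
  have e : (τ * (1 - τ)) ^ a = τ ^ a * (1 - τ) ^ a := Real.mul_rpow h0.le (by linarith)
  have p1 := Real.rpow_nonneg h0.le a
  have p2 := Real.rpow_nonneg (by linarith : 0 ≤ 1 - τ) a
  have A : τ ≤ 1 / 2 → (τ * (1 - τ)) ^ a ≤ (1 + (1 / 2) ^ a) * τ ^ a := fun h => by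
    rw [e, mul_comm]
    exact mul_le_mul_of_nonneg_right (key _ (by linarith) (by linarith)) p1
  refine ⟨?_, A⟩
  rcases le_total τ (1 / 2) with h | h
  · nlinarith [A h, mul_nonneg hc.le p2]
  · have : τ ^ a * (1 - τ) ^ a ≤ (1 + (1 / 2) ^ a) * (1 - τ) ^ a :=
      mul_le_mul_of_nonneg_right (key _ h h1.le) p2
    rw [e]; nlinarith [mul_nonneg hc.le p1]

lemma lintegral_rpow_Ioo {a T : ℝ} (ha : -1 < a) (hT : 0 ≤ T) :
    ∫⁻ t in Ioo 0 T, ENNReal.ofReal (t ^ a) = ENNReal.ofReal (T ^ (a + 1) / (a + 1)) := by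
  have hi := (intervalIntegral.intervalIntegrable_rpow' (a := 0) (b := T) ha)
  rw [intervalIntegrable_iff_integrableOn_Ioo_of_le hT] at hi
  rw [← ofReal_integral_eq_lintegral_ofReal hi, ← integral_Ioc_eq_integral_Ioo,
    ← intervalIntegral.integral_of_le hT, integral_rpow (Or.inl ha),
    Real.zero_rpow (by linarith), sub_zero]
  filter_upwards [ae_restrict_mem measurableSet_Ioo] with t ht
  exact Real.rpow_nonneg ht.1.le _

lemma kap_Iic_le {b : ℝ} (hb : 0 < b) : ∃ C : ℝ, 0 < C ∧ ∀ T : ℝ, 0 ≤ T → T ≤ 1 / 2 →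
    kap b (Iic T) ≤ ENNReal.ofReal (C * T ^ (b / 2)) := by
  obtain ⟨c, hc, h⟩ := kapdens_le (b := b)
  refine ⟨c / (b / 2), by positivity, fun T hT hT' => ?_⟩
  rw [kap, withDensity_apply _ measurableSet_Iic, Measure.restrict_restrict measurableSet_Iic]
  have hsub : Iic T ∩ Ioo 0 1 ⊆ Ioc 0 T := fun x hx => ⟨hx.2.1, hx.1⟩
  calc _ ≤ ∫⁻ τ in Iic T ∩ Ioo 0 1, ENNReal.ofReal c * ENNReal.ofReal (τ ^ (b / 2 - 1)) := by
        refine setLIntegral_mono' (measurableSet_Iic.inter measurableSet_Ioo) fun τ hτ => ?_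
        rw [← ENNReal.ofReal_mul hc.le]
        exact ENNReal.ofReal_le_ofReal ((h τ hτ.2).2 (hτ.1.trans hT'))
    _ ≤ ∫⁻ τ in Ioc 0 T, ENNReal.ofReal c * ENNReal.ofReal (τ ^ (b / 2 - 1)) :=
        lintegral_mono_set hsub
    _ = _ := by
        rw [setLIntegral_congr Ioo_ae_eq_Ioc.symm, lintegral_const_mul _ (by fun_prop),
          lintegral_rpow_Ioo (by linarith) hT,
          ← ENNReal.ofReal_mul hc.le]
        congr 1
        rw [show b / 2 - 1 + 1 = b / 2 by ring]; ring

lemma kap_univ_lt {b : ℝ} (hb : 0 < b) : kap b univ < ⊤ := by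
  obtain ⟨c, hc, h⟩ := kapdens_le (b := b)
  rw [kap, withDensity_apply _ MeasurableSet.univ, Measure.restrict_univ]
  have h2 : ∫⁻ τ in Ioo (0:ℝ) 1, ENNReal.ofReal ((1 - τ) ^ (b / 2 - 1)) =
      ∫⁻ τ in Ioo (0:ℝ) 1, ENNReal.ofReal (τ ^ (b / 2 - 1)) := by
    have hm : MeasurePreserving (fun τ : ℝ => 1 - τ) := Measure.measurePreserving_sub_left volume 1
    have := hm.setLIntegral_comp_preimage (s := Ioo 0 1) measurableSet_Ioo
      (f := fun τ => ENNReal.ofReal (τ ^ (b / 2 - 1))) (by fun_prop)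
    rw [← this]
    congr 2
    ext τ; simp
  calc _ ≤ ∫⁻ τ in Ioo (0:ℝ) 1, ENNReal.ofReal c * (ENNReal.ofReal (τ ^ (b / 2 - 1)) +
          ENNReal.ofReal ((1 - τ) ^ (b / 2 - 1))) := by
        refine setLIntegral_mono' measurableSet_Ioo fun τ hτ => ?_
        rw [← ENNReal.ofReal_add (Real.rpow_nonneg hτ.1.le _)
          (Real.rpow_nonneg (by linarith [hτ.2]) _), ← ENNReal.ofReal_mul hc.le]
        exact ENNReal.ofReal_le_ofReal (h τ hτ).1
    _ < ⊤ := by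
        rw [lintegral_const_mul _ (by fun_prop), lintegral_add_left (by fun_prop), h2,
          lintegral_rpow_Ioo (by linarith) zero_le_one]
        exact ENNReal.mul_lt_top ENNReal.ofReal_lt_top
          (ENNReal.add_lt_top.2 ⟨ENNReal.ofReal_lt_top, ENNReal.ofReal_lt_top⟩)

lemma isFiniteMeasure_kap {b : ℝ} (hb : 0 < b) : IsFiniteMeasure (kap b) := ⟨kap_univ_lt hb⟩

instance sigmaFinite_kap (b : ℝ) : SigmaFinite (kap b) := SigmaFinite.withDensity_ofReal _

lemma mub_closedBall_le {n : ℕ} (ln : Fin n) {b : ℝ} (hb : 0 < b) (x : Eu n) {r : ℝ} (hr : 0 ≤ r)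
    (hx : 0 ≤ x ln) :
    mub n ln b (Metric.closedBall x r) ≤
      ENNReal.ofReal ((x ln + r) ^ b * r ^ n * (volume (Metric.ball (0 : Eu n) 1)).toReal) := by
  rw [mub_apply ln b Metric.isClosed_closedBall.measurableSet]
  calc _ ≤ ∫⁻ y in Metric.closedBall x r ∩ Hs ln, ENNReal.ofReal ((x ln + r) ^ b) := by
        refine setLIntegral_mono' (Metric.isClosed_closedBall.measurableSet.inter
          (measurableSet_Hs ln)) fun y hy => ENNReal.ofReal_le_ofReal ?_
        refine Real.rpow_le_rpow (le_of_lt hy.2) ?_ hb.le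
        have h1 : ‖(y - x) ln‖ ≤ ‖y - x‖ := PiLp.norm_apply_le _ _
        have h2 : ‖y - x‖ ≤ r := by simpa [dist_eq_norm] using hy.1
        have h3 : (y - x) ln = y ln - x ln := rfl
        rw [h3, Real.norm_eq_abs] at h1
        linarith [le_abs_self (y ln - x ln)]
    _ ≤ ∫⁻ y in Metric.closedBall x r, ENNReal.ofReal ((x ln + r) ^ b) :=
        lintegral_mono_set inter_subset_left
    _ = _ := by
        rw [setLIntegral_const, Measure.addHaar_closedBall _ _ hr, finrank_euclideanSpace_fin,
          mul_assoc, ENNReal.ofReal_mul (by positivity), ENNReal.ofReal_mul (by positivity),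
          ENNReal.ofReal_toReal measure_ball_lt_top.ne]

lemma Qf_comm {n : ℕ} (ln : Fin n) (x y : Eu n) (τ : ℝ) : Qf ln x y τ = Qf ln y x τ := by
  unfold Qf; rw [norm_sub_rev]; ring

lemma reflLn_apply {n : ℕ} (ln : Fin n) (y : Eu n) (i : Fin n) :
    reflLn ln y i = if i = ln then -(y i) else y i := rfl

lemma norm_sub_reflLn_sq {n : ℕ} (ln : Fin n) (x y : Eu n) :
    ‖x - reflLn ln y‖ ^ 2 = ‖x - y‖ ^ 2 + 4 * x ln * y ln := by
  rw [EuclideanSpace.norm_sq_eq, EuclideanSpace.norm_sq_eq, ← sub_eq_iff_eq_add',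
    ← Finset.sum_sub_distrib, Finset.sum_eq_single ln]
  · simp [reflLn_apply]; ring
  · intro i _ hi; simp [reflLn_apply, hi]
  · simp

lemma Qf_eq {n : ℕ} (ln : Fin n) (x y : Eu n) (τ : ℝ) :
    Qf ln x y τ = ‖x - y‖ ^ 2 * (1 - τ) + ‖x - reflLn ln y‖ ^ 2 * τ := by
  rw [norm_sub_reflLn_sq]; unfold Qf; ring

lemma Qf_nonneg {n : ℕ} (ln : Fin n) (x y : Eu n) {τ : ℝ} (hτ : τ ∈ Ioo (0:ℝ) 1) :
    0 ≤ Qf ln x y τ := by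
  rw [Qf_eq]
  have := hτ.1; have := hτ.2
  have : 0 ≤ 1 - τ := by linarith
  positivity

lemma norm_sq_le_Qf {n : ℕ} (ln : Fin n) {x y : Eu n} {τ : ℝ} (hτ : τ ∈ Ioo (0:ℝ) 1)
    (hx : 0 ≤ x ln) (hy : 0 ≤ y ln) : ‖x - y‖ ^ 2 ≤ Qf ln x y τ := by
  have := hτ.1.le
  unfold Qf
  have : 0 ≤ 4 * τ * (x ln) * (y ln) := by positivity
  linarith

lemma sum_Xf_sq {n : ℕ} (ln : Fin n) (x y : Eu n) (τ : ℝ) :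
    ∑ i, Xf ln i x y τ ^ 2 = Qf ln x y τ - 4 * τ * (1 - τ) * (y ln) ^ 2 := by
  have : ∑ i, (Xf ln i x y τ ^ 2 - (x i - y i) ^ 2) =
      4 * τ * (y ln) * (x ln - y ln) + 4 * τ ^ 2 * y ln ^ 2 := by
    rw [Finset.sum_eq_single ln]
    · simp [Xf]; ring
    · intro i _ hi; simp [Xf, hi]
    · simp
  rw [Finset.sum_sub_distrib] at this
  unfold Qf
  rw [EuclideanSpace.norm_sq_eq]
  simp only [PiLp.sub_apply, Real.norm_eq_abs, sq_abs]
  linarith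

lemma Xf_sq_le {n : ℕ} (ln : Fin n) (i : Fin n) (x y : Eu n) {τ : ℝ} (hτ : τ ∈ Ioo (0:ℝ) 1) :
    Xf ln i x y τ ^ 2 ≤ Qf ln x y τ := by
  have h := Finset.single_le_sum (f := fun i => Xf ln i x y τ ^ 2) (fun i _ => sq_nonneg _)
    (Finset.mem_univ i)
  rw [sum_Xf_sq] at h
  have h1 := hτ.1.le
  have h2 : 0 ≤ 1 - τ := by linarith [hτ.2]
  have : 0 ≤ 4 * τ * (1 - τ) * (y ln) ^ 2 := by positivity
  simp only at h
  linarith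

lemma measurable_Qf {n : ℕ} (ln : Fin n) :
    Measurable fun q : Eu n × Eu n × ℝ => Qf ln q.1 q.2.1 q.2.2 := by
  unfold Qf; fun_prop

lemma measurable_Xf {n : ℕ} (ln i : Fin n) :
    Measurable fun q : Eu n × Eu n × ℝ => Xf ln i q.1 q.2.1 q.2.2 := by
  unfold Xf; split_ifs <;> fun_prop

/-- The product measure on `(y, τ)`. -/
abbrev rhob (n : ℕ) (ln : Fin n) (b : ℝ) : Measure (Eu n × ℝ) := (mub n ln b).prod (kap b)

lemma ae_rhob {n : ℕ} (ln : Fin n) (b : ℝ) :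
    ∀ᵐ w ∂(rhob n ln b), w.1 ∈ Hs ln ∧ w.2 ∈ Ioo (0:ℝ) 1 :=
  (Measure.quasiMeasurePreserving_fst.ae (ae_mub ln b)).and
    (Measure.quasiMeasurePreserving_snd.ae (ae_kap b))

lemma rhob_Qf_le {n : ℕ} (ln : Fin n) {b : ℝ} (hb : 0 < b) : ∃ C : ℝ, 0 < C ∧ ∀ x ∈ Hs ln,
    ∀ R : ℝ, 0 < R → rhob n ln b {w | Qf ln x w.1 w.2 ≤ R} ≤
      ENNReal.ofReal (C * R ^ (((n : ℝ) + b) / 2)) := by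
  obtain ⟨c, hc, hk⟩ := kap_Iic_le hb
  set K := (kap b univ).toReal
  set V := (volume (Metric.ball (0 : Eu n) 1)).toReal
  have hK : 0 ≤ K := ENNReal.toReal_nonneg
  have hV : 0 ≤ V := ENNReal.toReal_nonneg
  refine ⟨3 ^ b * V * K + 2 ^ b * V * c + 1, by positivity, fun x hx R hR => ?_⟩
  obtain ⟨r, hr, rfl⟩ : ∃ r : ℝ, 0 < r ∧ R = r ^ 2 :=
    ⟨√R, Real.sqrt_pos.2 hR, (Real.sq_sqrt hR.le).symm⟩
  have hRd : (r ^ 2) ^ (((n : ℝ) + b) / 2) = r ^ n * r ^ b := by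
    rw [← Real.rpow_natCast r n, ← Real.rpow_add hr, ← Real.rpow_natCast r 2, ← Real.rpow_mul hr.le]
    congr 1; push_cast; ring
  have hx0 : 0 < x ln := hx
  have dist_of : ∀ w : Eu n × ℝ, w.1 ∈ Hs ln → w.2 ∈ Ioo (0:ℝ) 1 → Qf ln x w.1 w.2 ≤ r ^ 2 →
      w.1 ∈ Metric.closedBall x r := fun w h1 h2 h3 => by
    have := (norm_sq_le_Qf ln h2 hx0.le (le_of_lt h1)).trans h3
    rw [Metric.mem_closedBall, dist_comm, dist_eq_norm]
    exact le_of_sq_le_sq this hr.le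
  have hP : 0 ≤ r ^ n * r ^ b := by positivity
  have h1 : 0 ≤ 3 ^ b * V * K := by positivity
  have h2 : 0 ≤ 2 ^ b * V * c := by positivity
  rw [hRd]
  rcases le_total (x ln) (2 * r) with hcase | hcase
  · calc _ ≤ rhob n ln b (Metric.closedBall x r ×ˢ univ) := by
          refine measure_mono_ae ?_
          filter_upwards [ae_rhob ln b] with w hw h
          exact ⟨dist_of w hw.1 hw.2 h, mem_univ _⟩
      _ ≤ ENNReal.ofReal ((x ln + r) ^ b * r ^ n * V) * ENNReal.ofReal K := by
          rw [Measure.prod_prod, ENNReal.ofReal_toReal (kap_univ_lt hb).ne]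
          gcongr
          exact mub_closedBall_le ln hb x hr.le hx0.le
      _ ≤ _ := by
          rw [← ENNReal.ofReal_mul (by positivity)]
          refine ENNReal.ofReal_le_ofReal ?_
          have : (x ln + r) ^ b ≤ 3 ^ b * r ^ b := by
            rw [← Real.mul_rpow (by norm_num) hr.le]
            exact Real.rpow_le_rpow (by linarith) (by linarith) hb.le
          calc (x ln + r) ^ b * r ^ n * V * K ≤ (3 ^ b * r ^ b) * r ^ n * V * K := by gcongr
            _ = (3 ^ b * V * K) * (r ^ n * r ^ b) := by ring
            _ ≤ _ := by apply mul_le_mul_of_nonneg_right _ hP; linarith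
  · have hT : r ^ 2 / (2 * x ln ^ 2) ≤ 1 / 2 := by
      rw [div_le_div_iff₀ (by positivity) (by norm_num)]; nlinarith
    calc _ ≤ rhob n ln b (Metric.closedBall x r ×ˢ Iic (r ^ 2 / (2 * x ln ^ 2))) := by
          refine measure_mono_ae ?_
          filter_upwards [ae_rhob ln b] with w hw h
          have hb1 := dist_of w hw.1 hw.2 h
          refine ⟨hb1, ?_⟩
          have h2 : ‖w.1 - x‖ ≤ r := by simpa [dist_eq_norm] using hb1
          have h1 : ‖(w.1 - x) ln‖ ≤ ‖w.1 - x‖ := PiLp.norm_apply_le _ _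
          have h3 : (w.1 - x) ln = w.1 ln - x ln := rfl
          rw [h3, Real.norm_eq_abs] at h1
          have h4 : x ln / 2 ≤ w.1 ln := by linarith [neg_abs_le (w.1 ln - x ln)]
          have h5 : Qf ln x w.1 w.2 ≤ r ^ 2 := h
          have h6 : 4 * w.2 * x ln * w.1 ln ≤ r ^ 2 := by
            unfold Qf at h5; nlinarith [sq_nonneg ‖x - w.1‖]
          show w.2 ≤ _
          rw [le_div_iff₀ (by positivity)]
          have : 0 ≤ w.2 * x ln := mul_nonneg hw.2.1.le hx0.le
          nlinarith
      _ ≤ ENNReal.ofReal ((x ln + r) ^ b * r ^ n * V) *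
          ENNReal.ofReal (c * (r ^ 2 / (2 * x ln ^ 2)) ^ (b / 2)) := by
          rw [Measure.prod_prod]
          gcongr
          · exact mub_closedBall_le ln hb x hr.le hx0.le
          · exact hk _ (by positivity) hT
      _ ≤ _ := by
          rw [← ENNReal.ofReal_mul (by positivity)]
          refine ENNReal.ofReal_le_ofReal ?_
          have e1 : (r ^ 2 / (2 * x ln ^ 2)) ^ (b / 2) ≤ r ^ b / x ln ^ b := by
            calc _ ≤ ((r / x ln) ^ 2) ^ (b / 2) := by
                  refine Real.rpow_le_rpow (by positivity) ?_ (by positivity)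
                  rw [div_pow]
                  gcongr
                  nlinarith [sq_nonneg (x ln)]
              _ = (r / x ln) ^ b := by
                  rw [← Real.rpow_natCast _ 2, ← Real.rpow_mul (by positivity)]
                  congr 1; push_cast; ring
              _ = _ := Real.div_rpow hr.le hx0.le _
          have e2 : (x ln + r) ^ b ≤ 2 ^ b * x ln ^ b := by
            rw [← Real.mul_rpow (by norm_num) hx0.le]
            exact Real.rpow_le_rpow (by linarith) (by linarith) hb.le
          have : 0 < x ln ^ b := by positivity
          calc _ ≤ (2 ^ b * x ln ^ b) * r ^ n * V * (c * (r ^ b / x ln ^ b)) := by gcongr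
            _ = (2 ^ b * V * c) * (r ^ n * r ^ b) := by field_simp
            _ ≤ _ := by apply mul_le_mul_of_nonneg_right _ hP; linarith

section

lemma lintegral_rpow_Ioi {a c : ℝ} (ha : a < -1) (hc : 0 < c) :
    ∫⁻ t in Ioi c, ENNReal.ofReal (t ^ a) = ENNReal.ofReal (-c ^ (a + 1) / (a + 1)) := by
  rw [← integral_Ioi_rpow_of_lt ha hc, ofReal_integral_eq_lintegral_ofReal
    (integrableOn_Ioi_rpow_of_lt ha hc)]
  filter_upwards [ae_restrict_mem measurableSet_Ioi] with t ht
  exact Real.rpow_nonneg (hc.trans ht).le _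

section Radial

variable {Ω : Type*} [MeasurableSpace Ω] {ρ : Measure Ω} {Q : Ω → ℝ} {C d m R : ℝ}

lemma lintegral_radial_eq (hQ : Measurable Q) (hQ0 : ∀ᵐ w ∂ρ, 0 ≤ Q w) (hm : 0 < m) (S : Set Ω) :
    ∫⁻ w in S, ENNReal.ofReal (Q w ^ (-m)) ∂ρ = ENNReal.ofReal m *
      ∫⁻ t in Ioi 0, (ρ.restrict S) {w | t < (Q w)⁻¹} * ENNReal.ofReal (t ^ (m - 1)) := by
  rw [← lintegral_rpow_eq_lintegral_meas_lt_mul (ρ.restrict S) (f := fun w => (Q w)⁻¹) _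
    (by fun_prop) hm]
  · refine lintegral_congr_ae ?_
    filter_upwards [ae_restrict_of_ae hQ0] with w hw
    rw [Real.rpow_neg hw, Real.inv_rpow hw]
  · filter_upwards [ae_restrict_of_ae hQ0] with w hw
    exact inv_nonneg.2 hw

lemma measure_inv_gt_le (hC : ∀ R : ℝ, 0 < R → ρ {w | Q w ≤ R} ≤
    ENNReal.ofReal (C * R ^ d)) (S : Set Ω) {t : ℝ} (ht : 0 < t) :
    (ρ.restrict S) {w | t < (Q w)⁻¹} ≤ ENNReal.ofReal (C * t ^ (-d)) := by
  refine (Measure.restrict_apply_le _ _).trans ?_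
  refine (measure_mono ?_).trans ((hC t⁻¹ (by positivity)).trans_eq ?_)
  · intro w hw
    have hw : t < (Q w)⁻¹ := hw
    have : 0 < Q w := inv_pos.1 (ht.trans hw)
    exact ((lt_inv_comm₀ ht this).1 hw).le
  · rw [Real.inv_rpow ht.le, ← Real.rpow_neg ht.le]

/-- Integrals of subcritical powers over small balls. -/
lemma lintegral_near (hQ : Measurable Q) (hQ0 : ∀ᵐ w ∂ρ, 0 ≤ Q w) (hC0 : 0 ≤ C)
    (hC : ∀ R : ℝ, 0 < R → ρ {w | Q w ≤ R} ≤ ENNReal.ofReal (C * R ^ d))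
    (hm : 0 < m) (hmd : m < d) (hR : 0 < R) :
    ∫⁻ w in {w | Q w ≤ R}, ENNReal.ofReal (Q w ^ (-m)) ∂ρ ≤
      ENNReal.ofReal (C * (d / (d - m)) * R ^ (d - m)) := by
  have hdm : 0 < d - m := sub_pos.2 hmd
  have e : ∀ x : ℝ, 0 < x → x⁻¹ ^ m = x ^ (-m) := fun x hx => by
    rw [Real.inv_rpow hx.le, Real.rpow_neg hx.le]
  have hsplit : Ioi (0:ℝ) = Ioc 0 R⁻¹ ∪ Ioi R⁻¹ := (Ioc_union_Ioi_eq_Ioi (by positivity)).symm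
  have h1 : ∫⁻ t in Ioc 0 R⁻¹, (ρ.restrict {w | Q w ≤ R}) {w | t < (Q w)⁻¹} *
      ENNReal.ofReal (t ^ (m - 1)) ≤ ENNReal.ofReal (C * R ^ (d - m) / m) := by
    calc _ ≤ ∫⁻ t in Ioc 0 R⁻¹, ENNReal.ofReal (C * R ^ d) * ENNReal.ofReal (t ^ (m - 1)) := by
          refine setLIntegral_mono' measurableSet_Ioc fun t ht => ?_
          gcongr
          refine (measure_mono (subset_univ _)).trans ?_
          rw [Measure.restrict_apply_univ]
          exact hC R hR
      _ = _ := by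
          rw [lintegral_const_mul _ (by fun_prop), setLIntegral_congr Ioo_ae_eq_Ioc.symm,
            lintegral_rpow_Ioo (by linarith) (by positivity), ← ENNReal.ofReal_mul (by positivity)]
          congr 1
          rw [sub_add_cancel, e R hR, sub_eq_add_neg, Real.rpow_add hR]; ring
  have h2 : ∫⁻ t in Ioi R⁻¹, (ρ.restrict {w | Q w ≤ R}) {w | t < (Q w)⁻¹} *
      ENNReal.ofReal (t ^ (m - 1)) ≤ ENNReal.ofReal (C * R ^ (d - m) / (d - m)) := by
    calc _ ≤ ∫⁻ t in Ioi R⁻¹, ENNReal.ofReal C * ENNReal.ofReal (t ^ (m - 1 - d)) := by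
          refine setLIntegral_mono' measurableSet_Ioi fun t ht => ?_
          have ht0 : 0 < t := (inv_pos.2 hR).trans ht
          refine (mul_le_mul_left (measure_inv_gt_le hC _ ht0) _).trans_eq ?_
          rw [← ENNReal.ofReal_mul (by positivity), ← ENNReal.ofReal_mul hC0, mul_assoc,
            ← Real.rpow_add ht0]
          congr 3; ring
      _ = _ := by
          rw [lintegral_const_mul _ (by fun_prop), lintegral_rpow_Ioi (by linarith) (by positivity),
            ← ENNReal.ofReal_mul hC0]
          congr 1
          rw [show m - 1 - d + 1 = -(d - m) by ring, Real.inv_rpow hR.le, ← Real.rpow_neg hR.le,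
            neg_neg, neg_div_neg_eq]; ring
  rw [lintegral_radial_eq hQ hQ0 hm, hsplit]
  refine (mul_le_mul_right ((lintegral_union_le _ _ _).trans (add_le_add h1 h2)) _).trans_eq ?_
  rw [← ENNReal.ofReal_add (by positivity) (by positivity), ← ENNReal.ofReal_mul hm.le]
  congr 1
  field_simp; ring

/-- Integrals of supercritical powers away from the centre. -/
lemma lintegral_far (hQ : Measurable Q) (hQ0 : ∀ᵐ w ∂ρ, 0 ≤ Q w) (hC0 : 0 ≤ C)
    (hC : ∀ R : ℝ, 0 < R → ρ {w | Q w ≤ R} ≤ ENNReal.ofReal (C * R ^ d))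
    (hm : 0 < m) (hmd : d < m) (hR : 0 < R) :
    ∫⁻ w in {w | R ≤ Q w}, ENNReal.ofReal (Q w ^ (-m)) ∂ρ ≤
      ENNReal.ofReal (C * (m / (m - d)) * R ^ (d - m)) := by
  have hdm : 0 < m - d := sub_pos.2 hmd
  have h1 : ∫⁻ t in Ioi 0, (ρ.restrict {w | R ≤ Q w}) {w | t < (Q w)⁻¹} *
      ENNReal.ofReal (t ^ (m - 1)) ≤ ENNReal.ofReal (C * R ^ (d - m) / (m - d)) := by
    calc _ ≤ ∫⁻ t in Ioi 0, (Ioo 0 R⁻¹).indicator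
          (fun t => ENNReal.ofReal C * ENNReal.ofReal (t ^ (m - d - 1))) t := by
          refine setLIntegral_mono' measurableSet_Ioi fun t (ht : 0 < t) => ?_
          by_cases h : t < R⁻¹
          · rw [indicator_of_mem (show t ∈ Ioo 0 R⁻¹ from ⟨ht, h⟩)]
            refine (mul_le_mul_left (measure_inv_gt_le hC _ ht) _).trans_eq ?_
            rw [← ENNReal.ofReal_mul (by positivity), ← ENNReal.ofReal_mul hC0, mul_assoc,
              ← Real.rpow_add ht]
            congr 3; ring
          · rw [Measure.restrict_apply (measurableSet_lt measurable_const (by fun_prop))]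
            have : {w | t < (Q w)⁻¹} ∩ {w | R ≤ Q w} = ∅ := by
              ext w
              simp only [mem_inter_iff, mem_ofPred_eq, mem_empty_iff_false, iff_false, not_and, not_le]
              intro h3
              have : 0 < Q w := inv_pos.1 (ht.trans h3)
              by_contra h4
              have := inv_anti₀ hR (not_lt.1 h4)
              linarith
            rw [this]; simp
      _ = _ := by
          rw [lintegral_indicator measurableSet_Ioo, Measure.restrict_restrict measurableSet_Ioo,
            inter_eq_self_of_subset_left (fun x hx => hx.1),
            lintegral_const_mul _ (by fun_prop), lintegral_rpow_Ioo (by linarith) (by positivity),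
            ← ENNReal.ofReal_mul hC0]
          congr 1
          rw [show m - d - 1 + 1 = -(d - m) by ring, Real.inv_rpow hR.le, ← Real.rpow_neg hR.le,
            neg_neg, show -(d - m) = m - d by ring]; ring
  rw [lintegral_radial_eq hQ hQ0 hm]
  refine (mul_le_mul_right h1 _).trans_eq ?_
  rw [← ENNReal.ofReal_mul hm.le]
  congr 1
  field_simp

end Radial

/-- Schur's test for nonnegative kernels. -/
lemma schur_test {X : Type*} [MeasurableSpace X] {μ : Measure X} [SFinite μ] {k : X → X → ℝ≥0∞}
    (hk : Measurable (Function.uncurry k)) {A : ℝ≥0∞} {s : Set X} (hs : ∀ᵐ x ∂μ, x ∈ s)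
    (h1 : ∀ x ∈ s, ∫⁻ y, k x y ∂μ ≤ A) (h2 : ∀ y ∈ s, ∫⁻ x, k x y ∂μ ≤ A)
    {p : ℝ} (hp : 1 < p) {f : X → ℝ≥0∞} (hf : Measurable f) :
    ∫⁻ x, (∫⁻ y, k x y * f y ∂μ) ^ p ∂μ ≤ A ^ p * ∫⁻ y, f y ^ p ∂μ := by
  have hpq := Real.HolderConjugate.conjExponent hp
  set q := p.conjExponent
  have hp0 : 0 < p := by linarith
  have hq0 : 0 < q := hpq.symm.pos
  have pt : ∀ x ∈ s, (∫⁻ y, k x y * f y ∂μ) ^ p ≤ A ^ (p / q) * ∫⁻ y, k x y * f y ^ p ∂μ := by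
    intro x hx
    have hkx : Measurable (k x) := hk.of_uncurry_left
    have := ENNReal.lintegral_mul_le_Lp_mul_Lq μ hpq (f := fun y => k x y ^ (1 / p) * f y)
      (g := fun y => k x y ^ (1 / q)) (by fun_prop) (by fun_prop)
    have e1 : ∀ y, k x y ^ (1 / p) * f y * k x y ^ (1 / q) = k x y * f y := fun y => by
      rw [mul_right_comm, ← ENNReal.rpow_add_of_nonneg _ _ (by positivity) (by positivity),
        one_div, one_div, hpq.inv_add_inv_eq_one, ENNReal.rpow_one]
    have e2 : ∀ y, (k x y ^ (1 / p) * f y) ^ p = k x y * f y ^ p := fun y => by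
      rw [ENNReal.mul_rpow_of_nonneg _ _ hp0.le, ← ENNReal.rpow_mul, one_div_mul_cancel hp0.ne',
        ENNReal.rpow_one]
    have e3 : ∀ y, (k x y ^ (1 / q)) ^ q = k x y := fun y => by
      rw [← ENNReal.rpow_mul, one_div_mul_cancel hq0.ne', ENNReal.rpow_one]
    simp only [Pi.mul_apply, e1, e2, e3] at this
    calc _ ≤ ((∫⁻ y, k x y * f y ^ p ∂μ) ^ (1 / p) * (∫⁻ y, k x y ∂μ) ^ (1 / q)) ^ p := by
          gcongr
      _ = (∫⁻ y, k x y ∂μ) ^ (p / q) * ∫⁻ y, k x y * f y ^ p ∂μ := by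
          rw [ENNReal.mul_rpow_of_nonneg _ _ hp0.le, ← ENNReal.rpow_mul,
            one_div_mul_cancel hp0.ne', ENNReal.rpow_one, ← ENNReal.rpow_mul, mul_comm]
          congr 2; ring
      _ ≤ _ := by gcongr; exact h1 x hx
  calc _ ≤ ∫⁻ x, A ^ (p / q) * ∫⁻ y, k x y * f y ^ p ∂μ ∂μ := by
        refine lintegral_mono_ae ?_
        filter_upwards [hs] with x hx using pt x hx
    _ = A ^ (p / q) * ∫⁻ y, ∫⁻ x, k x y * f y ^ p ∂μ ∂μ := by
        have hm : Measurable fun q : X × X => k q.1 q.2 * f q.2 ^ p := by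
          have := hk; fun_prop
        rw [lintegral_const_mul _ hm.lintegral_prod_right, lintegral_lintegral_swap hm.aemeasurable]
    _ ≤ A ^ (p / q) * ∫⁻ y, A * f y ^ p ∂μ := by
        refine mul_le_mul_right (lintegral_mono_ae ?_) _
        filter_upwards [hs] with y hy
        have hky : Measurable fun x => k x y := hk.of_uncurry_right
        rw [lintegral_mul_const _ hky]
        gcongr; exact h2 y hy
    _ = _ := by
        rw [lintegral_const_mul _ (by fun_prop), ← mul_assoc]
        congr 1
        nth_rewrite 2 [← ENNReal.rpow_one A]
        rw [← ENNReal.rpow_add_of_nonneg _ _ (by positivity) (by positivity)]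
        congr 1
        have := hpq.inv_add_inv_eq_one
        field_simp at this ⊢; linarith

end

/-- The index of the grid cell of side `ℓ` containing `x`. -/
def idx {n : ℕ} (ℓ : ℝ) (x : Eu n) : Fin n → ℤ := fun i => ⌊x i / ℓ⌋

/-- The half-open grid cell of side `ℓ` with index `m`. -/
def cell {n : ℕ} (ℓ : ℝ) (m : Fin n → ℤ) : Set (Eu n) := {x | idx ℓ x = m}

/-- The centre of `cell ℓ m`. -/
def ctr {n : ℕ} (ℓ : ℝ) (m : Fin n → ℤ) : Eu n := WithLp.toLp 2 fun i => ℓ * (m i + 1 / 2)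

lemma measurableSet_cell {n : ℕ} (ℓ : ℝ) (m : Fin n → ℤ) : MeasurableSet (cell ℓ m : Set (Eu n)) := by
  have : Measurable (idx ℓ : Eu n → Fin n → ℤ) := by
    unfold idx
    refine measurable_pi_lambda _ fun i => Int.measurable_floor.comp ?_
    fun_prop
  exact this (measurableSet_singleton m)

lemma mem_cell_iff {n : ℕ} {ℓ : ℝ} (hℓ : 0 < ℓ) {m : Fin n → ℤ} {x : Eu n} :
    x ∈ cell ℓ m ↔ ∀ i, ℓ * m i ≤ x i ∧ x i < ℓ * (m i + 1) := by
  simp only [cell, idx, funext_iff, Int.floor_eq_iff, mem_ofPred_eq, le_div_iff₀ hℓ, div_lt_iff₀ hℓ,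
    mul_comm ℓ]

lemma idx_eq_of_half {n : ℕ} {ℓ : ℝ} {x y : Eu n} (h : idx (ℓ / 2) x = idx (ℓ / 2) y) :
    idx ℓ x = idx ℓ y := by
  have key : ∀ z : Eu n, idx ℓ z = fun i => idx (ℓ / 2) z i / 2 := fun z => by
    funext i
    have := Int.floor_div_natCast (z i / (ℓ / 2)) 2
    simp only [idx]
    push_cast at this
    rw [← this]; congr 1
    by_cases hl : ℓ = 0
    · simp [hl]
    · field_simp
  rw [key, key, h]

lemma idx_eq_of_le {n : ℕ} {ℓ : ℝ} {x y : Eu n} {i j : ℕ} (hij : i ≤ j)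
    (h : idx (ℓ / 2 ^ j) x = idx (ℓ / 2 ^ j) y) : idx (ℓ / 2 ^ i) x = idx (ℓ / 2 ^ i) y := by
  induction j, hij using Nat.le_induction with
  | base => exact h
  | succ j _ ih => exact ih (idx_eq_of_half (by rwa [div_div, ← pow_succ]))

lemma norm_le_of_coord {n : ℕ} {v : Eu n} {r : ℝ} (hr : 0 ≤ r) (h : ∀ i, |v i| ≤ r) : ‖v‖ ≤ n * r := by
  rw [EuclideanSpace.norm_eq]
  refine Real.sqrt_le_iff.2 ⟨by positivity, ?_⟩
  calc ∑ i, ‖v i‖ ^ 2 ≤ ∑ i : Fin n, r ^ 2 := Finset.sum_le_sum fun i _ => by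
        rw [Real.norm_eq_abs]; have := h i; gcongr
    _ = n * r ^ 2 := by simp
    _ ≤ (n * r) ^ 2 := by
        rw [mul_pow]; gcongr
        exact_mod_cast Nat.le_self_pow two_ne_zero n

lemma dist_ctr_le {n : ℕ} {ℓ : ℝ} (hℓ : 0 < ℓ) {m : Fin n → ℤ} {x : Eu n} (hx : x ∈ cell ℓ m) :
    dist x (ctr ℓ m) ≤ n * (ℓ / 2) := by
  rw [dist_eq_norm]
  refine norm_le_of_coord (by positivity) fun i => ?_
  have := (mem_cell_iff hℓ).1 hx i
  have e : (x - ctr ℓ m) i = x i - ℓ * (m i + 1 / 2) := rfl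
  rw [e, abs_le]; constructor <;> linarith

lemma ctr_mem_cell {n : ℕ} {ℓ : ℝ} (hℓ : 0 < ℓ) (m : Fin n → ℤ) : ctr ℓ m ∈ cell ℓ m := by
  rw [mem_cell_iff hℓ]
  intro i
  have e : ctr ℓ m i = ℓ * (m i + 1 / 2) := rfl
  rw [e]; constructor <;> nlinarith

lemma mub_cell_eq_zero {n : ℕ} (ln : Fin n) (b : ℝ) {ℓ : ℝ} (hℓ : 0 < ℓ) {m : Fin n → ℤ}
    (hm : m ln < 0) : mub n ln b (cell ℓ m) = 0 := by
  refine measure_mono_null ?_ (ae_iff.1 (ae_mub ln b))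
  intro x hx
  have h1 := ((mem_cell_iff hℓ).1 hx ln).2
  have h2 : (m ln : ℝ) + 1 ≤ 0 := by exact_mod_cast hm
  show ¬ (0 < x ln)
  nlinarith

lemma mub_cell_ge {n : ℕ} (ln : Fin n) {b : ℝ} (hb : 0 < b) {ℓ : ℝ} (hℓ : 0 < ℓ) {m : Fin n → ℤ}
    (hm : 0 ≤ m ln) : ENNReal.ofReal ((ctr ℓ m ln) ^ b * (ℓ / 4) ^ n *
      (volume (Metric.ball (0 : Eu n) 1)).toReal) ≤ mub n ln b (cell ℓ m) := by
  set c' : Eu n := ctr ℓ m + EuclideanSpace.single ln (ℓ / 4)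
  have hm' : (0:ℝ) ≤ m ln := by exact_mod_cast hm
  have ec : ∀ i, ctr ℓ m i = ℓ * (m i + 1 / 2) := fun i => rfl
  have hsub : ∀ y ∈ Metric.ball c' (ℓ / 4), y ∈ cell ℓ m ∧ ctr ℓ m ln ≤ y ln := by
    intro y hy
    have hd : ∀ i, |y i - c' i| < ℓ / 4 := fun i => by
      have h1 : ‖(y - c') i‖ ≤ ‖y - c'‖ := PiLp.norm_apply_le _ _
      exact lt_of_le_of_lt h1 (by simpa [dist_eq_norm] using hy)
    have hc' : ∀ i, c' i = ℓ * (m i + 1 / 2) + if i = ln then ℓ / 4 else 0 := fun i => by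
      simp [c', ec]
    refine ⟨(mem_cell_iff hℓ).2 fun i => ?_, ?_⟩
    · have := abs_lt.1 (hd i)
      rw [hc'] at this
      split_ifs at this <;> constructor <;> linarith
    · have := abs_lt.1 (hd ln)
      rw [hc', if_pos rfl] at this
      rw [ec]; linarith
  have hc0 : 0 < ctr ℓ m ln := by rw [ec]; positivity
  calc _ = ∫⁻ y in Metric.ball c' (ℓ / 4), ENNReal.ofReal ((ctr ℓ m ln) ^ b) := by
        rw [setLIntegral_const, Measure.addHaar_ball_of_pos _ c' (show 0 < ℓ / 4 by positivity), finrank_euclideanSpace_fin,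
          mul_assoc, ENNReal.ofReal_mul (by positivity), ENNReal.ofReal_mul (by positivity),
          ENNReal.ofReal_toReal measure_ball_lt_top.ne]
    _ ≤ ∫⁻ y in Metric.ball c' (ℓ / 4), ENNReal.ofReal ((y ln) ^ b) := by
        refine setLIntegral_mono' measurableSet_ball fun y hy => ENNReal.ofReal_le_ofReal ?_
        exact Real.rpow_le_rpow hc0.le (hsub y hy).2 hb.le
    _ ≤ ∫⁻ y in cell ℓ m ∩ Hs ln, ENNReal.ofReal ((y ln) ^ b) :=
        lintegral_mono_set fun y hy => ⟨(hsub y hy).1, hc0.trans_le (hsub y hy).2⟩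
    _ = _ := (mub_apply ln b (measurableSet_cell ℓ m)).symm

lemma ctr_mem_Hs {n : ℕ} (ln : Fin n) {ℓ : ℝ} (hℓ : 0 < ℓ) {m : Fin n → ℤ} (hm : 0 ≤ m ln) :
    ctr ℓ m ∈ Hs ln := by
  have hm' : (0:ℝ) ≤ m ln := by exact_mod_cast hm
  show 0 < ℓ * ((m ln : ℝ) + 1 / 2)
  positivity

lemma mub_ball_le_cell {n : ℕ} (ln : Fin n) {b : ℝ} (hb : 0 < b) : ∃ D : ℝ, 1 ≤ D ∧
    ∀ (ℓ : ℝ) (m : Fin n → ℤ), 0 < ℓ → 0 ≤ m ln →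
      mub n ln b (Metric.closedBall (ctr ℓ m) (2 * (n * ℓ))) ≤
        ENNReal.ofReal D * mub n ln b (cell ℓ m) := by
  have hn : (1:ℝ) ≤ n := by exact_mod_cast (Fin.pos ln)
  refine ⟨(1 + 4 * n) ^ b * (8 * n) ^ n, ?_, fun ℓ m hℓ hm => ?_⟩
  · exact one_le_mul_of_one_le_of_one_le (Real.one_le_rpow (by linarith) hb.le)
      (one_le_pow₀ (by linarith))
  have hm' : (0:ℝ) ≤ m ln := by exact_mod_cast hm
  have hc : 0 < ctr ℓ m ln := ctr_mem_Hs ln hℓ hm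
  have hcl : ℓ / 2 ≤ ctr ℓ m ln := by
    show ℓ / 2 ≤ ℓ * ((m ln : ℝ) + 1 / 2)
    nlinarith
  refine (mub_closedBall_le ln hb _ (by positivity) hc.le).trans ?_
  refine le_trans ?_ (mul_le_mul_right (mub_cell_ge ln hb hℓ hm) _)
  rw [← ENNReal.ofReal_mul (by positivity)]
  refine ENNReal.ofReal_le_ofReal ?_
  have h1 : (ctr ℓ m ln + 2 * (n * ℓ)) ^ b ≤ (1 + 4 * n) ^ b * ctr ℓ m ln ^ b := by
    rw [← Real.mul_rpow (by positivity) hc.le]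
    exact Real.rpow_le_rpow (by positivity) (by nlinarith) hb.le
  calc _ ≤ ((1 + 4 * n) ^ b * ctr ℓ m ln ^ b) * (2 * (n * ℓ)) ^ n *
        (volume (Metric.ball (0 : Eu n) 1)).toReal := by gcongr
    _ = _ := by
        rw [show (2 * (n * ℓ)) = (8 * n : ℝ) * (ℓ / 4) by ring, mul_pow]; ring

lemma mub_cell_large {n : ℕ} (ln : Fin n) {b : ℝ} (hb : 0 < b) (M : ℝ) : ∃ ℓ : ℝ, 0 < ℓ ∧
    ∀ m : Fin n → ℤ, 0 ≤ m ln → ENNReal.ofReal M ≤ mub n ln b (cell ℓ m) := by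
  set V := (volume (Metric.ball (0 : Eu n) 1)).toReal
  have hV : 0 < V := ENNReal.toReal_pos (Metric.measure_ball_pos _ _ one_pos).ne'
    measure_ball_lt_top.ne
  have hn : n ≠ 0 := (Fin.pos ln).ne'
  have hn1 : (1:ℝ) ≤ n := by exact_mod_cast (Fin.pos ln)
  refine ⟨4 * (1 + |M| / V), by positivity, fun m hm => ?_⟩
  have hm' : (0:ℝ) ≤ m ln := by exact_mod_cast hm
  refine le_trans (ENNReal.ofReal_le_ofReal ?_) (mub_cell_ge ln hb (by positivity) hm)
  have hp : 0 ≤ |M| / V := by positivity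
  have h1 : 1 ≤ ctr (4 * (1 + |M| / V)) m ln ^ b := by
    refine Real.one_le_rpow ?_ hb.le
    show 1 ≤ 4 * (1 + |M| / V) * ((m ln : ℝ) + 1 / 2)
    nlinarith
  have h2 : |M| / V ≤ (4 * (1 + |M| / V) / 4) ^ n := by
    rw [mul_div_cancel_left₀ _ (by norm_num : (4:ℝ) ≠ 0)]
    exact (by linarith : |M| / V ≤ 1 + |M| / V).trans (le_self_pow₀ (by linarith) hn)
  calc M ≤ |M| := le_abs_self M
    _ = 1 * (|M| / V) * V := by field_simp
    _ ≤ _ := by gcongr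

lemma mub_closedBall_lt_top {n : ℕ} (ln : Fin n) {b : ℝ} (hb : 0 < b) (x : Eu n) (r : ℝ) :
    mub n ln b (Metric.closedBall x r) < ⊤ := by
  refine lt_of_le_of_lt (measure_mono (t := Metric.closedBall 0 (‖x‖ + |r|)) ?_)
    (lt_of_le_of_lt (mub_closedBall_le ln hb 0 (by positivity) (by simp)) ENNReal.ofReal_lt_top)
  refine Metric.closedBall_subset_closedBall' ?_
  rw [dist_zero_right]; linarith [le_abs_self r]

lemma isLocallyFiniteMeasure_mub {n : ℕ} (ln : Fin n) {b : ℝ} (hb : 0 < b) :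
    IsLocallyFiniteMeasure (mub n ln b) :=
  ⟨fun x => ⟨Metric.closedBall x 1, Metric.closedBall_mem_nhds x one_pos,
    mub_closedBall_lt_top ln hb x 1⟩⟩

lemma exists_cz {n : ℕ} (ln : Fin n) {b : ℝ} (hb : 0 < b) : ∃ D : ℝ, 1 ≤ D ∧
    ∀ (f : Eu n → ℝ), Continuous f → HasCompactSupport f → ∀ lam : ℝ, 0 < lam →
    ∃ (ι : Type) (_ : Countable ι) (Q : ι → Set (Eu n)) (c : ι → Eu n) (r : ι → ℝ),
      (∀ i, MeasurableSet (Q i)) ∧ Pairwise (fun i j => Disjoint (Q i) (Q j)) ∧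
      (∀ i, c i ∈ Hs ln) ∧ (∀ i, Q i ⊆ Metric.closedBall (c i) (r i)) ∧
      (∀ i, mub n ln b (Metric.closedBall (c i) (2 * r i)) ≤ ENNReal.ofReal D * mub n ln b (Q i)) ∧
      (∀ i, ENNReal.ofReal lam * mub n ln b (Q i) ≤ ∫⁻ x in Q i, ‖f x‖ₑ ∂(mub n ln b)) ∧
      (∀ i, ∫⁻ x in Q i, ‖f x‖ₑ ∂(mub n ln b) ≤ ENNReal.ofReal (D * lam) * mub n ln b (Q i)) ∧
      (∀ i, mub n ln b (Q i) ≠ 0) ∧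
      Bornology.IsBounded (⋃ i, Q i) ∧
      ∀ x ∈ Hs ln, x ∉ ⋃ i, Q i → |f x| ≤ lam := by
  obtain ⟨D, hD, hDb⟩ := mub_ball_le_cell ln hb
  refine ⟨D, hD, fun f hf hfc lam hlam => ?_⟩
  have hn : (1:ℝ) ≤ n := by exact_mod_cast (Fin.pos ln)
  set μ := mub n ln b with hμ
  have := isLocallyFiniteMeasure_mub ln hb
  have hfi : Integrable f μ := hf.integrable_of_hasCompactSupport hfc
  obtain ⟨L, hL, hLm⟩ := mub_cell_large ln hb (lam⁻¹ * (∫⁻ x, ‖f x‖ₑ ∂μ).toReal)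
  set ℓ : ℕ → ℝ := fun j => L / 2 ^ j with hℓd
  have hℓ : ∀ j, 0 < ℓ j := fun j => by positivity
  set bad : ℕ → (Fin n → ℤ) → Prop := fun j m =>
    ENNReal.ofReal lam * μ (cell (ℓ j) m) < ∫⁻ x in cell (ℓ j) m, ‖f x‖ₑ ∂μ with hbad
  have hneg : ∀ j m, bad j m → 0 ≤ m ln := by
    intro j m h
    by_contra! hm
    have h0 := mub_cell_eq_zero ln b (hℓ j) hm
    have : ∫⁻ x in cell (ℓ j) m, ‖f x‖ₑ ∂μ = 0 := setLIntegral_measure_zero _ _ h0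
    simp only [hbad, this, not_lt_zero] at h
  have hbad0 : ∀ m, ¬ bad 0 m := by
    intro m h
    have h1 := hLm m (hneg 0 m h)
    have e : ℓ 0 = L := by simp [hℓd]
    refine absurd h (not_lt.2 ?_)
    rw [e]
    calc ∫⁻ x in cell L m, ‖f x‖ₑ ∂μ ≤ ∫⁻ x, ‖f x‖ₑ ∂μ := setLIntegral_le_lintegral _ _
      _ = ENNReal.ofReal lam * ENNReal.ofReal (lam⁻¹ * (∫⁻ x, ‖f x‖ₑ ∂μ).toReal) := by
          rw [← ENNReal.ofReal_mul hlam.le, ← mul_assoc, mul_inv_cancel₀ hlam.ne', one_mul,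
            ENNReal.ofReal_toReal hfi.2.ne]
      _ ≤ _ := by gcongr
  set S : Set (ℕ × (Fin n → ℤ)) := {σ | bad σ.1 σ.2 ∧
    ∀ j < σ.1, ∀ x ∈ cell (ℓ σ.1) σ.2, ¬ bad j (idx (ℓ j) x)} with hS
  have hdist : ∀ j, ∀ x y : Eu n, idx (ℓ j) x = idx (ℓ j) y → dist x y ≤ n * ℓ j := by
    intro j x y h
    have h1 := dist_ctr_le (hℓ j) (m := idx (ℓ j) y) (x := x) h
    have h2 := dist_ctr_le (hℓ j) (m := idx (ℓ j) y) (x := y) rfl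
    have := dist_triangle_right x y (ctr (ℓ j) (idx (ℓ j) y))
    linarith
  refine ⟨S, inferInstance, fun σ => cell (ℓ σ.1.1) σ.1.2, fun σ => ctr (ℓ σ.1.1) σ.1.2,
    fun σ => n * ℓ σ.1.1, fun σ => measurableSet_cell _ _, ?_, ?_, ?_, ?_, ?_, ?_, ?_, ?_, ?_⟩
  · rintro ⟨⟨j, m⟩, h1, h2⟩ ⟨⟨j', m'⟩, h1', h2'⟩ hne
    rw [Set.disjoint_left]
    intro x hx hx'
    simp only [cell, mem_ofPred_eq] at hx hx'
    simp only at h1 h2 h1' h2'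
    rcases lt_trichotomy j j' with h | h | h
    · exact h2' j h x hx' (by rwa [hx])
    · subst h; apply hne; simp [← hx, ← hx']
    · exact h2 j' h x hx (by rwa [hx'])
  · rintro ⟨⟨j, m⟩, h1, h2⟩
    exact ctr_mem_Hs ln (hℓ j) (hneg j m h1)
  · rintro ⟨⟨j, m⟩, h1, h2⟩ x hx
    have := dist_ctr_le (hℓ j) hx
    have h3 := hℓ j
    simp only [Metric.mem_closedBall]
    nlinarith
  · rintro ⟨⟨j, m⟩, h1, h2⟩
    exact hDb _ _ (hℓ j) (hneg j m h1)
  · rintro ⟨⟨j, m⟩, h1, h2⟩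
    exact h1.le
  · rintro ⟨⟨j, m⟩, h1, h2⟩
    simp only at h1 h2 ⊢
    obtain _ | j := j
    · exact absurd h1 (hbad0 m)
    set x₀ := ctr (ℓ (j + 1)) m with hx₀
    have hx₀m : x₀ ∈ cell (ℓ (j + 1)) m := ctr_mem_cell (hℓ _) m
    have hp := h2 j (Nat.lt_succ_self j) x₀ hx₀m
    simp only [hbad, not_lt] at hp
    have hℓ2 : ℓ j = 2 * ℓ (j + 1) := by simp only [hℓd, pow_succ]; field_simp
    have hsub : cell (ℓ (j + 1)) m ⊆ cell (ℓ j) (idx (ℓ j) x₀) := fun z hz =>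
      idx_eq_of_le (ℓ := L) (Nat.le_succ j) (show idx (ℓ (j+1)) z = idx (ℓ (j+1)) x₀ from
        Eq.trans hz (Eq.symm hx₀m))
    calc _ ≤ ∫⁻ x in cell (ℓ j) (idx (ℓ j) x₀), ‖f x‖ₑ ∂μ := lintegral_mono_set hsub
      _ ≤ _ := hp
      _ ≤ ENNReal.ofReal lam * (ENNReal.ofReal D * μ (cell (ℓ (j + 1)) m)) := by
          gcongr
          refine (measure_mono ?_).trans (hDb _ _ (hℓ (j + 1)) (hneg _ m h1))
          intro z hz
          have := hdist j z x₀ hz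
          rw [Metric.mem_closedBall]
          rw [hℓ2] at this; linarith
      _ = _ := by rw [← mul_assoc, ← ENNReal.ofReal_mul hlam.le, mul_comm lam]
  · rintro ⟨⟨j, m⟩, h1, h2⟩ h0
    have : ∫⁻ x in cell (ℓ j) m, ‖f x‖ₑ ∂μ = 0 := setLIntegral_measure_zero _ _ h0
    simp only [hbad, this, not_lt_zero] at h1
  · obtain ⟨R, hR⟩ := hfc.isBounded.subset_closedBall 0
    refine (Metric.isBounded_closedBall (x := (0 : Eu n)) (r := R + n * L)).subset ?_
    refine iUnion_subset ?_
    rintro ⟨⟨j, m⟩, h1, h2⟩ x hx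
    have hex : ∃ z ∈ cell (ℓ j) m, f z ≠ 0 := by
      by_contra! hc
      have : ∫⁻ x in cell (ℓ j) m, ‖f x‖ₑ ∂μ = 0 := by
        rw [setLIntegral_congr_fun (g := fun _ => 0) (measurableSet_cell _ _)
          (fun z hz => by simp [hc z hz])]
        simp
      simp only [hbad, this, not_lt_zero] at h1
    obtain ⟨z, hz, hfz⟩ := hex
    have hzR := hR (subset_tsupport _ hfz)
    rw [Metric.mem_closedBall] at hzR ⊢
    have h3 := hdist j x z (Eq.trans hx (Eq.symm hz))
    have h4 : ℓ j ≤ L := div_le_self hL.le (one_le_pow₀ (by norm_num))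
    have h5 := dist_triangle x z 0
    nlinarith
  · intro x hx hxn
    have hnb : ∀ j, ¬ bad j (idx (ℓ j) x) := by
      intro j
      induction j using Nat.strong_induction_on with
      | _ j ih =>
        intro hj
        apply hxn
        rw [mem_iUnion]
        refine ⟨⟨(j, idx (ℓ j) x), hj, fun i hi z hz => ?_⟩, rfl⟩
        have : idx (ℓ i) z = idx (ℓ i) x := idx_eq_of_le (ℓ := L) hi.le hz
        rw [this]; exact ih i hi
    by_contra! hlt
    obtain ⟨lam', hl1, hl2⟩ := exists_between hlt
    have hev : ∀ᶠ z in 𝓝 x, lam' < |f z| := (hf.abs.continuousAt).eventually (lt_mem_nhds hl2)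
    obtain ⟨δ, hδ, hball⟩ := Metric.eventually_nhds_iff.1 hev
    obtain ⟨j, hj⟩ : ∃ j, n * ℓ j < δ := by
      obtain ⟨j, hj⟩ := exists_pow_lt_of_lt_one (y := (1/2:ℝ)) (show 0 < δ / (n * L) by positivity) (by norm_num)
      refine ⟨j, ?_⟩
      rw [lt_div_iff₀ (by positivity)] at hj
      simp only [hℓd, div_eq_mul_inv, one_mul, inv_pow] at hj ⊢
      linarith
    have h1 := hnb j
    simp only [hbad, not_lt] at h1
    set c := cell (ℓ j) (idx (ℓ j) x) with hc
    have hm0 : 0 ≤ idx (ℓ j) x ln := Int.floor_nonneg.2 (div_nonneg (le_of_lt hx) (hℓ j).le)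
    have hc0 : μ c ≠ 0 := by
      have h2 := mub_cell_ge ln hb (hℓ j) hm0
      refine (lt_of_lt_of_le ?_ h2).ne'
      rw [ENNReal.ofReal_pos]
      have := ctr_mem_Hs ln (hℓ j) hm0
      have hV : 0 < (volume (Metric.ball (0 : Eu n) 1)).toReal :=
        ENNReal.toReal_pos (Metric.measure_ball_pos _ _ one_pos).ne' measure_ball_lt_top.ne
      have := hℓ j
      have h3 : 0 < (ctr (ℓ j) (idx (ℓ j) x) ln) ^ b := Real.rpow_pos_of_pos (by assumption) _
      positivity
    have hct : μ c ≠ ⊤ := by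
      refine (lt_of_le_of_lt (measure_mono (t := Metric.closedBall x (n * ℓ j)) ?_)
        (mub_closedBall_lt_top ln hb _ _)).ne
      intro z hz
      exact hdist j z x hz
    have h2 : ENNReal.ofReal lam' * μ c ≤ ∫⁻ z in c, ‖f z‖ₑ ∂μ := by
      rw [← setLIntegral_const]
      refine setLIntegral_mono' (measurableSet_cell _ _) fun z hz => ?_
      rw [← ofReal_norm]
      exact ENNReal.ofReal_le_ofReal (hball (lt_of_le_of_lt (hdist j z x hz) hj)).le
    have h3 := h2.trans h1
    rw [ENNReal.mul_le_mul_iff_left hc0 hct, ENNReal.ofReal_le_ofReal_iff hlam.le] at h3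
    linarith

/-- Bounded measurable functions with bounded support. -/
structure BBS {n : ℕ} (f : Eu n → ℝ) : Prop where
  meas : Measurable f
  bdd : ∃ M, ∀ x, |f x| ≤ M
  supp : ∃ R, ∀ x, f x ≠ 0 → ‖x‖ ≤ R

/-- The integral operator with kernel `k` with respect to `mub`. -/
def opk (n : ℕ) (ln : Fin n) (b : ℝ) (k : Eu n → Eu n → ℝ) (f : Eu n → ℝ) (x : Eu n) : ℝ :=
  ∫ y, k x y * f y ∂(mub n ln b)

/-- A bounded kernel on the half-space satisfying an `L²` bound and Hörmander's condition. -/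
structure CZKer (n : ℕ) (ln : Fin n) (b : ℝ) (k : Eu n → Eu n → ℝ) (A : ℝ≥0∞) : Prop where
  meas : Measurable (Function.uncurry k)
  bdd : ∃ M, ∀ x ∈ Hs ln, ∀ y ∈ Hs ln, |k x y| ≤ M
  l2 : ∀ g, BBS g → ∫⁻ x, ‖opk n ln b k g x‖ₑ ^ (2:ℝ) ∂(mub n ln b) ≤
    A * ∫⁻ x, ‖g x‖ₑ ^ (2:ℝ) ∂(mub n ln b)
  hor : ∀ y ∈ Hs ln, ∀ c ∈ Hs ln, ∀ r, dist y c ≤ r →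
    ∫⁻ x in (Metric.closedBall c (2 * r))ᶜ, ‖k x y - k x c‖ₑ ∂(mub n ln b) ≤ A

lemma BBS.integrable {n : ℕ} {ln : Fin n} {b : ℝ} (hb : 0 < b) {f : Eu n → ℝ} (hf : BBS f) :
    Integrable f (mub n ln b) := by
  obtain ⟨M, hM⟩ := hf.bdd
  obtain ⟨R, hR⟩ := hf.supp
  rw [← integrableOn_iff_integrable_of_support_subset (s := Metric.closedBall 0 R)
    (fun x hx => by simpa using hR x hx)]
  exact IntegrableOn.of_bound (mub_closedBall_lt_top ln hb _ _) hf.meas.aestronglyMeasurable M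
    (ae_of_all _ hM)

lemma integrable_kernel_mul {n : ℕ} {ln : Fin n} {b : ℝ} {k : Eu n → Eu n → ℝ}
    (hk : Measurable (Function.uncurry k)) (hkb : ∃ M, ∀ x ∈ Hs ln, ∀ y ∈ Hs ln, |k x y| ≤ M)
    {g : Eu n → ℝ} (hg : Integrable g (mub n ln b)) {x : Eu n} (hx : x ∈ Hs ln) :
    Integrable (fun y => k x y * g y) (mub n ln b) := by
  obtain ⟨M, hM⟩ := hkb
  exact hg.bdd_mul (c := M) (hk.of_uncurry_left).aestronglyMeasurable
    ((ae_mub ln b).mono fun y hy => hM x hx y hy)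

lemma measurable_opk {n : ℕ} {ln : Fin n} {b : ℝ} {k : Eu n → Eu n → ℝ}
    (hk : Measurable (Function.uncurry k)) {g : Eu n → ℝ} (hg : Measurable g) :
    Measurable (opk n ln b k g) := by
  have : StronglyMeasurable (Function.uncurry fun x y => k x y * g y) :=
    (hk.mul (hg.comp measurable_snd)).stronglyMeasurable
  exact (this.integral_prod_right (ν := mub n ln b)).measurable

lemma exists_good {n : ℕ} {ι : Type} [Countable ι] {Q : ι → Set (Eu n)}
    (hQ : ∀ i, MeasurableSet (Q i)) (hd : Pairwise (fun i j => Disjoint (Q i) (Q j)))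
    {f : Eu n → ℝ} (hf : Measurable f) (a : ι → ℝ) :
    ∃ g : Eu n → ℝ, Measurable g ∧ (∀ i, ∀ x ∈ Q i, g x = a i) ∧ ∀ x, x ∉ ⋃ i, Q i → g x = f x := by
  obtain ⟨g, hg, h⟩ := exists_measurable_piecewise
    (fun o : Option ι => o.elim (⋃ i, Q i)ᶜ Q) (by
      rintro (_ | i)
      · exact (MeasurableSet.iUnion hQ).compl
      · exact hQ i) (fun o : Option ι => o.elim f (fun i _ => a i)) (by
      rintro (_ | i)
      · exact hf
      · exact measurable_const) (by
      rintro (_ | i) (_ | j) hij x hx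
      · rfl
      · exact absurd (mem_iUnion_of_mem j hx.2) hx.1
      · exact absurd (mem_iUnion_of_mem i hx.1) hx.2
      · exact absurd hx.2 (Set.disjoint_left.1 (hd (fun h => hij (by rw [h]))) hx.1))
  exact ⟨g, hg, fun i x hx => h (some i) hx, fun x hx => h none hx⟩

lemma weak_type {n : ℕ} (ln : Fin n) {b : ℝ} (hb : 0 < b) : ∃ D : ℝ, 1 ≤ D ∧
    ∀ (k : Eu n → Eu n → ℝ) (A : ℝ≥0∞), CZKer n ln b k A →
    ∀ f : Eu n → ℝ, Continuous f → HasCompactSupport f → ∀ lam : ℝ, 0 < lam →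
    ENNReal.ofReal lam * mub n ln b {x | 2 * lam < |opk n ln b k f x|} ≤
      (ENNReal.ofReal D * (1 + A) + 2 * A) * ∫⁻ x, ‖f x‖ₑ ∂(mub n ln b) := by
  obtain ⟨D, hD, hcz⟩ := exists_cz ln hb
  refine ⟨D, hD, fun k A hk f hf hfc lam hlam => ?_⟩
  obtain ⟨ι, _, Q, c, r, hQm, hQd, hcH, hQc, hdb, hlow, hup, hQ0, hEb, hoff⟩ :=
    hcz f hf hfc lam hlam
  set μ := mub n ln b with hμ
  have := isLocallyFiniteMeasure_mub ln hb
  have hfi : Integrable f μ := hf.integrable_of_hasCompactSupport hfc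
  obtain ⟨M, hM⟩ := hf.bounded_above_of_compact_support hfc
  have hM0 : 0 ≤ M := (norm_nonneg _).trans (hM 0)
  have hQt : ∀ i, μ (Q i) ≠ ⊤ := fun i h => by
    have h1 := (hlow i).trans (setLIntegral_le_lintegral _ _)
    rw [h, ENNReal.mul_top (by simpa using hlam)] at h1
    exact hfi.2.ne (top_le_iff.1 h1)
  set E := ⋃ i, Q i with hE
  have hEm : MeasurableSet E := MeasurableSet.iUnion hQm
  obtain ⟨R, hR⟩ := hEb.subset_closedBall 0
  obtain ⟨R', hR'⟩ := hfc.isBounded.subset_closedBall 0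
  set a : ι → ℝ := fun i => (μ (Q i)).toReal⁻¹ * ∫ x in Q i, f x ∂μ with ha
  have hap : ∀ i, 0 < (μ (Q i)).toReal := fun i => ENNReal.toReal_pos (hQ0 i) (hQt i)
  obtain ⟨g, hgm, hgQ, hgf⟩ := exists_good hQm hQd hf.measurable a
  have haQ : ∀ i, ‖a i‖ₑ * μ (Q i) ≤ ∫⁻ x in Q i, ‖f x‖ₑ ∂μ := by
    intro i
    refine le_trans (le_of_eq ?_) (enorm_integral_le_lintegral_enorm _)
    rw [ha]
    simp only
    rw [enorm_mul, enorm_inv (hap i).ne', Real.enorm_of_nonneg (hap i).le,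
      ENNReal.ofReal_toReal (hQt i), mul_right_comm, ENNReal.inv_mul_cancel (hQ0 i) (hQt i), one_mul]
  have haD : ∀ i, ‖a i‖ₑ ≤ ENNReal.ofReal (D * lam) := by
    intro i
    have h1 := (haQ i).trans (hup i)
    rwa [ENNReal.mul_le_mul_iff_left (hQ0 i) (hQt i)] at h1
  have haD' : ∀ i, |a i| ≤ D * lam := by
    intro i
    have := haD i
    rwa [← ofReal_norm, ENNReal.ofReal_le_ofReal_iff (by positivity)] at this
  have hgB : ∀ x, |g x| ≤ M + D * lam := by
    intro x
    by_cases hx : x ∈ E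
    · obtain ⟨i, hi⟩ := mem_iUnion.1 hx
      rw [hgQ i x hi]; linarith [haD' i]
    · rw [hgf x hx]
      have := hM x
      rw [Real.norm_eq_abs] at this
      have : 0 ≤ D * lam := by positivity
      linarith
  have hgH : ∀ x ∈ Hs ln, ‖g x‖ₑ ≤ ENNReal.ofReal (D * lam) := by
    intro x hx
    by_cases hxE : x ∈ E
    · obtain ⟨i, hi⟩ := mem_iUnion.1 hxE
      rw [hgQ i x hi]; exact haD i
    · rw [hgf x hxE, ← ofReal_norm]
      refine ENNReal.ofReal_le_ofReal ((hoff x hx hxE).trans ?_)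
      nlinarith
  have hgS : BBS g := ⟨hgm, ⟨_, hgB⟩, max R R', fun x hx => by
    by_cases hxE : x ∈ E
    · exact le_max_of_le_left (by simpa using hR hxE)
    · rw [hgf x hxE] at hx
      exact le_max_of_le_right (by simpa using hR' (subset_tsupport _ hx))⟩
  have hgi : Integrable g μ := hgS.integrable hb
  have hQint : ∀ F : Eu n → ℝ≥0∞, ∑' i, ∫⁻ x in Q i, F x ∂μ = ∫⁻ x in E, F x ∂μ := fun F =>
    (lintegral_iUnion hQm hQd F).symm
  have hgQ1 : ∀ i, ∫⁻ x in Q i, ‖g x‖ₑ ∂μ ≤ ∫⁻ x in Q i, ‖f x‖ₑ ∂μ := fun i => by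
    rw [setLIntegral_congr_fun (g := fun _ => ‖a i‖ₑ) (hQm i) (fun x hx => by simp [hgQ i x hx]),
      setLIntegral_const]
    exact haQ i
  have hg1 : ∫⁻ x, ‖g x‖ₑ ∂μ ≤ ∫⁻ x, ‖f x‖ₑ ∂μ := by
    rw [← lintegral_add_compl _ hEm, ← lintegral_add_compl (fun x => ‖f x‖ₑ) hEm, ← hQint, ← hQint]
    refine add_le_add (ENNReal.tsum_le_tsum hgQ1) (le_of_eq ?_)
    exact setLIntegral_congr_fun hEm.compl (fun x hx => by simp [hgf x hx])
  set F1 := ∫⁻ x, ‖f x‖ₑ ∂μ with hF1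
  set Ω := ⋃ i, Metric.closedBall (c i) (2 * r i) with hΩ
  have hΩm : MeasurableSet Ω := MeasurableSet.iUnion fun i => Metric.isClosed_closedBall.measurableSet
  -- the exceptional set
  have hΩ1 : ENNReal.ofReal lam * μ Ω ≤ ENNReal.ofReal D * F1 := by
    calc _ ≤ ENNReal.ofReal lam * ∑' i, ENNReal.ofReal D * μ (Q i) := by
          gcongr
          exact (measure_iUnion_le _).trans (ENNReal.tsum_le_tsum hdb)
      _ = ENNReal.ofReal D * ∑' i, ENNReal.ofReal lam * μ (Q i) := by
          rw [ENNReal.tsum_mul_left, ENNReal.tsum_mul_left, mul_left_comm]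
      _ ≤ ENNReal.ofReal D * ∑' i, ∫⁻ x in Q i, ‖f x‖ₑ ∂μ := by
          gcongr with i; exact hlow i
      _ ≤ _ := by
          rw [hQint]; gcongr; exact setLIntegral_le_lintegral _ _
  -- the good part
  have hgood : ENNReal.ofReal lam * μ {x | lam < |opk n ln b k g x|} ≤ A * ENNReal.ofReal D * F1 := by
    have h1 : ENNReal.ofReal lam ^ (2:ℝ) * μ {x | lam < |opk n ln b k g x|} ≤
        A * (ENNReal.ofReal lam * (ENNReal.ofReal D * F1)) := by
      calc _ ≤ ENNReal.ofReal lam ^ (2:ℝ) *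
            μ {x | ENNReal.ofReal lam ^ (2:ℝ) ≤ ‖opk n ln b k g x‖ₑ ^ (2:ℝ)} := by
            refine mul_le_mul_right (measure_mono fun x hx => ?_) _
            simp only [mem_ofPred_eq] at hx ⊢
            gcongr
            rw [← ofReal_norm]
            exact ENNReal.ofReal_le_ofReal hx.le
        _ ≤ ∫⁻ x, ‖opk n ln b k g x‖ₑ ^ (2:ℝ) ∂μ :=
            mul_meas_ge_le_lintegral₀ ((measurable_opk hk.meas hgm).enorm.pow_const _).aemeasurable _
        _ ≤ A * ∫⁻ x, ‖g x‖ₑ ^ (2:ℝ) ∂μ := hk.l2 g hgS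
        _ ≤ A * ∫⁻ x, ENNReal.ofReal (D * lam) * ‖g x‖ₑ ∂μ := by
            gcongr 1
            refine lintegral_mono_ae ((ae_mub ln b).mono fun x hx => ?_)
            rw [show (2:ℝ) = 1 + 1 by norm_num, ENNReal.rpow_add_of_nonneg _ _ zero_le_one zero_le_one,
              ENNReal.rpow_one]
            gcongr
            exact hgH x hx
        _ ≤ _ := by
            rw [lintegral_const_mul _ hgm.enorm, mul_comm D lam, ENNReal.ofReal_mul hlam.le, mul_assoc]
            gcongr
    have hl0 : ENNReal.ofReal lam ≠ 0 := by simpa using hlam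
    rw [show (2:ℝ) = 1 + 1 by norm_num, ENNReal.rpow_add_of_nonneg _ _ zero_le_one zero_le_one,
      ENNReal.rpow_one, mul_assoc, mul_left_comm A,
      ENNReal.mul_le_mul_iff_right hl0 ENNReal.ofReal_ne_top] at h1
    rwa [mul_assoc A]
  -- the bad part
  set h : Eu n → ℝ := fun x => f x - g x with hh
  have hhm : Measurable h := hf.measurable.sub hgm
  have hhi : Integrable h μ := hfi.sub hgi
  have hh0 : ∀ x ∉ E, h x = 0 := fun x hx => by simp [hh, hgf x hx]
  have hhQ : ∀ i, ∫ x in Q i, h x ∂μ = 0 := by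
    intro i
    have e1 : ∫ x in Q i, g x ∂μ = ∫ x in Q i, a i ∂μ :=
      setIntegral_congr_fun (hQm i) (fun x hx => hgQ i x hx)
    rw [hh, integral_sub hfi.integrableOn hgi.integrableOn, e1, setIntegral_const, ha, smul_eq_mul,
      Measure.real, mul_inv_cancel_left₀ (hap i).ne', sub_self]
  have hpt : ∀ x ∈ Hs ln, ‖opk n ln b k h x‖ₑ ≤
      ∑' i, ∫⁻ y in Q i, ‖k x y - k x (c i)‖ₑ * ‖h y‖ₑ ∂μ := by
    intro x hx
    have hi := integrable_kernel_mul hk.meas hk.bdd hhi hx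
    have e : opk n ln b k h x = ∑' i, ∫ y in Q i, k x y * h y ∂μ := by
      rw [opk, ← integral_iUnion hQm hQd hi.integrableOn,
        setIntegral_eq_integral_of_forall_compl_eq_zero]
      intro y hy; rw [hh0 y hy, mul_zero]
    rw [e]
    refine enorm_tsum_le_tsum_enorm.trans (ENNReal.tsum_le_tsum fun i => ?_)
    have e2 : ∫ y in Q i, k x y * h y ∂μ = ∫ y in Q i, (k x y - k x (c i)) * h y ∂μ := by
      simp only [sub_mul]
      rw [integral_sub hi.integrableOn (hhi.integrableOn.const_mul _), integral_const_mul, hhQ i,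
        mul_zero, sub_zero]
    rw [e2]
    refine (enorm_integral_le_lintegral_enorm _).trans (le_of_eq ?_)
    simp only [enorm_mul]
  have hkm : ∀ i, Measurable (Function.uncurry fun x y => ‖k x y - k x (c i)‖ₑ * ‖h y‖ₑ) := fun i => by
    have h1 : Measurable fun z : Eu n × Eu n => k z.1 (c i) :=
      (hk.meas.of_uncurry_right (y := c i)).comp measurable_fst
    have h2 : Measurable fun z : Eu n × Eu n => k z.1 z.2 := hk.meas
    exact ((h2.sub h1).enorm).mul (hhm.comp measurable_snd).enorm
  have hbad : ∫⁻ x in Ωᶜ, ‖opk n ln b k h x‖ₑ ∂μ ≤ 2 * A * F1 := by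
    calc _ ≤ ∫⁻ x in Ωᶜ, ∑' i, ∫⁻ y in Q i, ‖k x y - k x (c i)‖ₑ * ‖h y‖ₑ ∂μ ∂μ :=
          lintegral_mono_ae (ae_restrict_of_ae ((ae_mub ln b).mono hpt))
      _ = ∑' i, ∫⁻ x in Ωᶜ, ∫⁻ y in Q i, ‖k x y - k x (c i)‖ₑ * ‖h y‖ₑ ∂μ ∂μ :=
          lintegral_tsum fun i => ((hkm i).lintegral_prod_right).aemeasurable
      _ = ∑' i, ∫⁻ y in Q i, ∫⁻ x in Ωᶜ, ‖k x y - k x (c i)‖ₑ * ‖h y‖ₑ ∂μ ∂μ := by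
          congr 1; funext i
          exact lintegral_lintegral_swap (hkm i).aemeasurable
      _ ≤ ∑' i, ∫⁻ y in Q i, A * ‖h y‖ₑ ∂μ := by
          refine ENNReal.tsum_le_tsum fun i => lintegral_mono_ae ?_
          filter_upwards [ae_restrict_of_ae (ae_mub ln b), ae_restrict_mem (hQm i)] with y hy hyQ
          have hm1 : Measurable fun x => ‖k x y - k x (c i)‖ₑ :=
            ((hk.meas.of_uncurry_right (y := y)).sub (hk.meas.of_uncurry_right (y := c i))).enorm
          rw [lintegral_mul_const _ hm1]
          gcongr
          refine (lintegral_mono_set ?_).trans (hk.hor y hy (c i) (hcH i) (r i) (hQc i hyQ))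
          exact compl_subset_compl.2 (subset_iUnion (fun i => Metric.closedBall (c i) (2 * r i)) i)
      _ = A * ∫⁻ y in E, ‖h y‖ₑ ∂μ := by
          rw [hQint, lintegral_const_mul _ hhm.enorm]
      _ ≤ A * (F1 + F1) := by
          gcongr
          calc _ ≤ ∫⁻ y, ‖f y‖ₑ + ‖g y‖ₑ ∂μ :=
                (setLIntegral_le_lintegral _ _).trans (lintegral_mono fun y => enorm_sub_le)
            _ = F1 + ∫⁻ y, ‖g y‖ₑ ∂μ := lintegral_add_left hf.measurable.enorm _
            _ ≤ _ := by gcongr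
      _ = _ := by ring
  have hbad' : ENNReal.ofReal lam * μ ({x | lam < |opk n ln b k h x|} ∩ Ωᶜ) ≤ 2 * A * F1 := by
    refine le_trans ?_ hbad
    have hm1 := (measurable_opk (ln := ln) (b := b) hk.meas hhm).enorm
    refine le_trans ?_ (mul_meas_ge_le_lintegral₀ (μ := μ.restrict Ωᶜ) hm1.aemeasurable
      (ENNReal.ofReal lam))
    have hms : MeasurableSet {x | ENNReal.ofReal lam ≤ ‖opk n ln b k h x‖ₑ} := hm1 measurableSet_Ici
    rw [Measure.restrict_apply hms]
    refine mul_le_mul_right (measure_mono (inter_subset_inter_left _ fun x hx => ?_)) _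
    simp only [mem_ofPred_eq] at hx ⊢
    rw [← ofReal_norm]
    exact ENNReal.ofReal_le_ofReal hx.le
  have hsum : ∀ x ∈ Hs ln, opk n ln b k f x = opk n ln b k g x + opk n ln b k h x := by
    intro x hx
    rw [opk, opk, opk, ← integral_add (integrable_kernel_mul hk.meas hk.bdd hgi hx)
      (integrable_kernel_mul hk.meas hk.bdd hhi hx)]
    congr 1; funext y; simp only [hh]; ring
  have hcover : μ {x | 2 * lam < |opk n ln b k f x|} ≤ μ {x | lam < |opk n ln b k g x|} +
      (μ ({x | lam < |opk n ln b k h x|} ∩ Ωᶜ) + μ Ω) := by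
    refine le_trans ?_ ((measure_union_le _ _).trans (add_le_add le_rfl (measure_union_le _ _)))
    refine measure_mono_ae ((ae_mub ln b).mono fun x hx h1 => ?_)
    have h2 : 2 * lam < |opk n ln b k f x| := h1
    rw [hsum x hx] at h2
    by_cases h3 : lam < |opk n ln b k g x|
    · exact Or.inl h3
    · by_cases h4 : x ∈ Ω
      · exact Or.inr (Or.inr h4)
      · refine Or.inr (Or.inl ⟨?_, h4⟩)
        have := abs_add_le (opk n ln b k g x) (opk n ln b k h x)
        show lam < _
        linarith
  calc _ ≤ ENNReal.ofReal lam * (μ {x | lam < |opk n ln b k g x|} +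
      (μ ({x | lam < |opk n ln b k h x|} ∩ Ωᶜ) + μ Ω)) := mul_le_mul_right hcover _
    _ ≤ A * ENNReal.ofReal D * F1 + (2 * A * F1 + ENNReal.ofReal D * F1) := by
        rw [mul_add, mul_add]; gcongr
    _ = _ := by ring

/-- Truncation to `[-lam, lam]`. -/
def clip (lam s : ℝ) : ℝ := max (-lam) (min s lam)

lemma continuous_clip (lam : ℝ) : Continuous (clip lam) := by unfold clip; fun_prop

lemma clip_zero {lam : ℝ} (h : 0 ≤ lam) : clip lam 0 = 0 := by
  unfold clip; rw [min_eq_left h, max_eq_right (by linarith)]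

lemma abs_clip {lam s : ℝ} (h : 0 ≤ lam) : |clip lam s| = min |s| lam := by
  unfold clip
  rcases abs_cases s with ⟨h1, h2⟩ | ⟨h1, h2⟩ <;> rcases le_total |s| lam with h3 | h3 <;>
    rw [h1] at h3 ⊢
  · rw [min_eq_left h3, max_eq_right (by linarith), h1]
  · rw [min_eq_right h3, max_eq_right (by linarith), abs_of_nonneg h]
  · rw [min_eq_left (by linarith : s ≤ lam), max_eq_right (by linarith), min_eq_left h3, h1]
  · rw [min_eq_left (by linarith : s ≤ lam), max_eq_left (by linarith), min_eq_right h3, abs_neg,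
      abs_of_nonneg h]

lemma abs_sub_clip {lam s : ℝ} (h : 0 ≤ lam) : |s - clip lam s| = |s| - min |s| lam := by
  unfold clip
  rcases abs_cases s with ⟨h1, h2⟩ | ⟨h1, h2⟩ <;> rcases le_total |s| lam with h3 | h3 <;>
    rw [h1] at h3 ⊢
  · rw [min_eq_left h3, max_eq_right (by linarith), sub_self, abs_zero]
  · rw [min_eq_right h3, max_eq_right (by linarith), abs_of_nonneg (by linarith)]
  · rw [min_eq_left (by linarith : s ≤ lam), max_eq_right (by linarith), min_eq_left h3]; simp
  · rw [min_eq_left (by linarith : s ≤ lam), max_eq_left (by linarith), min_eq_right h3,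
      abs_of_nonpos (by linarith)]; ring

lemma clip_eq_self {lam s : ℝ} (h : |s| ≤ lam) : clip lam s = s := by
  have := abs_sub_clip (s := s) ((abs_nonneg s).trans h)
  rw [min_eq_left h, sub_self, abs_eq_zero] at this
  linarith

lemma abs_clip_sub_clip_le (lam s t : ℝ) : |clip lam s - clip lam t| ≤ |s - t| := by
  unfold clip
  refine (abs_max_sub_max_le_max _ _ _ _).trans ?_
  rw [sub_self, abs_zero, max_eq_right (abs_nonneg _)]
  refine (abs_min_sub_min_le_max _ _ _ _).trans ?_
  rw [sub_self, abs_zero, max_eq_left (abs_nonneg _)]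

lemma BBS.of_continuous {n : ℕ} {f : Eu n → ℝ} (hf : Continuous f) (hfc : HasCompactSupport f) :
    BBS f := by
  obtain ⟨M, hM⟩ := hf.bounded_above_of_compact_support hfc
  obtain ⟨R', hR'⟩ := hfc.isBounded.subset_closedBall 0
  exact ⟨hf.measurable, ⟨M, hM⟩, R', fun x hx => by simpa using hR' (subset_tsupport _ hx)⟩

lemma opk_add {n : ℕ} {ln : Fin n} {b : ℝ} {k : Eu n → Eu n → ℝ}
    (hk : Measurable (Function.uncurry k)) (hkb : ∃ M, ∀ x ∈ Hs ln, ∀ y ∈ Hs ln, |k x y| ≤ M)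
    {g h : Eu n → ℝ} (hg : Integrable g (mub n ln b)) (hh : Integrable h (mub n ln b))
    {x : Eu n} (hx : x ∈ Hs ln) :
    opk n ln b k (fun y => g y + h y) x = opk n ln b k g x + opk n ln b k h x := by
  rw [opk, opk, opk, ← integral_add (integrable_kernel_mul hk hkb hg hx)
      (integrable_kernel_mul hk hkb hh hx)]
  congr 1; funext y; ring

/-- The Marcinkiewicz integrand. -/
def mzk (p : ℝ) (W A : ℝ≥0∞) (t lam : ℝ) : ℝ≥0∞ :=
  ENNReal.ofReal (lam ^ (p - 2)) * (W * ENNReal.ofReal (t - min t lam)) +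
    ENNReal.ofReal (lam ^ (p - 3)) * (A * ENNReal.ofReal ((min t lam) ^ 2))

lemma measurable_mzk (p : ℝ) (W A : ℝ≥0∞) :
    Measurable fun z : ℝ × ℝ => mzk p W A z.1 z.2 := by unfold mzk; fun_prop

lemma lintegral_mzk_le {p : ℝ} (hp1 : 1 < p) (hp2 : p < 2) (W A : ℝ≥0∞) {t : ℝ} (ht : 0 ≤ t) :
    ∫⁻ lam in Ioi 0, mzk p W A t lam ≤
      ((W + A) * ENNReal.ofReal (1 / (p - 1)) + A * ENNReal.ofReal (1 / (2 - p))) *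
        ENNReal.ofReal (t ^ p) := by
  rcases ht.eq_or_lt with rfl | ht
  · rw [setLIntegral_congr_fun (g := fun _ => 0) measurableSet_Ioi (fun l hl => by
      have : min 0 l = 0 := min_eq_left (le_of_lt hl)
      simp [mzk, this])]
    simp
  have e : Ioi (0:ℝ) ⊆ Ioo 0 t ∪ Ici t := fun l hl => by
    rcases lt_or_ge l t with h | h
    · exact Or.inl ⟨hl, h⟩
    · exact Or.inr h
  have h1 : ∫⁻ lam in Ioo 0 t, mzk p W A t lam ≤
      (W + A) * ENNReal.ofReal (1 / (p - 1)) * ENNReal.ofReal (t ^ p) := by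
    calc _ ≤ ∫⁻ lam in Ioo 0 t, ((W + A) * ENNReal.ofReal t) * ENNReal.ofReal (lam ^ (p - 2)) := by
          refine setLIntegral_mono' measurableSet_Ioo fun l hl => ?_
          have e1 : min t l = l := min_eq_right hl.2.le
          have e2 : l ^ (p - 3) * l ^ 2 = l ^ (p - 2) * l := by
            rw [← Real.rpow_natCast, ← Real.rpow_add hl.1, ← Real.rpow_add_one hl.1.ne']
            congr 1; push_cast; ring
          rw [mzk, e1, add_mul, add_mul]
          refine add_le_add ?_ ?_
          · rw [mul_comm]; gcongr; linarith [hl.1]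
          · rw [mul_left_comm, ← ENNReal.ofReal_mul (Real.rpow_nonneg hl.1.le _), e2, mul_assoc,
              ← ENNReal.ofReal_mul ht.le, mul_comm t]
            gcongr
            · exact Real.rpow_nonneg hl.1.le _
            · exact hl.2.le
      _ = _ := by
          rw [lintegral_const_mul _ (by fun_prop), lintegral_rpow_Ioo (by linarith) ht.le, mul_assoc,
            mul_assoc, ← ENNReal.ofReal_mul ht.le, ← ENNReal.ofReal_mul (by
              have : 0 < p - 1 := by linarith
              positivity)]
          congr 2
          have : t ^ p = t * t ^ (p - 1) := by
            rw [mul_comm, ← Real.rpow_add_one ht.ne']; congr 1; ring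
          rw [this, show p - 2 + 1 = p - 1 by ring]; ring
  have h2 : ∫⁻ lam in Ici t, mzk p W A t lam ≤
      A * ENNReal.ofReal (1 / (2 - p)) * ENNReal.ofReal (t ^ p) := by
    calc _ ≤ ∫⁻ lam in Ici t, (A * ENNReal.ofReal (t ^ 2)) * ENNReal.ofReal (lam ^ (p - 3)) := by
          refine setLIntegral_mono' measurableSet_Ici fun l hl => ?_
          have e1 : min t l = t := min_eq_left hl
          rw [mzk, e1, sub_self, ENNReal.ofReal_zero, mul_zero, mul_zero, zero_add, mul_comm]
      _ = _ := by
          rw [lintegral_const_mul _ (by fun_prop), setLIntegral_congr Ioi_ae_eq_Ici.symm,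
            lintegral_rpow_Ioi (by linarith) ht, mul_assoc,
            mul_assoc, ← ENNReal.ofReal_mul (by positivity), ← ENNReal.ofReal_mul (by
              have : 0 < 2 - p := by linarith
              positivity)]
          congr 2
          have : t ^ p = t ^ 2 * t ^ (p - 2) := by
            rw [← Real.rpow_natCast, ← Real.rpow_add ht]; congr 1; push_cast; ring
          rw [this, show p - 3 + 1 = -(2 - p) by ring, show p - 2 = -(2 - p) by ring, neg_div_neg_eq]; ring
  calc _ ≤ _ := lintegral_mono_set e
    _ ≤ _ := lintegral_union_le _ _ _
    _ ≤ _ := add_le_add h1 h2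
    _ = _ := by ring

set_option maxHeartbeats 1000000 in
lemma cz_Lp_aux {n : ℕ} (ln : Fin n) {b : ℝ} (hb : 0 < b) {p : ℝ} (hp1 : 1 < p) (hp2 : p < 2)
    {A : ℝ≥0∞} (hA : A ≠ ⊤) : ∃ C : ℝ≥0∞, C ≠ ⊤ ∧ ∀ k, CZKer n ln b k A →
    ∀ f : Eu n → ℝ, Continuous f → HasCompactSupport f →
      ∫⁻ x, ‖opk n ln b k f x‖ₑ ^ p ∂(mub n ln b) ≤ C * ∫⁻ x, ‖f x‖ₑ ^ p ∂(mub n ln b) := by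
  obtain ⟨D, hD, hweak⟩ := weak_type ln hb
  set W : ℝ≥0∞ := ENNReal.ofReal D * (1 + A) + 2 * A with hW
  have hWt : W ≠ ⊤ := by
    rw [hW]; finiteness
  refine ⟨ENNReal.ofReal (4 ^ p) * (ENNReal.ofReal p *
    ((W + A) * ENNReal.ofReal (1 / (p - 1)) + A * ENNReal.ofReal (1 / (2 - p)))), by finiteness,
    fun k hk f hf hfc => ?_⟩
  set μ := mub n ln b with hμ
  have hp0 : 0 < p := by linarith
  have hTm := measurable_opk (ln := ln) (b := b) hk.meas hf.measurable
  have e0 : ∫⁻ x, ‖opk n ln b k f x‖ₑ ^ p ∂μ =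
      ENNReal.ofReal (4 ^ p) * ∫⁻ x, ENNReal.ofReal ((|opk n ln b k f x| / 4) ^ p) ∂μ := by
    rw [← lintegral_const_mul _ (by fun_prop)]
    refine lintegral_congr fun x => ?_
    rw [← ENNReal.ofReal_mul (by positivity), ← Real.mul_rpow (by norm_num) (by positivity),
      mul_div_cancel₀ _ (by norm_num), ← ofReal_norm, ENNReal.ofReal_rpow_of_nonneg (norm_nonneg _) hp0.le]
    rfl
  rw [e0, lintegral_rpow_eq_lintegral_meas_lt_mul μ (ae_of_all _ fun x => by positivity)
    (by fun_prop) hp0, mul_assoc, mul_assoc]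
  refine mul_le_mul_right (mul_le_mul_right ?_ _) _
  have hl : ∀ lam ∈ Ioi (0:ℝ), μ {x | lam < |opk n ln b k f x| / 4} * ENNReal.ofReal (lam ^ (p - 1)) ≤
      ∫⁻ x, mzk p W A |f x| lam ∂μ := by
    intro lam hlam
    have hlam : 0 < lam := hlam
    set f1 : Eu n → ℝ := fun x => clip lam (f x) with hf1
    set f2 : Eu n → ℝ := fun x => f x - clip lam (f x) with hf2
    have hf1c : Continuous f1 := (continuous_clip lam).comp hf
    have hf2c : Continuous f2 := hf.sub hf1c
    have hf1s : HasCompactSupport f1 := hfc.comp_left (clip_zero hlam.le)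
    have hf2s : HasCompactSupport f2 := hfc.comp_left (g := fun s => s - clip lam s)
      (by simp [clip_zero hlam.le])
    have hB1 := BBS.of_continuous hf1c hf1s
    have hB2 := BBS.of_continuous hf2c hf2s
    have w2 := hweak k A hk f2 hf2c hf2s lam hlam
    have w1 : ENNReal.ofReal lam ^ (2:ℝ) * μ {x | 2 * lam < |opk n ln b k f1 x|} ≤
        A * ∫⁻ x, ‖f1 x‖ₑ ^ (2:ℝ) ∂μ := by
      refine le_trans ?_ (hk.l2 f1 hB1)
      refine le_trans ?_ (mul_meas_ge_le_lintegral₀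
        ((measurable_opk hk.meas hf1c.measurable).enorm.pow_const _).aemeasurable
          (ENNReal.ofReal lam ^ (2:ℝ)))
      refine mul_le_mul_right (measure_mono fun x hx => ?_) _
      simp only [mem_ofPred_eq] at hx ⊢
      gcongr
      rw [← ofReal_norm]
      refine ENNReal.ofReal_le_ofReal (le_trans ?_ (le_of_lt hx))
      linarith
    have hc : μ {x | lam < |opk n ln b k f x| / 4} ≤
        μ {x | 2 * lam < |opk n ln b k f2 x|} + μ {x | 2 * lam < |opk n ln b k f1 x|} := by
      refine le_trans ?_ (measure_union_le _ _)
      refine measure_mono_ae ((ae_mub ln b).mono fun x hx h1 => ?_)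
      have h2 : lam < |opk n ln b k f x| / 4 := h1
      have h3 : opk n ln b k f x = opk n ln b k f2 x + opk n ln b k f1 x := by
        rw [← opk_add hk.meas hk.bdd (hB2.integrable hb) (hB1.integrable hb) hx]
        simp [hf1, hf2]
      rw [h3] at h2
      have h4 := abs_add_le (opk n ln b k f2 x) (opk n ln b k f1 x)
      by_cases h5 : 2 * lam < |opk n ln b k f2 x|
      · exact Or.inl h5
      · refine Or.inr ?_
        show 2 * lam < _
        linarith
    have er2 : ENNReal.ofReal (lam ^ (p - 1)) = ENNReal.ofReal (lam ^ (p - 2)) * ENNReal.ofReal lam := by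
      rw [← ENNReal.ofReal_mul (by positivity), ← Real.rpow_add_one hlam.ne']
      congr 2; ring
    have er1 : ENNReal.ofReal (lam ^ (p - 1)) =
        ENNReal.ofReal (lam ^ (p - 3)) * ENNReal.ofReal lam ^ (2:ℝ) := by
      rw [ENNReal.ofReal_rpow_of_pos hlam, ← ENNReal.ofReal_mul (by positivity), ← Real.rpow_add hlam]
      congr 2; ring
    have i2 : W * ∫⁻ x, ‖f2 x‖ₑ ∂μ = ∫⁻ x, W * ENNReal.ofReal (|f x| - min |f x| lam) ∂μ := by
      rw [lintegral_const_mul' _ _ hWt]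
      congr 1
      refine lintegral_congr fun x => ?_
      rw [← ofReal_norm, Real.norm_eq_abs, abs_sub_clip hlam.le]
    have i1 : A * ∫⁻ x, ‖f1 x‖ₑ ^ (2:ℝ) ∂μ = ∫⁻ x, A * ENNReal.ofReal ((min |f x| lam) ^ 2) ∂μ := by
      rw [lintegral_const_mul' _ _ hA]
      congr 1
      refine lintegral_congr fun x => ?_
      rw [← ofReal_norm, Real.norm_eq_abs, abs_clip hlam.le, ENNReal.rpow_ofNat,
        ENNReal.ofReal_pow (by positivity)]
    have hfm := hf.measurable
    calc _ ≤ (μ {x | 2 * lam < |opk n ln b k f2 x|} + μ {x | 2 * lam < |opk n ln b k f1 x|}) *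
          ENNReal.ofReal (lam ^ (p - 1)) := by gcongr
      _ = ENNReal.ofReal (lam ^ (p - 2)) * (ENNReal.ofReal lam * μ {x | 2 * lam < |opk n ln b k f2 x|}) +
          ENNReal.ofReal (lam ^ (p - 3)) *
            (ENNReal.ofReal lam ^ (2:ℝ) * μ {x | 2 * lam < |opk n ln b k f1 x|}) := by
          rw [add_mul]
          nth_rw 1 [er2]
          rw [er1]
          ring
      _ ≤ ENNReal.ofReal (lam ^ (p - 2)) * (W * ∫⁻ x, ‖f2 x‖ₑ ∂μ) +
          ENNReal.ofReal (lam ^ (p - 3)) * (A * ∫⁻ x, ‖f1 x‖ₑ ^ (2:ℝ) ∂μ) := by gcongr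
      _ = _ := by
          simp only [mzk]
          rw [i1, i2, ← lintegral_const_mul _ (by fun_prop), ← lintegral_const_mul _ (by fun_prop),
            ← lintegral_add_left (by fun_prop)]
  have hmz : Measurable (Function.uncurry fun (lam : ℝ) (x : Eu n) => mzk p W A |f x| lam) := by
    have hfm := hf.measurable
    have h1 : Measurable fun z : ℝ × Eu n => (|f z.2|, z.1) := by fun_prop
    exact (measurable_mzk p W A).comp h1
  calc _ ≤ ∫⁻ lam in Ioi (0:ℝ), (∫⁻ x, mzk p W A |f x| lam ∂μ) := setLIntegral_mono' measurableSet_Ioi hl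
    _ = ∫⁻ x, (∫⁻ lam in Ioi (0:ℝ), mzk p W A |f x| lam) ∂μ := by
        exact lintegral_lintegral_swap hmz.aemeasurable
    _ ≤ ∫⁻ x, ((W + A) * ENNReal.ofReal (1 / (p - 1)) + A * ENNReal.ofReal (1 / (2 - p))) *
        ENNReal.ofReal (|f x| ^ p) ∂μ := lintegral_mono fun x => lintegral_mzk_le hp1 hp2 W A (abs_nonneg _)
    _ = _ := by
        have hfm := hf.measurable
        rw [lintegral_const_mul _ (by fun_prop)]
        congr 1
        refine lintegral_congr fun x => ?_
        rw [← ofReal_norm, ENNReal.ofReal_rpow_of_nonneg (norm_nonneg _) hp0.le, Real.norm_eq_abs]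

lemma enorm_add_rpow_le {p : ℝ} (hp : 1 ≤ p) (a b : ℝ) :
    ‖a + b‖ₑ ^ p ≤ ENNReal.ofReal (2 ^ (p - 1)) * (‖a‖ₑ ^ p + ‖b‖ₑ ^ p) := by
  have e : ENNReal.ofReal (2 ^ (p - 1)) = 2 ^ (p - 1) := by
    rw [← ENNReal.ofReal_rpow_of_pos (by norm_num)]; norm_num
  rw [e]
  refine le_trans ?_ (ENNReal.rpow_add_le_mul_rpow_add_rpow _ _ hp)
  gcongr
  exact enorm_add_le _ _

lemma BBS.lintegral_rpow_lt_top {n : ℕ} {ln : Fin n} {b : ℝ} (hb : 0 < b) {f : Eu n → ℝ}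
    (hf : BBS f) {p : ℝ} (hp : 0 < p) : ∫⁻ x, ‖f x‖ₑ ^ p ∂(mub n ln b) < ⊤ := by
  have h2 : BBS (fun x => |f x| ^ p) := by
    obtain ⟨M, hM⟩ := hf.bdd
    obtain ⟨R, hR⟩ := hf.supp
    have := hf.meas
    refine ⟨by fun_prop, ⟨M ^ p, fun x => ?_⟩, R, fun x hx => hR x fun h0 => hx ?_⟩
    · rw [abs_of_nonneg (by positivity)]
      exact Real.rpow_le_rpow (abs_nonneg _) (hM x) hp.le
    · rw [h0, abs_zero, Real.zero_rpow hp.ne']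
  have h3 := (h2.integrable (ln := ln) hb).2
  refine lt_of_eq_of_lt (lintegral_congr fun x => ?_) h3
  rw [← ofReal_norm, ← ofReal_norm, ENNReal.ofReal_rpow_of_nonneg (norm_nonneg _) hp.le,
    Real.norm_eq_abs, Real.norm_eq_abs, abs_of_nonneg (by positivity : 0 ≤ |f x| ^ p)]

lemma cz_Lp_lt_two {n : ℕ} (ln : Fin n) {b : ℝ} (hb : 0 < b) {p : ℝ} (hp1 : 1 < p) (hp2 : p < 2)
    {A : ℝ≥0∞} (hA : A ≠ ⊤) : ∃ C : ℝ≥0∞, C ≠ ⊤ ∧ ∀ k, CZKer n ln b k A →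
    ∀ f : Eu n → ℝ, BBS f →
      ∫⁻ x, ‖opk n ln b k f x‖ₑ ^ p ∂(mub n ln b) ≤ C * ∫⁻ x, ‖f x‖ₑ ^ p ∂(mub n ln b) := by
  obtain ⟨C, hC, h⟩ := cz_Lp_aux ln hb hp1 hp2 hA
  refine ⟨C * ENNReal.ofReal (2 ^ (p - 1)), by finiteness, fun k hk f hf => ?_⟩
  set μ := mub n ln b with hμ
  have := isLocallyFiniteMeasure_mub ln hb
  have hp0 : 0 < p := by linarith
  have hfi : Integrable f μ := hf.integrable hb
  obtain ⟨M, hM⟩ := hf.bdd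
  have hM0 : 0 ≤ M := (abs_nonneg _).trans (hM 0)
  have hfm := hf.meas
  have hex : ∀ j : ℕ, ∃ φ : Eu n → ℝ, Continuous φ ∧ HasCompactSupport φ ∧ (∀ x, |φ x| ≤ M) ∧
      ∫⁻ x, ‖f x - φ x‖ₑ ∂μ ≤ ENNReal.ofReal (1 / ((j : ℝ) + 1)) := by
    intro j
    obtain ⟨g, hg1, hg2, hg3, -⟩ := hfi.exists_hasCompactSupport_lintegral_sub_le
      (ε := ENNReal.ofReal (1 / ((j : ℝ) + 1))) (by rw [ne_eq, ENNReal.ofReal_eq_zero]; push Not; positivity)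
    refine ⟨fun x => clip M (g x), (continuous_clip M).comp hg3, hg1.comp_left (clip_zero hM0),
      fun x => ?_, le_trans (lintegral_mono fun x => ?_) hg2⟩
    · rw [abs_clip hM0]; exact min_le_right _ _
    · nth_rw 1 [← clip_eq_self (hM x)]
      rw [← ofReal_norm, ← ofReal_norm]
      exact ENNReal.ofReal_le_ofReal (abs_clip_sub_clip_le _ _ _)
  choose φ hφc hφs hφM hφ1 using hex
  have hlim0 : Tendsto (fun j : ℕ => ENNReal.ofReal (1 / ((j : ℝ) + 1))) atTop (𝓝 0) := by
    rw [← ENNReal.ofReal_zero]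
    exact ENNReal.tendsto_ofReal tendsto_one_div_add_atTop_nhds_zero_nat
  have hφb := fun j => BBS.of_continuous (hφc j) (hφs j)
  have hTlim : ∀ x ∈ Hs ln, Tendsto (fun j => opk n ln b k (φ j) x) atTop (𝓝 (opk n ln b k f x)) := by
    intro x hx
    obtain ⟨K, hK⟩ := hk.bdd
    rw [tendsto_iff_edist_tendsto_0]
    have hup : Tendsto (fun j : ℕ => ENNReal.ofReal K * ENNReal.ofReal (1 / ((j : ℝ) + 1))) atTop (𝓝 0) := by
      simpa using ENNReal.Tendsto.const_mul hlim0 (Or.inr ENNReal.ofReal_ne_top)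
    refine tendsto_of_tendsto_of_tendsto_of_le_of_le tendsto_const_nhds hup (fun _ => zero_le) fun j => ?_
    simp only
    rw [edist_comm, edist_eq_enorm_sub, opk, opk, ← integral_sub
      (integrable_kernel_mul hk.meas hk.bdd hfi hx)
      (integrable_kernel_mul hk.meas hk.bdd ((hφb j).integrable hb) hx)]
    calc _ ≤ ∫⁻ y, ‖k x y * f y - k x y * φ j y‖ₑ ∂μ := enorm_integral_le_lintegral_enorm _
      _ ≤ ∫⁻ y, ENNReal.ofReal K * ‖f y - φ j y‖ₑ ∂μ := by
          refine lintegral_mono_ae ((ae_mub ln b).mono fun y hy => ?_)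
          rw [← mul_sub, enorm_mul]
          gcongr
          rw [← ofReal_norm]
          exact ENNReal.ofReal_le_ofReal (hK x hx y hy)
      _ = ENNReal.ofReal K * ∫⁻ y, ‖f y - φ j y‖ₑ ∂μ :=
          lintegral_const_mul' _ _ ENNReal.ofReal_ne_top
      _ ≤ _ := by gcongr; exact hφ1 j
  have hφp : ∀ j, ∫⁻ x, ‖φ j x‖ₑ ^ p ∂μ ≤ ENNReal.ofReal (2 ^ (p - 1)) *
      (∫⁻ x, ‖f x‖ₑ ^ p ∂μ + ENNReal.ofReal ((2 * M) ^ (p - 1)) * ENNReal.ofReal (1 / ((j : ℝ) + 1))) := by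
    intro j
    have hφm := (hφc j).measurable
    calc _ ≤ ∫⁻ x, ENNReal.ofReal (2 ^ (p - 1)) * (‖f x‖ₑ ^ p + ‖φ j x - f x‖ₑ ^ p) ∂μ := by
          refine lintegral_mono fun x => ?_
          have := enorm_add_rpow_le hp1.le (f x) (φ j x - f x)
          rwa [add_sub_cancel] at this
      _ = ENNReal.ofReal (2 ^ (p - 1)) * (∫⁻ x, ‖f x‖ₑ ^ p ∂μ + ∫⁻ x, ‖φ j x - f x‖ₑ ^ p ∂μ) := by
          rw [lintegral_const_mul _ (by fun_prop), lintegral_add_left (by fun_prop)]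
      _ ≤ ENNReal.ofReal (2 ^ (p - 1)) * (∫⁻ x, ‖f x‖ₑ ^ p ∂μ +
            ∫⁻ x, ENNReal.ofReal ((2 * M) ^ (p - 1)) * ‖f x - φ j x‖ₑ ∂μ) := by
          gcongr with x
          have h1 : |φ j x - f x| ≤ 2 * M := by
            have := hφM j x; have := hM x
            calc _ ≤ |φ j x| + |f x| := abs_sub _ _
              _ ≤ _ := by linarith
          rw [← ofReal_norm, ← ofReal_norm, ENNReal.ofReal_rpow_of_nonneg (norm_nonneg _) hp0.le,
            ← ENNReal.ofReal_mul (by positivity), norm_sub_rev (f x), Real.norm_eq_abs]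
          refine ENNReal.ofReal_le_ofReal ?_
          have h2 : |φ j x - f x| ^ p = |φ j x - f x| ^ (p - 1) * |φ j x - f x| := by
            nth_rw 1 [← sub_add_cancel p 1]
            rw [Real.rpow_add_of_nonneg (abs_nonneg _) (by linarith) zero_le_one, Real.rpow_one]
          rw [h2]
          gcongr
      _ ≤ _ := by
          rw [lintegral_const_mul' _ _ ENNReal.ofReal_ne_top]
          gcongr
          exact hφ1 j
  have hlim : Tendsto (fun j : ℕ => C * (ENNReal.ofReal (2 ^ (p - 1)) *
      (∫⁻ x, ‖f x‖ₑ ^ p ∂μ + ENNReal.ofReal ((2 * M) ^ (p - 1)) * ENNReal.ofReal (1 / ((j : ℝ) + 1)))))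
      atTop (𝓝 (C * (ENNReal.ofReal (2 ^ (p - 1)) *
        (∫⁻ x, ‖f x‖ₑ ^ p ∂μ + ENNReal.ofReal ((2 * M) ^ (p - 1)) * 0)))) := by
    refine ENNReal.Tendsto.const_mul (ENNReal.Tendsto.const_mul (tendsto_const_nhds.add
      (ENNReal.Tendsto.const_mul hlim0 (Or.inr ENNReal.ofReal_ne_top))) (Or.inr ENNReal.ofReal_ne_top))
      (Or.inr hC)
  rw [mul_zero, add_zero, ← mul_assoc] at hlim
  calc _ = ∫⁻ x, liminf (fun j => ‖opk n ln b k (φ j) x‖ₑ ^ p) atTop ∂μ := by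
        refine lintegral_congr_ae ((ae_mub ln b).mono fun x hx => ?_)
        exact (Tendsto.liminf_eq ((((hTlim x hx).enorm).ennrpow_const p))).symm
    _ ≤ liminf (fun j => ∫⁻ x, ‖opk n ln b k (φ j) x‖ₑ ^ p ∂μ) atTop :=
        lintegral_liminf_le fun j => (measurable_opk hk.meas (hφc j).measurable).enorm.pow_const _
    _ ≤ _ := by
        rw [← hlim.liminf_eq]
        refine liminf_le_liminf (Eventually.of_forall fun j => ?_)
        refine (h k hk (φ j) (hφc j) (hφs j)).trans ?_
        gcongr
        exact hφp j

lemma cz_Lp_dual {n : ℕ} (ln : Fin n) {b : ℝ} (hb : 0 < b) {p q : ℝ} (hpq : p.HolderConjugate q)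
    {k : Eu n → Eu n → ℝ} (hk : Measurable (Function.uncurry k))
    (hkb : ∃ M, ∀ x ∈ Hs ln, ∀ y ∈ Hs ln, |k x y| ≤ M) {C : ℝ≥0∞}
    (hC : ∀ f : Eu n → ℝ, BBS f → ∫⁻ x, ‖opk n ln b (fun x y => k y x) f x‖ₑ ^ q ∂(mub n ln b) ≤
      C * ∫⁻ x, ‖f x‖ₑ ^ q ∂(mub n ln b)) {h : Eu n → ℝ} (hh : BBS h) :
      ∫⁻ x, ‖opk n ln b k h x‖ₑ ^ p ∂(mub n ln b) ≤ C ^ (p - 1) * ∫⁻ x, ‖h x‖ₑ ^ p ∂(mub n ln b) := by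
  set μ := mub n ln b with hμ
  have hp := hpq.lt
  have hp0 := hpq.pos
  have hq0 := hpq.symm.pos
  have hhm := hh.meas
  have hhi : Integrable h μ := hh.integrable hb
  obtain ⟨M, hM⟩ := hkb
  have hFm := measurable_opk (ln := ln) (b := b) hk hhm
  set F := opk n ln b k h with hF
  have hFb : ∀ x ∈ Hs ln, |F x| ≤ M * ∫ y, |h y| ∂μ := by
    intro x hx
    rw [← integral_const_mul]
    refine norm_integral_le_of_norm_le (f := fun y => k x y * h y) (hhi.abs.const_mul M)
      ((ae_mub ln b).mono fun y hy => ?_)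
    rw [norm_mul, Real.norm_eq_abs, Real.norm_eq_abs]
    exact mul_le_mul_of_nonneg_right (hM x hx y hy) (abs_nonneg _)
  have main : ∀ R : ℕ, ∫⁻ x in Metric.closedBall 0 (R : ℝ), ‖F x‖ₑ ^ p ∂μ ≤
      C ^ (p - 1) * ∫⁻ x, ‖h x‖ₑ ^ p ∂μ := by
    intro R
    set S : Set (Eu n) := Metric.closedBall 0 (R : ℝ) ∩ Hs ln with hS
    have hSm : MeasurableSet S := Metric.isClosed_closedBall.measurableSet.inter (measurableSet_Hs ln)
    have hSb : ∫⁻ x in Metric.closedBall 0 (R : ℝ), ‖F x‖ₑ ^ p ∂μ = ∫⁻ x in S, ‖F x‖ₑ ^ p ∂μ :=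
      setLIntegral_congr (by
        filter_upwards [ae_mub ln b] with x hx
        exact propext ⟨fun h => ⟨h, hx⟩, fun h => h.1⟩)
    rw [hSb]
    set g : Eu n → ℝ := S.indicator fun x => SignType.sign (F x) * |F x| ^ (p - 1) with hg
    have hgm : Measurable g := by
      refine Measurable.indicator ?_ hSm
      have hs : Measurable fun s : ℝ => ((SignType.sign s : SignType) : ℝ) := by
        have : (fun s : ℝ => ((SignType.sign s : SignType) : ℝ)) = fun s =>
            if 0 < s then 1 else if s < 0 then -1 else 0 := by
          funext s
          rcases lt_trichotomy s 0 with h | h | h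
          · simp [h, h.not_gt]
          · simp [h]
          · simp [h]
        rw [this]
        exact Measurable.ite measurableSet_Ioi measurable_const
          (Measurable.ite measurableSet_Iio measurable_const measurable_const)
      exact (hs.comp hFm).mul (by fun_prop)
    have hsg : ∀ s : ℝ, |s| ^ (p - 1) = |((SignType.sign s : SignType) : ℝ) * |s| ^ (p - 1)| := by
      intro s
      rcases lt_trichotomy s 0 with h | h | h
      · simp [h, abs_of_nonneg (Real.rpow_nonneg (abs_nonneg s) (p - 1))]
      · subst h; simp [Real.zero_rpow (by linarith : p - 1 ≠ 0)]
      · simp [h, abs_of_nonneg (Real.rpow_nonneg (abs_nonneg s) (p - 1))]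
    have hga : ∀ x ∈ S, |g x| = |F x| ^ (p - 1) := fun x hx => by
      rw [hg, indicator_of_mem hx, ← hsg]
    have hgB : BBS g := by
      refine ⟨hgm, ⟨(M * ∫ y, |h y| ∂μ) ^ (p - 1) + 0, fun x => ?_⟩, R, fun x hx => ?_⟩
      · by_cases hx : x ∈ S
        · rw [hga x hx, add_zero]
          exact Real.rpow_le_rpow (abs_nonneg _) (hFb x hx.2) (by linarith)
        · have hx0 : 0 ≤ M * ∫ y, |h y| ∂μ ∨ ¬ (∃ x, x ∈ Hs ln) := by
            by_cases hne : ∃ x, x ∈ Hs ln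
            · obtain ⟨z, hz⟩ := hne
              exact Or.inl ((abs_nonneg _).trans (hFb z hz))
            · exact Or.inr hne
          rw [hg, indicator_of_notMem hx, abs_zero, add_zero]
          rcases hx0 with h0 | h0
          · exact Real.rpow_nonneg h0 _
          · exfalso
            refine h0 ⟨EuclideanSpace.single ln 1, ?_⟩
            simp [Hs]
      · by_contra! hc
        apply hx
        rw [hg, indicator_of_notMem]
        intro hxS
        have := hxS.1
        rw [Metric.mem_closedBall, dist_zero_right] at this
        linarith
    have hgi : Integrable g μ := hgB.integrable hb
    set I := ∫⁻ x in S, ‖F x‖ₑ ^ p ∂μ with hI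
    have hgq : ∫⁻ x, ‖g x‖ₑ ^ q ∂μ = I := by
      rw [hI, ← lintegral_indicator hSm]
      refine lintegral_congr fun x => ?_
      by_cases hx : x ∈ S
      · rw [indicator_of_mem hx, ← ofReal_norm, Real.norm_eq_abs, hga x hx, ← ofReal_norm,
          ENNReal.ofReal_rpow_of_nonneg (by positivity) hq0.le,
          ENNReal.ofReal_rpow_of_nonneg (by positivity) hp0.le, ← Real.rpow_mul (abs_nonneg _),
          hpq.sub_one_mul_conj, Real.norm_eq_abs]
      · rw [indicator_of_notMem hx, hg, indicator_of_notMem hx, enorm_zero, ENNReal.zero_rpow_of_pos hq0]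
    have hIt : I ≠ ⊤ := hgq ▸ (hgB.lintegral_rpow_lt_top hb hq0).ne
    have hFg : ∀ x, F x * g x = S.indicator (fun x => |F x| ^ p) x := by
      intro x
      by_cases hx : x ∈ S
      · rw [indicator_of_mem hx, hg, indicator_of_mem hx, ← mul_assoc, mul_comm (F x)]
        rw [show ((SignType.sign (F x) : SignType) : ℝ) * F x = |F x| from sign_mul_self _]
        rcases (abs_nonneg (F x)).eq_or_lt with h0 | h0
        · rw [← h0, Real.zero_rpow hp0.ne', zero_mul]
        · rw [mul_comm, ← Real.rpow_add_one h0.ne', sub_add_cancel]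
      · rw [indicator_of_notMem hx, hg, indicator_of_notMem hx, mul_zero]
    have hFg' : ∫⁻ x, ‖F x * g x‖ₑ ∂μ = I := by
      rw [hI, ← lintegral_indicator hSm]
      refine lintegral_congr fun x => ?_
      rw [hFg]
      by_cases hx : x ∈ S
      · rw [indicator_of_mem hx, indicator_of_mem hx, Real.enorm_of_nonneg (by positivity),
          ← ofReal_norm, ENNReal.ofReal_rpow_of_nonneg (by positivity) hp0.le, Real.norm_eq_abs]
      · rw [indicator_of_notMem hx, indicator_of_notMem hx, enorm_zero]
    have hI1 : I = ‖∫ x, F x * g x ∂μ‖ₑ := by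
      have h0 : ∀ x, 0 ≤ F x * g x := fun x => by
        rw [hFg]; exact indicator_nonneg (fun _ _ => by positivity) x
      have h_int : Integrable (fun x => F x * g x) μ := ⟨(hFm.mul hgm).aestronglyMeasurable, by
          rw [HasFiniteIntegral]; exact lt_of_eq_of_lt hFg' hIt.lt_top⟩
      rw [← hFg', Real.enorm_of_nonneg (integral_nonneg h0),
        ofReal_integral_eq_lintegral_ofReal h_int (ae_of_all _ h0)]
      exact lintegral_congr fun x => Real.enorm_of_nonneg (h0 x)
    have hI2 : ∫ x, F x * g x ∂μ = ∫ y, h y * opk n ln b (fun x y => k y x) g y ∂μ := by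
      have h_int : Integrable (Function.uncurry fun x y => k x y * h y * g x) (μ.prod μ) := by
        have h1 : Integrable (fun z : Eu n × Eu n => g z.1 * h z.2) (μ.prod μ) := hgi.mul_prod hhi
        have h2 := h1.bdd_mul (c := M) hk.aestronglyMeasurable (by
          filter_upwards [Measure.quasiMeasurePreserving_fst.ae (ae_mub ln b),
            Measure.quasiMeasurePreserving_snd.ae (ae_mub ln b)] with z hz1 hz2
          exact hM z.1 hz1 z.2 hz2)
        refine h2.congr (ae_of_all _ fun z => ?_)
        simp only [Function.uncurry]; ring
      calc _ = ∫ x, ∫ y, k x y * h y * g x ∂μ ∂μ := by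
            refine integral_congr_ae (ae_of_all _ fun x => ?_)
            simp only [integral_mul_const]; rfl
        _ = ∫ y, ∫ x, k x y * h y * g x ∂μ ∂μ := integral_integral_swap h_int
        _ = _ := by
            refine integral_congr_ae (ae_of_all _ fun y => ?_)
            simp only [opk]
            rw [← integral_const_mul]
            congr 1; funext x; ring
    have hgt : Measurable (opk n ln b (fun x y => k y x) g) :=
      measurable_opk (by exact hk.comp measurable_swap) hgm
    have hI3 : I ≤ (∫⁻ x, ‖h x‖ₑ ^ p ∂μ) ^ (1 / p) * (C * I) ^ (1 / q) := by
      rw [hI1, hI2]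
      refine (enorm_integral_le_lintegral_enorm _).trans ?_
      simp only [enorm_mul]
      refine (ENNReal.lintegral_mul_le_Lp_mul_Lq μ hpq hhm.enorm.aemeasurable
        hgt.enorm.aemeasurable).trans ?_
      rw [← hI2, ← hI1]
      gcongr
      rw [← hgq]; exact hC g hgB
    rcases eq_or_ne I 0 with h0 | h0
    · rw [h0]; exact zero_le
    have hI4 : I ^ (1 / p) ≤ (∫⁻ x, ‖h x‖ₑ ^ p ∂μ) ^ (1 / p) * C ^ (1 / q) := by
      have e1 : I = I ^ (1 / p) * I ^ (1 / q) := by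
        rw [← ENNReal.rpow_add _ _ h0 hIt]
        simp only [one_div]
        rw [hpq.inv_add_inv_eq_one, ENNReal.rpow_one]
      rw [ENNReal.mul_rpow_of_nonneg _ _ (by positivity), ← mul_assoc] at hI3
      nth_rw 1 [e1] at hI3
      rwa [ENNReal.mul_le_mul_iff_left (by simp [h0, hIt]) (by finiteness)] at hI3
    have hI5 := ENNReal.rpow_le_rpow hI4 hp0.le
    rw [ENNReal.mul_rpow_of_nonneg _ _ hp0.le, ← ENNReal.rpow_mul, ← ENNReal.rpow_mul, ← ENNReal.rpow_mul,
      one_div_mul_cancel hp0.ne', ENNReal.rpow_one, ENNReal.rpow_one, mul_comm] at hI5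
    have e2 : 1 / q * p = p - 1 := by
      have h1 := hpq.sub_one_mul_conj
      field_simp
      linarith
    rwa [e2] at hI5
  have hU : (⋃ R : ℕ, Metric.closedBall (0 : Eu n) (R : ℝ)) = univ := Metric.iUnion_closedBall_nat _
  have hd : Directed (· ⊆ ·) fun R : ℕ => Metric.closedBall (0 : Eu n) (R : ℝ) :=
    Monotone.directed_le fun i j hij => Metric.closedBall_subset_closedBall (by exact_mod_cast hij)
  rw [← setLIntegral_univ, ← hU, setLIntegral_iUnion_of_directed _ hd]
  exact iSup_le main

/-- `L^p` bounds for Calderón–Zygmund kernels, uniform over the kernel. -/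
theorem cz_Lp {n : ℕ} (ln : Fin n) {b : ℝ} (hb : 0 < b) {p : ℝ} (hp1 : 1 < p)
    {A : ℝ≥0∞} (hA : A ≠ ⊤) : ∃ C : ℝ≥0∞, C ≠ ⊤ ∧ ∀ k, CZKer n ln b k A →
    CZKer n ln b (fun x y => k y x) A → ∀ f : Eu n → ℝ, BBS f →
      ∫⁻ x, ‖opk n ln b k f x‖ₑ ^ p ∂(mub n ln b) ≤ C * ∫⁻ x, ‖f x‖ₑ ^ p ∂(mub n ln b) := by
  rcases lt_trichotomy p 2 with h | h | h
  · obtain ⟨C, hC, h⟩ := cz_Lp_lt_two ln hb hp1 h hA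
    exact ⟨C, hC, fun k hk _ f hf => h k hk f hf⟩
  · subst h
    exact ⟨A, hA, fun k hk _ f hf => hk.l2 f hf⟩
  · have hpq := Real.HolderConjugate.conjExponent hp1
    have hq2 : p.conjExponent < 2 := by
      rw [Real.conjExponent, div_lt_iff₀ (by linarith)]; linarith
    obtain ⟨C, hC, h'⟩ := cz_Lp_lt_two ln hb hpq.symm.lt hq2 hA
    refine ⟨C ^ (p - 1), ENNReal.rpow_ne_top_of_nonneg (by linarith) hC, fun k hk hkt f hf => ?_⟩
    exact cz_Lp_dual ln hb hpq hk.meas hk.bdd (h' _ hkt) hf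

section

/-- The linear form with coordinates `v`. -/
def gradCLM {n : ℕ} (v : Fin n → ℝ) : Eu n →L[ℝ] ℝ := ∑ k, v k • EuclideanSpace.proj k

lemma gradCLM_single {n : ℕ} (v : Fin n → ℝ) (k : Fin n) :
    gradCLM v (EuclideanSpace.single k 1) = v k := by
  simp [gradCLM]

lemma eq_gradCLM {n : ℕ} (L : Eu n →L[ℝ] ℝ) : L = gradCLM fun k => L (EuclideanSpace.single k 1) := by
  apply ContinuousLinearMap.coe_injective
  refine (EuclideanSpace.basisFun (Fin n) ℝ).toBasis.ext fun k => ?_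
  simp [gradCLM_single]

lemma HasFDerivAt.to_gradCLM {n : ℕ} {f : Eu n → ℝ} {L : Eu n →L[ℝ] ℝ} {x : Eu n} {G : Fin n → ℝ}
    (h : HasFDerivAt f L x) (hG : ∀ k, L (EuclideanSpace.single k 1) = G k) :
    HasFDerivAt f (gradCLM G) x := by
  rw [eq_gradCLM L] at h
  simpa only [hG] using h

lemma norm_gradCLM_le {n : ℕ} (v : Fin n → ℝ) : ‖gradCLM v‖ ≤ ∑ k, |v k| := by
  unfold gradCLM
  refine (norm_sum_le _ _).trans (Finset.sum_le_sum fun k _ => ?_)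
  rw [norm_smul, Real.norm_eq_abs]
  refine mul_le_of_le_one_right (abs_nonneg _) (ContinuousLinearMap.opNorm_le_bound _ zero_le_one fun x => ?_)
  rw [one_mul]
  exact PiLp.norm_apply_le x k

section Kernels
variable {n : ℕ} (ln : Fin n) (ε s : ℝ)

/-- Powers of the regularised quadratic form. -/
def pw (x y : Eu n) (τ : ℝ) : ℝ := (Qf ln x y τ + ε) ^ (-s)

def g1 (i : Fin n) (x y : Eu n) (τ : ℝ) : ℝ := -2 * s * (pw ln ε (s + 1) x y τ * Xf ln i x y τ)

def g2 (i j : Fin n) (x y : Eu n) (τ : ℝ) : ℝ :=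
  4 * s * (s + 1) * (pw ln ε (s + 2) x y τ * Xf ln i x y τ * Xf ln j x y τ) -
    2 * s * ((if i = j then 1 else 0) * pw ln ε (s + 1) x y τ)

def g3 (i j k : Fin n) (x y : Eu n) (τ : ℝ) : ℝ :=
  -8 * s * (s + 1) * (s + 2) * (pw ln ε (s + 3) x y τ * Xf ln i x y τ * Xf ln j x y τ * Xf ln k x y τ) +
    4 * s * (s + 1) * (pw ln ε (s + 2) x y τ * ((if i = k then 1 else 0) * Xf ln j x y τ +
      (if j = k then 1 else 0) * Xf ln i x y τ + (if i = j then 1 else 0) * Xf ln k x y τ))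

variable {ln ε s}
variable {x y : Eu n} {τ : ℝ}

lemma hasFDerivAt_Xf (i : Fin n) :
    HasFDerivAt (fun x => Xf ln i x y τ) (gradCLM fun k => if i = k then 1 else 0) x := by
  have h : HasFDerivAt (fun x : Eu n => x i) (EuclideanSpace.proj i : Eu n →L[ℝ] ℝ) x :=
    (EuclideanSpace.proj i : Eu n →L[ℝ] ℝ).hasFDerivAt
  have := (h.sub_const (y i)).add_const (if i = ln then 2 * τ * y ln else 0)
  refine HasFDerivAt.to_gradCLM this fun k => ?_
  simp

lemma hasFDerivAt_Qf :
    HasFDerivAt (fun x => Qf ln x y τ) (gradCLM fun k => 2 * Xf ln k x y τ) x := by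
  have h : HasFDerivAt (fun x : Eu n => x ln) (EuclideanSpace.proj ln : Eu n →L[ℝ] ℝ) x :=
    (EuclideanSpace.proj ln : Eu n →L[ℝ] ℝ).hasFDerivAt
  have h1 : HasFDerivAt (fun x : Eu n => ‖x - y‖ ^ 2) _ x := ((hasFDerivAt_id x).sub_const y).norm_sq
  have := h1.add ((h.const_mul (4 * τ)).mul_const (y ln))
  refine HasFDerivAt.to_gradCLM this fun k => ?_
  simp [Xf, EuclideanSpace.inner_single_right, eq_comm (a := k)]
  split_ifs <;> ring

lemma Qfe_pos (hε : 0 < ε) (hτ : τ ∈ Ioo (0:ℝ) 1) : 0 < Qf ln x y τ + ε := by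
  have := Qf_nonneg ln x y hτ
  linarith

lemma hasFDerivAt_pw (hε : 0 < ε) (hτ : τ ∈ Ioo (0:ℝ) 1) :
    HasFDerivAt (fun x => pw ln ε s x y τ) (gradCLM fun k => g1 ln ε s k x y τ) x := by
  have h := (hasFDerivAt_Qf (ln := ln) (x := x) (y := y) (τ := τ)).add_const ε
  have := h.rpow_const (p := -s) (Or.inl (Qfe_pos hε hτ).ne')
  refine HasFDerivAt.to_gradCLM this fun k => ?_
  simp only [_root_.smul_apply, gradCLM_single, smul_eq_mul, g1, pw]
  rw [neg_add, ← sub_eq_add_neg]; ring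

lemma hasFDerivAt_g1 (hε : 0 < ε) (hτ : τ ∈ Ioo (0:ℝ) 1) (i : Fin n) :
    HasFDerivAt (fun x => g1 ln ε s i x y τ) (gradCLM fun k => g2 ln ε s i k x y τ) x := by
  have := ((hasFDerivAt_pw (ln := ln) (s := s + 1) (x := x) (y := y) hε hτ).mul
    (hasFDerivAt_Xf (ln := ln) (x := x) (y := y) (τ := τ) i)).const_mul (-2 * s)
  refine HasFDerivAt.to_gradCLM this fun k => ?_
  simp only [_root_.smul_apply, _root_.add_apply, gradCLM_single,
    smul_eq_mul, g1, g2, show s + 1 + 1 = s + 2 by ring]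
  ring

lemma hasFDerivAt_g2 (hε : 0 < ε) (hτ : τ ∈ Ioo (0:ℝ) 1) (i j : Fin n) :
    HasFDerivAt (fun x => g2 ln ε s i j x y τ) (gradCLM fun k => g3 ln ε s i j k x y τ) x := by
  have h2 := (hasFDerivAt_pw (ln := ln) (s := s + 2) (x := x) (y := y) hε hτ)
  have h1 := (hasFDerivAt_pw (ln := ln) (s := s + 1) (x := x) (y := y) hε hτ)
  have hi := (hasFDerivAt_Xf (ln := ln) (x := x) (y := y) (τ := τ) i)
  have hj := (hasFDerivAt_Xf (ln := ln) (x := x) (y := y) (τ := τ) j)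
  have := (((h2.mul hi).mul hj).const_mul (4 * s * (s + 1))).sub
    ((h1.const_mul (if i = j then 1 else 0)).const_mul (2 * s))
  refine HasFDerivAt.to_gradCLM this fun k => ?_
  simp only [_root_.smul_apply, _root_.add_apply, gradCLM_single,
    _root_.sub_apply, smul_eq_mul, Pi.mul_apply, g1, g3, show s + 1 + 1 = s + 2 by ring,
    show s + 2 + 1 = s + 3 by ring]
  ring

/-! ### Size and measurability -/

lemma measurable_pw (ε s : ℝ) : Measurable fun q : Eu n × Eu n × ℝ => pw ln ε s q.1 q.2.1 q.2.2 := by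
  have := measurable_Qf ln
  unfold pw; fun_prop

lemma measurable_g1 (i : Fin n) : Measurable fun q : Eu n × Eu n × ℝ => g1 ln ε s i q.1 q.2.1 q.2.2 :=
  ((measurable_pw _ _).mul (measurable_Xf ln i)).const_mul _

lemma measurable_g2 (i j : Fin n) :
    Measurable fun q : Eu n × Eu n × ℝ => g2 ln ε s i j q.1 q.2.1 q.2.2 :=
  ((((measurable_pw _ _).mul (measurable_Xf ln i)).mul (measurable_Xf ln j)).const_mul _).sub
    (((measurable_pw _ _).const_mul _).const_mul _)

lemma measurable_g3 (i j k : Fin n) :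
    Measurable fun q : Eu n × Eu n × ℝ => g3 ln ε s i j k q.1 q.2.1 q.2.2 :=
  (((((measurable_pw _ _).mul (measurable_Xf ln i)).mul (measurable_Xf ln j)).mul
    (measurable_Xf ln k)).const_mul _).add
    (((measurable_pw _ _).mul ((((measurable_Xf ln j).const_mul _).add
      ((measurable_Xf ln i).const_mul _)).add ((measurable_Xf ln k).const_mul _))).const_mul _)

lemma pw_nonneg (hε : 0 ≤ ε) (hτ : τ ∈ Ioo (0:ℝ) 1) : 0 ≤ pw ln ε s x y τ := by
  have := Qf_nonneg ln x y hτ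
  unfold pw; positivity

lemma abs_Xf_le (hε : 0 ≤ ε) (hτ : τ ∈ Ioo (0:ℝ) 1) (i : Fin n) :
    |Xf ln i x y τ| ≤ (Qf ln x y τ + ε) ^ (1 / 2 : ℝ) := by
  rw [← Real.sqrt_eq_rpow]
  exact Real.abs_le_sqrt ((Xf_sq_le ln i x y hτ).trans (by linarith))

lemma pw_mul_half (hε : 0 < ε) (hτ : τ ∈ Ioo (0:ℝ) 1) :
    pw ln ε s x y τ * (Qf ln x y τ + ε) ^ (1 / 2 : ℝ) = pw ln ε (s - 1 / 2) x y τ := by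
  unfold pw; rw [← Real.rpow_add (Qfe_pos hε hτ)]; congr 1; ring

lemma abs_pw_mul_Xf_le (hε : 0 < ε) (hτ : τ ∈ Ioo (0:ℝ) 1) {a B : ℝ}
    (ha : |a| ≤ B * pw ln ε s x y τ) (i : Fin n) :
    |a * Xf ln i x y τ| ≤ B * pw ln ε (s - 1 / 2) x y τ := by
  rw [abs_mul, ← pw_mul_half hε hτ, ← mul_assoc]
  exact mul_le_mul ha (abs_Xf_le hε.le hτ i) (abs_nonneg _) ((abs_nonneg _).trans ha)

lemma abs_delta_mul_le {i j : Fin n} {a B : ℝ} (ha : |a| ≤ B) : |(if i = j then 1 else 0) * a| ≤ B := by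
  split_ifs
  · simpa using ha
  · simpa using (abs_nonneg _).trans ha

lemma abs_pw (hε : 0 ≤ ε) (hτ : τ ∈ Ioo (0:ℝ) 1) : |pw ln ε s x y τ| ≤ 1 * pw ln ε s x y τ := by
  rw [abs_of_nonneg (pw_nonneg hε hτ), one_mul]

lemma abs_g1_le (hε : 0 < ε) (hs : 0 ≤ s) (hτ : τ ∈ Ioo (0:ℝ) 1) (i : Fin n) :
    |g1 ln ε s i x y τ| ≤ 2 * s * pw ln ε (s + 1 / 2) x y τ := by
  have := abs_pw_mul_Xf_le hε hτ (abs_pw (ln := ln) (s := s + 1) (x := x) (y := y) hε.le hτ) i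
  rw [show s + 1 - 1 / 2 = s + 1 / 2 by ring] at this
  unfold g1
  rw [abs_mul, show |-2 * s| = 2 * s by rw [abs_mul, abs_of_nonneg hs]; norm_num]
  nlinarith

lemma abs_g2_le (hε : 0 < ε) (hs : 0 ≤ s) (hτ : τ ∈ Ioo (0:ℝ) 1) (i j : Fin n) :
    |g2 ln ε s i j x y τ| ≤ (4 * s * (s + 1) + 2 * s) * pw ln ε (s + 1) x y τ := by
  have h1 := abs_pw_mul_Xf_le hε hτ (abs_pw_mul_Xf_le hε hτ
    (abs_pw (ln := ln) (s := s + 2) (x := x) (y := y) hε.le hτ) i) j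
  rw [show s + 2 - 1 / 2 - 1 / 2 = s + 1 by ring] at h1
  have h2 := abs_delta_mul_le (i := i) (j := j) (abs_pw (ln := ln) (s := s + 1) (x := x) (y := y) hε.le hτ)
  unfold g2
  refine (abs_sub _ _).trans ?_
  rw [abs_mul, abs_mul (2 * s), abs_of_nonneg (by positivity : 0 ≤ 4 * s * (s + 1)),
    abs_of_nonneg (by positivity : 0 ≤ 2 * s), add_mul]
  rw [one_mul] at h1 h2
  gcongr

lemma abs_g3_le (hε : 0 < ε) (hs : 0 ≤ s) (hτ : τ ∈ Ioo (0:ℝ) 1) (i j k : Fin n) :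
    |g3 ln ε s i j k x y τ| ≤ (8 * s * (s + 1) * (s + 2) + 12 * s * (s + 1)) *
      pw ln ε (s + 3 / 2) x y τ := by
  have h1 := abs_pw_mul_Xf_le hε hτ (abs_pw_mul_Xf_le hε hτ (abs_pw_mul_Xf_le hε hτ
    (abs_pw (ln := ln) (s := s + 3) (x := x) (y := y) hε.le hτ) i) j) k
  rw [show s + 3 - 1 / 2 - 1 / 2 - 1 / 2 = s + 3 / 2 by ring] at h1
  have h2 := fun i j k : Fin n => abs_delta_mul_le (i := i) (j := j) (abs_pw_mul_Xf_le hε hτ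
    (abs_pw (ln := ln) (s := s + 2) (x := x) (y := y) hε.le hτ) k)
  rw [show s + 2 - 1 / 2 = s + 3 / 2 by ring] at h2
  simp only [one_mul] at h1 h2
  have h3 : g3 ln ε s i j k x y τ = -(8 * s * (s + 1) * (s + 2)) * (pw ln ε (s + 3) x y τ *
      Xf ln i x y τ * Xf ln j x y τ * Xf ln k x y τ) + 4 * s * (s + 1) *
      ((if i = k then 1 else 0) * (pw ln ε (s + 2) x y τ * Xf ln j x y τ) +
      (if j = k then 1 else 0) * (pw ln ε (s + 2) x y τ * Xf ln i x y τ) +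
      (if i = j then 1 else 0) * (pw ln ε (s + 2) x y τ * Xf ln k x y τ)) := by
    unfold g3; ring
  rw [h3]
  refine (abs_add_le _ _).trans ?_
  rw [abs_mul, abs_mul (4 * s * (s + 1)), abs_neg, abs_of_nonneg (by positivity : 0 ≤ 4 * s * (s + 1)),
    abs_of_nonneg (by positivity : 0 ≤ 8 * s * (s + 1) * (s + 2)), add_mul]
  have h4 := (abs_add_three _ _ _).trans (add_le_add (add_le_add (h2 i k j) (h2 j k i)) (h2 i j k))
  have h5 : 0 ≤ 4 * s * (s + 1) := by positivity
  have h6 : 0 ≤ 8 * s * (s + 1) * (s + 2) := by positivity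
  nlinarith [mul_le_mul_of_nonneg_left h4 h5, mul_le_mul_of_nonneg_left h1 h6]

end Kernels

end

section

/-- The operator `f ↦ ∫∫ f(y) Φ(x,y,τ)`. -/
def Ik (n : ℕ) (ln : Fin n) (b : ℝ) (Φ : Eu n → Eu n → ℝ → ℝ) (f : Eu n → ℝ) (x : Eu n) : ℝ :=
  ∫ w, Φ x w.1 w.2 * f w.1 ∂(rhob n ln b)

/-- Kernels of size `(Qf + ε)^{-m}`. -/
structure Adm {n : ℕ} (ln : Fin n) (ε m : ℝ) (Φ : Eu n → Eu n → ℝ → ℝ) : Prop where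
  meas : Measurable fun q : Eu n × Eu n × ℝ => Φ q.1 q.2.1 q.2.2
  bd : ∃ C, 0 ≤ C ∧ ∀ x y, ∀ τ ∈ Ioo (0:ℝ) 1, |Φ x y τ| ≤ C * pw ln ε m x y τ

variable {n : ℕ} {ln : Fin n} {b ε m s : ℝ} {Φ Ψ : Eu n → Eu n → ℝ → ℝ} {f : Eu n → ℝ}

lemma pw_le_const (hε : 0 < ε) {m m' : ℝ} (h : m' ≤ m) {x y : Eu n} {τ : ℝ} (hτ : τ ∈ Ioo (0:ℝ) 1) :
    pw ln ε m x y τ ≤ ε ^ (-(m - m')) * pw ln ε m' x y τ := by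
  have hq := Qfe_pos (ln := ln) (x := x) (y := y) hε hτ
  unfold pw
  rw [show -m = -(m - m') + -m' by ring, Real.rpow_add hq]
  have : (Qf ln x y τ + ε) ^ (-(m - m')) ≤ ε ^ (-(m - m')) :=
    Real.rpow_le_rpow_of_nonpos hε (by linarith [Qf_nonneg ln x y hτ]) (by linarith)
  gcongr

lemma Adm.mono (hε : 0 < ε) (h : Adm ln ε m Φ) {m' : ℝ} (hm : m' ≤ m) : Adm ln ε m' Φ := by
  obtain ⟨C, hC0, hC⟩ := h.bd
  refine ⟨h.meas, C * ε ^ (-(m - m')), by positivity, fun x y τ hτ => (hC x y τ hτ).trans ?_⟩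
  rw [mul_assoc]
  exact mul_le_mul_of_nonneg_left (pw_le_const hε hm hτ) hC0

lemma Adm.bounded (hε : 0 < ε) (h : Adm ln ε m Φ) (hm : 0 ≤ m) :
    ∃ M, 0 ≤ M ∧ ∀ x y, ∀ τ ∈ Ioo (0:ℝ) 1, |Φ x y τ| ≤ M := by
  obtain ⟨C, hC0, hC⟩ := (h.mono hε hm).bd
  exact ⟨C, hC0, fun x y τ hτ => (hC x y τ hτ).trans (by simp [pw])⟩

lemma Adm.const_mul (h : Adm ln ε m Φ) (c : ℝ) : Adm ln ε m fun x y τ => c * Φ x y τ := by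
  obtain ⟨C, hC0, hC⟩ := h.bd
  refine ⟨h.meas.const_mul c, |c| * C, by positivity, fun x y τ hτ => ?_⟩
  rw [abs_mul, mul_assoc]
  exact mul_le_mul_of_nonneg_left (hC x y τ hτ) (abs_nonneg c)

lemma adm_pw (hε : 0 < ε) (m : ℝ) : Adm ln ε m (pw ln ε m) :=
  ⟨measurable_pw _ _, 1, zero_le_one, fun _ _ _ hτ => abs_pw hε.le hτ⟩

lemma adm_g1 (hε : 0 < ε) (hs : 0 ≤ s) (i : Fin n) : Adm ln ε (s + 1 / 2) (g1 ln ε s i) :=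
  ⟨measurable_g1 i, _, by positivity, fun _ _ _ hτ => abs_g1_le hε hs hτ i⟩

lemma adm_g2 (hε : 0 < ε) (hs : 0 ≤ s) (i j : Fin n) : Adm ln ε (s + 1) (g2 ln ε s i j) :=
  ⟨measurable_g2 i j, _, by positivity, fun _ _ _ hτ => abs_g2_le hε hs hτ i j⟩

lemma adm_g3 (hε : 0 < ε) (hs : 0 ≤ s) (i j k : Fin n) : Adm ln ε (s + 3 / 2) (g3 ln ε s i j k) :=
  ⟨measurable_g3 i j k, _, by positivity, fun _ _ _ hτ => abs_g3_le hε hs hτ i j k⟩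

lemma BBS.integrable_rhob (hb : 0 < b) (hf : BBS f) :
    Integrable (fun w : Eu n × ℝ => f w.1) (rhob n ln b) := by
  have := isFiniteMeasure_kap hb
  exact (hf.integrable hb).comp_fst _

lemma Adm.integrable (hb : 0 < b) (hε : 0 < ε) (hm : 0 ≤ m) (h : Adm ln ε m Φ) (hf : BBS f) (x : Eu n) :
    Integrable (fun w : Eu n × ℝ => Φ x w.1 w.2 * f w.1) (rhob n ln b) := by
  obtain ⟨M, hM0, hM⟩ := h.bounded hε hm
  exact (hf.integrable_rhob hb).bdd_mul (c := M) (h.meas.of_uncurry_left (f := fun x (w : Eu n × ℝ) => Φ x w.1 w.2)).aestronglyMeasurable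
    ((ae_rhob ln b).mono fun w hw => hM x w.1 w.2 hw.2)

lemma Adm.measurable_Ik (h : Adm ln ε m Φ) (hf : Measurable f) : Measurable (Ik n ln b Φ f) := by
  have : StronglyMeasurable (Function.uncurry fun (x : Eu n) (w : Eu n × ℝ) => Φ x w.1 w.2 * f w.1) :=
    (h.meas.mul (hf.comp (measurable_fst.comp measurable_snd))).stronglyMeasurable
  exact (this.integral_prod_right (ν := rhob n ln b)).measurable

lemma integral_gradCLM {Ω : Type*} [MeasurableSpace Ω] {ν : Measure Ω} {G : Fin n → Ω → ℝ}
    (hG : ∀ k, Integrable (G k) ν) :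
    ∫ w, gradCLM (fun k => G k w) ∂ν = gradCLM fun k => ∫ w, G k w ∂ν := by
  unfold gradCLM
  rw [integral_finsetSum _ fun k _ => (hG k).smul_const _]
  simp only [integral_smul_const]

set_option maxHeartbeats 1000000 in
lemma Ik_hasFDerivAt (hb : 0 < b) (hε : 0 < ε) (hm : 0 ≤ m) (h : Adm ln ε m Φ) {D : Fin n → Eu n → Eu n → ℝ → ℝ}
    (hD : ∀ k, Adm ln ε m (D k)) (hd : ∀ x y, ∀ τ ∈ Ioo (0:ℝ) 1,
      HasFDerivAt (fun x => Φ x y τ) (gradCLM fun k => D k x y τ) x) (hf : BBS f) (x : Eu n) :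
    HasFDerivAt (Ik n ln b Φ f) (gradCLM fun k => Ik n ln b (D k) f x) x := by
  choose M hM0 hM using fun k => (hD k).bounded hε hm
  have hi := fun k => (hD k).integrable hb hε hm hf x
  have key := hasFDerivAt_integral_of_dominated_of_fderiv_le (μ := rhob n ln b) (s := univ)
    (F := fun x (w : Eu n × ℝ) => Φ x w.1 w.2 * f w.1) (x₀ := x)
    (F' := fun x w => gradCLM fun k => D k x w.1 w.2 * f w.1)
    (bound := fun w => ∑ k, M k * |f w.1|) univ_mem
    (Eventually.of_forall fun z => (h.integrable hb hε hm hf z).aestronglyMeasurable)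
    (h.integrable hb hε hm hf x)
    (by
      unfold gradCLM
      exact Finset.aestronglyMeasurable_fun_sum _ fun k _ => (hi k).aestronglyMeasurable.smul_const _)
    ((ae_rhob ln b).mono fun w hw z _ => (norm_gradCLM_le _).trans (Finset.sum_le_sum fun k _ => by
      rw [abs_mul]; exact mul_le_mul_of_nonneg_right (hM k z w.1 w.2 hw.2) (abs_nonneg _)))
    (integrable_finsetSum _ fun k _ => (hf.integrable_rhob hb).abs.const_mul _)
    ((ae_rhob ln b).mono fun w hw z _ => by
      refine HasFDerivAt.to_gradCLM ((hd z w.1 w.2 hw.2).mul_const (f w.1)) fun k => ?_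
      simp [gradCLM_single, mul_comm])
  rwa [integral_gradCLM hi] at key

lemma norm_reflLn (y : Eu n) : ‖reflLn ln y‖ = ‖y‖ := by
  rw [EuclideanSpace.norm_eq, EuclideanSpace.norm_eq]
  congr 1
  refine Finset.sum_congr rfl fun i _ => ?_
  rw [reflLn_apply]; split_ifs <;> simp

lemma one_add_norm_sq_le (hε : 0 < ε) {x y : Eu n} {τ R : ℝ} (hτ : τ ∈ Ioo (0:ℝ) 1) (hy : ‖y‖ ≤ R) :
    (1 + ‖x‖) ^ 2 ≤ (2 + 2 * (1 + R) ^ 2 / ε) * (Qf ln x y τ + ε) := by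
  have key : ∀ z : Eu n, ‖z‖ ≤ R → (1 + ‖x‖) ^ 2 ≤ 2 * (1 + R) ^ 2 + 2 * ‖x - z‖ ^ 2 := by
    intro z hz
    have h1 : ‖x‖ ≤ ‖x - z‖ + ‖z‖ := by simpa using norm_add_le (x - z) z
    nlinarith [sq_nonneg (1 + R - ‖x - z‖), norm_nonneg x, norm_nonneg z, norm_nonneg (x - z)]
  have h1 := key y hy
  have h2 := key (reflLn ln y) (by rwa [norm_reflLn])
  have hQ := Qf_nonneg ln x y hτ
  have h3 : (1 + ‖x‖) ^ 2 ≤ 2 * (1 + R) ^ 2 + 2 * Qf ln x y τ := by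
    rw [Qf_eq]
    nlinarith [mul_le_mul_of_nonneg_left h1 (by linarith [hτ.2] : 0 ≤ 1 - τ),
      mul_le_mul_of_nonneg_left h2 hτ.1.le]
  have h4 : 2 * (1 + R) ^ 2 / ε * ε = 2 * (1 + R) ^ 2 := by field_simp
  have h5 : 0 ≤ 2 * (1 + R) ^ 2 / ε := by positivity
  nlinarith [mul_nonneg h5 hQ]

lemma Adm.decay (hb : 0 < b) (hε : 0 < ε) (hm : 0 ≤ m) (h : Adm ln ε m Φ) (hf : BBS f) :
    ∃ C, 0 ≤ C ∧ ∀ x, |Ik n ln b Φ f x| ≤ C * (1 + ‖x‖) ^ (-(2 * m)) := by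
  obtain ⟨C, hC0, hC⟩ := h.bd
  obtain ⟨R, hR⟩ := hf.supp
  set K := 2 + 2 * (1 + R) ^ 2 / ε
  have hK : 0 < K := by positivity
  refine ⟨∫ w : Eu n × ℝ, C * K ^ m * |f w.1| ∂(rhob n ln b), by positivity, fun x => ?_⟩
  rw [← integral_mul_const]
  refine norm_integral_le_of_norm_le (f := fun w : Eu n × ℝ => Φ x w.1 w.2 * f w.1)
    (((hf.integrable_rhob hb).abs.const_mul _).mul_const _)
    ((ae_rhob ln b).mono fun w hw => ?_)
  rw [norm_mul, Real.norm_eq_abs, Real.norm_eq_abs]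
  by_cases hf0 : f w.1 = 0
  · simp [hf0]
  have hq := Qfe_pos (ln := ln) (x := x) (y := w.1) hε hw.2
  have hx : 0 < 1 + ‖x‖ := by positivity
  have h1 : pw ln ε m x w.1 w.2 ≤ K ^ m * (1 + ‖x‖) ^ (-(2 * m)) := by
    have h2 := one_add_norm_sq_le (ln := ln) (x := x) hε hw.2 (hR _ hf0)
    have h3 : (1 + ‖x‖) ^ 2 / K ≤ Qf ln x w.1 w.2 + ε := by rw [div_le_iff₀ hK]; linarith
    refine (Real.rpow_le_rpow_of_nonpos (by positivity) h3 (by linarith)).trans_eq ?_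
    rw [Real.div_rpow (by positivity) hK.le, Real.rpow_neg hK.le, div_inv_eq_mul, mul_comm,
      ← Real.rpow_natCast, ← Real.rpow_mul hx.le]
    congr 2; push_cast; ring
  calc |Φ x w.1 w.2| * |f w.1| ≤ (C * (K ^ m * (1 + ‖x‖) ^ (-(2 * m)))) * |f w.1| := by
        refine mul_le_mul_of_nonneg_right ((hC x w.1 w.2 hw.2).trans ?_) (abs_nonneg _)
        exact mul_le_mul_of_nonneg_left h1 hC0
    _ = _ := by ring

/-- The kernel on the half-space obtained by integrating out `τ`. -/
def kerI {n : ℕ} (b : ℝ) (Φ : Eu n → Eu n → ℝ → ℝ) (x y : Eu n) : ℝ := ∫ τ, Φ x y τ ∂(kap b)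

lemma Adm.measurable_kerI (h : Adm ln ε m Φ) : Measurable (Function.uncurry (kerI b Φ)) := by
  have : StronglyMeasurable (Function.uncurry fun (z : Eu n × Eu n) (τ : ℝ) => Φ z.1 z.2 τ) := by
    apply Measurable.stronglyMeasurable
    exact h.meas.comp (by fun_prop : Measurable fun q : (Eu n × Eu n) × ℝ => (q.1.1, q.1.2, q.2))
  exact (this.integral_prod_right (ν := kap b)).measurable

lemma Adm.kerI_bdd (hb : 0 < b) (hε : 0 < ε) (hm : 0 ≤ m) (h : Adm ln ε m Φ) :
    ∃ M, ∀ x y, |kerI b Φ x y| ≤ M := by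
  have := isFiniteMeasure_kap hb
  obtain ⟨M, hM0, hM⟩ := h.bounded hε hm
  refine ⟨∫ _, M ∂(kap b), fun x y => ?_⟩
  exact norm_integral_le_of_norm_le (f := fun τ => Φ x y τ) (integrable_const _)
    ((ae_kap b).mono fun τ hτ => hM x y τ hτ)

lemma Adm.opk_kerI (hb : 0 < b) (hε : 0 < ε) (hm : 0 ≤ m) (h : Adm ln ε m Φ) (hf : BBS f) (x : Eu n) :
    opk n ln b (kerI b Φ) f x = Ik n ln b Φ f x := by
  unfold opk Ik kerI
  rw [integral_prod _ (h.integrable hb hε hm hf x)]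
  simp only [integral_mul_const]

end

section

variable {n : ℕ} {ln : Fin n} {b ε m s : ℝ} {Φ Ψ : Eu n → Eu n → ℝ → ℝ} {f : Eu n → ℝ}

lemma integral_kap (b : ℝ) (g : ℝ → ℝ) :
    ∫ τ, g τ ∂(kap b) = ∫ τ in Ioo (0:ℝ) 1, (τ * (1 - τ)) ^ (b / 2 - 1) * g τ := by
  rw [kap, integral_withDensity_eq_integral_toReal_smul (measurable_kapdens b)
    (ae_of_all _ fun _ => ENNReal.ofReal_lt_top)]
  refine setIntegral_congr_fun measurableSet_Ioo fun τ hτ => ?_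
  have : 0 ≤ τ * (1 - τ) := mul_nonneg hτ.1.le (by linarith [hτ.2])
  simp only [smul_eq_mul]
  rw [ENNReal.toReal_ofReal (by positivity)]

/-- The kernel of the defect in the equation satisfied by the regularised potential. -/
def gP {n : ℕ} (ln : Fin n) (b ε s : ℝ) (x y : Eu n) (τ : ℝ) : ℝ :=
  -2 * s * ((n : ℝ) + b) * ε * pw ln ε (s + 2) x y τ

/-- The kernel combination which integrates to zero. -/
def gZ {n : ℕ} (ln : Fin n) (b ε s : ℝ) (x y : Eu n) (τ : ℝ) : ℝ :=
  ∑ j, g2 ln ε s j j x y τ + b / x ln * g1 ln ε s ln x y τ - gP ln b ε s x y τ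

lemma sum_g2 (x y : Eu n) (τ : ℝ) : ∑ j, g2 ln ε s j j x y τ =
    4 * s * (s + 1) * (pw ln ε (s + 2) x y τ * (Qf ln x y τ - 4 * τ * (1 - τ) * (y ln) ^ 2)) -
      2 * s * (n * pw ln ε (s + 1) x y τ) := by
  rw [← sum_Xf_sq]
  simp only [g2, Finset.sum_sub_distrib, Finset.mul_sum, if_true, one_mul, Finset.sum_const,
    Finset.card_univ, Fintype.card_fin, nsmul_eq_mul]
  congr 1
  · exact Finset.sum_congr rfl fun i _ => by ring
  · ring

lemma hasDerivAt_gZ (hε : 0 < ε) (hs : 2 * (s + 1) = (n : ℝ) + b) {x y : Eu n} (hx : x ln ≠ 0) {τ : ℝ}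
    (hτ : τ ∈ Ioo (0:ℝ) 1) :
    HasDerivAt (fun τ => 4 * s * (y ln / x ln) * ((τ * (1 - τ)) ^ (b / 2) * pw ln ε (s + 1) x y τ))
      ((τ * (1 - τ)) ^ (b / 2 - 1) * gZ ln b ε s x y τ) τ := by
  have hq := Qfe_pos (ln := ln) (x := x) (y := y) hε hτ
  have ht : 0 < τ * (1 - τ) := mul_pos hτ.1 (by linarith [hτ.2])
  have h1 : HasDerivAt (fun τ : ℝ => τ * (1 - τ)) (1 - 2 * τ) τ := by
    have := (hasDerivAt_id τ).mul ((hasDerivAt_id τ).const_sub 1)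
    refine this.congr_deriv ?_
    simp; ring
  have h2 := h1.rpow_const (p := b / 2) (Or.inl ht.ne')
  have h3 : HasDerivAt (fun τ : ℝ => Qf ln x y τ + ε) (4 * x ln * y ln) τ := by
    have := ((((hasDerivAt_id τ).const_mul (4:ℝ)).mul_const (x ln)).mul_const (y ln)).const_add (‖x - y‖ ^ 2)
    refine (this.add_const ε).congr_deriv ?_
    simp
  have h4 := h3.rpow_const (p := -(s + 1)) (Or.inl hq.ne')
  refine ((h2.mul h4).const_mul (4 * s * (y ln / x ln))).congr_deriv ?_
  have e1 : (τ * (1 - τ)) ^ (b / 2) = (τ * (1 - τ)) ^ (b / 2 - 1) * (τ * (1 - τ)) := by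
    rw [← Real.rpow_add_one ht.ne', sub_add_cancel]
  have e2 : (Qf ln x y τ + ε) ^ (-(s + 1) - 1) = pw ln ε (s + 2) x y τ := by
    unfold pw; congr 1; ring
  have e3 : (Qf ln x y τ + ε) ^ (-(s + 1)) = pw ln ε (s + 2) x y τ * (Qf ln x y τ + ε) := by
    unfold pw; rw [← Real.rpow_add_one hq.ne']; congr 1; ring
  have e4 : pw ln ε (s + 1) x y τ = pw ln ε (s + 2) x y τ * (Qf ln x y τ + ε) := e3
  unfold gZ gP
  rw [sum_g2, g1, e4, e1, e2, e3, Xf, if_pos rfl]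
  generalize pw ln ε (s + 2) x y τ = P
  generalize (τ * (1 - τ)) ^ (b / 2 - 1) = K
  generalize Qf ln x y τ = Q
  have hb : b = 2 * (s + 1) - n := by linarith
  field_simp
  rw [← hs]
  subst hb
  ring

lemma kerI_gZ (hb : 0 < b) (hε : 0 < ε) (hs : 2 * (s + 1) = (n : ℝ) + b) {x : Eu n}
    (y : Eu n) (hx : x ln ≠ 0) (h_int : Integrable (fun τ => gZ ln b ε s x y τ) (kap b))
    (hy : 0 ≤ x ln * y ln) :
    kerI b (gZ ln b ε s) x y = 0 := by
  have hi : IntegrableOn (fun τ => (τ * (1 - τ)) ^ (b / 2 - 1) * gZ ln b ε s x y τ) (Ioo 0 1) volume := by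
    rw [kap, integrable_withDensity_iff_integrable_smul' (measurable_kapdens b)
      (ae_of_all _ fun _ => ENNReal.ofReal_lt_top)] at h_int
    refine IntegrableOn.congr_fun h_int (fun τ hτ => ?_) measurableSet_Ioo
    have : 0 ≤ τ * (1 - τ) := mul_nonneg hτ.1.le (by linarith [hτ.2])
    simp only [smul_eq_mul]
    rw [ENNReal.toReal_ofReal (by positivity)]
  unfold kerI
  rw [integral_kap, ← integral_Ioc_eq_integral_Ioo, ← intervalIntegral.integral_of_le zero_le_one,
    intervalIntegral.integral_eq_sub_of_hasDerivAt_of_le zero_le_one ?_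
      (fun τ hτ => hasDerivAt_gZ hε hs hx hτ)]
  · simp [Real.zero_rpow (by positivity : b / 2 ≠ 0)]
  · rwa [intervalIntegrable_iff_integrableOn_Ioo_of_le zero_le_one]
  · have hq : ∀ τ ∈ Icc (0:ℝ) 1, Qf ln x y τ + ε ≠ 0 := by
      intro τ hτ
      have h1 := hτ.1
      have : 0 ≤ ‖x - y‖ ^ 2 := by positivity
      have h2 : 0 ≤ 4 * τ * (x ln * y ln) := by positivity
      unfold Qf; nlinarith
    refine continuousOn_const.mul (ContinuousOn.mul ?_ ?_)
    · exact ContinuousOn.rpow_const (by fun_prop) fun _ _ => Or.inr (by positivity)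
    · unfold pw
      refine ContinuousOn.rpow_const ?_ fun τ hτ => Or.inl (hq τ hτ)
      unfold Qf; fun_prop

lemma adm_gP (hε : 0 < ε) : Adm ln ε (s + 2) (gP ln b ε s) := (adm_pw hε (s + 2)).const_mul _

lemma pde (hb : 0 < b) (hε : 0 < ε) (hs0 : 0 ≤ s) (hs : 2 * (s + 1) = (n : ℝ) + b) (hf : BBS f) {x : Eu n}
    (hx : x ∈ Hs ln) :
    ∑ j, Ik n ln b (g2 ln ε s j j) f x + b / x ln * Ik n ln b (g1 ln ε s ln) f x =
      Ik n ln b (gP ln b ε s) f x := by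
  have hx0 : x ln ≠ 0 := (show 0 < x ln from hx).ne'
  have i2 := fun j => (adm_g2 (ln := ln) hε hs0 j j).integrable hb hε (by positivity) hf x
  have i1 := ((adm_g1 (ln := ln) hε hs0 ln).integrable hb hε (by positivity) hf x).const_mul (b / x ln)
  have iP := (adm_gP (ln := ln) (b := b) (s := s) hε).integrable hb hε (by positivity) hf x
  have i2s := integrable_finsetSum Finset.univ fun j _ => i2 j
  have i21 : Integrable (fun w : Eu n × ℝ => ∑ j, g2 ln ε s j j x w.1 w.2 * f w.1 +
    b / x ln * (g1 ln ε s ln x w.1 w.2 * f w.1)) (rhob n ln b) := i2s.add i1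
  have iZ := i21.sub iP
  rw [← sub_eq_zero]
  have e : ∑ j, Ik n ln b (g2 ln ε s j j) f x + b / x ln * Ik n ln b (g1 ln ε s ln) f x -
      Ik n ln b (gP ln b ε s) f x = ∫ w, gZ ln b ε s x w.1 w.2 * f w.1 ∂(rhob n ln b) := by
    unfold Ik
    rw [← integral_finsetSum _ fun j _ => i2 j, ← integral_const_mul, ← integral_add i2s i1,
      ← integral_sub i21 iP]
    congr 1; funext w
    simp only [gZ, sub_mul, add_mul, Finset.sum_mul, mul_assoc]
  have iZ' : Integrable (fun w : Eu n × ℝ => gZ ln b ε s x w.1 w.2 * f w.1) (rhob n ln b) := by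
    refine iZ.congr (ae_of_all _ fun w => ?_)
    simp only [gZ, sub_mul, add_mul, Finset.sum_mul, mul_assoc, Pi.sub_apply]
  rw [e, integral_prod _ iZ']
  have := isFiniteMeasure_kap hb
  refine integral_eq_zero_of_ae ((ae_mub ln b).mono fun y hy => ?_)
  simp only [integral_mul_const, Pi.zero_apply]
  have : kerI b (gZ ln b ε s) x y = 0 := by
    refine kerI_gZ hb hε hs y hx0 ?_ (mul_pos hx hy).le
    have hk : ∀ {m Φ}, Adm ln ε m Φ → 0 ≤ m → Integrable (fun τ => Φ x y τ) (kap b) := by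
      intro m Φ h hm
      obtain ⟨M, -, hM⟩ := h.bounded hε hm
      exact Integrable.of_bound (h.meas.comp (by fun_prop : Measurable fun τ : ℝ => (x, y, τ))).aestronglyMeasurable
        M ((ae_kap b).mono fun τ hτ => hM x y τ hτ)
    exact ((integrable_finsetSum _ fun j _ => hk (adm_g2 hε hs0 j j) (by positivity)).add
      ((hk (adm_g1 hε hs0 ln) (by positivity)).const_mul _)).sub (hk (adm_gP hε) (by positivity))
  rw [show ∫ τ, gZ ln b ε s x y τ ∂(kap b) = 0 from this, zero_mul]

end

section

variable {n : ℕ} {ln : Fin n} {b ε m s : ℝ} {f : Eu n → ℝ}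

/-- The weight, extended by zero. -/
def wt {n : ℕ} (ln : Fin n) (b : ℝ) (x : Eu n) : ℝ := max (x ln) 0 ^ b

lemma hasDerivAt_max_rpow {b : ℝ} (hb : 1 < b) (t : ℝ) :
    HasDerivAt (fun t : ℝ => max t 0 ^ b) (b * max t 0 ^ (b - 1)) t := by
  rcases lt_trichotomy t 0 with h | h | h
  · rw [max_eq_right h.le, Real.zero_rpow (by linarith), mul_zero]
    refine (hasDerivAt_const t (0:ℝ)).congr_of_eventuallyEq ?_
    filter_upwards [Iio_mem_nhds h] with u hu
    rw [max_eq_right (le_of_lt hu), Real.zero_rpow (by linarith)]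
  · subst h
    rw [max_self, Real.zero_rpow (by linarith), mul_zero]
    have h1 : HasDerivAt (fun t : ℝ => |t| ^ b) 0 0 := by simpa using hasDerivAt_abs_rpow 0 hb
    have h2 : HasDerivWithinAt (fun t : ℝ => max t 0 ^ b) 0 (Ici 0) 0 :=
      h1.hasDerivWithinAt.congr (fun u hu => by rw [max_eq_left hu, abs_of_nonneg hu]) (by simp)
    have h3 : HasDerivWithinAt (fun t : ℝ => max t 0 ^ b) 0 (Iic 0) 0 :=
      (hasDerivWithinAt_const (0:ℝ) (Iic (0:ℝ)) (0:ℝ)).congr (fun u hu => by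
        rw [max_eq_right hu, Real.zero_rpow (by linarith)]) (by
        rw [max_self, Real.zero_rpow (by linarith)])
    have := h3.union h2
    rwa [Iic_union_Ici, hasDerivWithinAt_univ] at this
  · rw [max_eq_left h.le]
    have := Real.hasDerivAt_rpow_const (x := t) (p := b) (Or.inl h.ne')
    refine this.congr_of_eventuallyEq ?_
    filter_upwards [Ioi_mem_nhds h] with u hu
    rw [max_eq_left (le_of_lt hu)]

lemma hasFDerivAt_wt (hb : 1 < b) (x : Eu n) :
    HasFDerivAt (wt ln b) (gradCLM fun k => if k = ln then b * max (x ln) 0 ^ (b - 1) else 0) x := by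
  have h : HasFDerivAt (fun x : Eu n => x ln) (EuclideanSpace.proj ln : Eu n →L[ℝ] ℝ) x :=
    (EuclideanSpace.proj ln : Eu n →L[ℝ] ℝ).hasFDerivAt
  have h2 := (hasDerivAt_max_rpow hb (x ln)).comp_hasFDerivAt x h
  have e : wt ln b = (fun t : ℝ => max t 0 ^ b) ∘ fun x : Eu n => x ln := rfl
  rw [e]
  refine HasFDerivAt.to_gradCLM h2 fun k => ?_
  simp [eq_comm (a := k)]

lemma wt_nonneg (x : Eu n) : 0 ≤ wt ln b x := Real.rpow_nonneg (le_max_right _ _) _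

lemma wt_le (hb : 0 ≤ b) (x : Eu n) : wt ln b x ≤ (1 + ‖x‖) ^ b := by
  refine Real.rpow_le_rpow (le_max_right _ _) (max_le ?_ (by positivity)) hb
  have := (le_abs_self _).trans (PiLp.norm_apply_le x ln)
  linarith

lemma dwt_le (hb : 1 < b) (x : Eu n) : max (x ln) 0 ^ (b - 1) ≤ (1 + ‖x‖) ^ b := by
  refine (wt_le (ln := ln) (b := b - 1) (by linarith) x).trans ?_
  exact Real.rpow_le_rpow_of_exponent_le (by linarith [norm_nonneg x]) (by linarith)

lemma measurable_max_rpow (b : ℝ) : Measurable fun x : Eu n => max (x ln) 0 ^ b := by fun_prop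

lemma lintegral_mub' (hb : 0 < b) {g : Eu n → ℝ≥0∞} (hg : Measurable g) :
    ∫⁻ x, g x ∂(mub n ln b) = ∫⁻ x, ENNReal.ofReal (wt ln b x) * g x := by
  rw [lintegral_mub ln b hg, ← lintegral_indicator (measurableSet_Hs ln)]
  refine lintegral_congr fun x => ?_
  by_cases hx : x ∈ Hs ln
  · rw [indicator_of_mem hx, wt, max_eq_left (le_of_lt hx)]
  · rw [indicator_of_notMem hx, wt, max_eq_right (not_lt.1 hx), Real.zero_rpow hb.ne',
      ENNReal.ofReal_zero, zero_mul]

/-- Functions decaying like `(1 + ‖x‖)^{-(2s+1)}`. -/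
structure Dec (s : ℝ) (g : Eu n → ℝ) : Prop where
  meas : Measurable g
  bd : ∃ C, 0 ≤ C ∧ ∀ x, |g x| ≤ C * (1 + ‖x‖) ^ (-(2 * s + 1))

lemma Adm.dec {Φ : Eu n → Eu n → ℝ → ℝ} (hb : 0 < b) (hε : 0 < ε) (hs : 0 ≤ s) (hm : s + 1 / 2 ≤ m)
    (h : Adm ln ε m Φ) (hf : BBS f) : Dec s (Ik n ln b Φ f) := by
  refine ⟨h.measurable_Ik hf.meas, ?_⟩
  have := (h.mono hε hm).decay hb hε (by linarith) hf
  rwa [show 2 * (s + 1 / 2) = 2 * s + 1 by ring] at this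

lemma Dec.integrable_mul {g h ω : Eu n → ℝ} (hs : 2 * (s + 1) = (n : ℝ) + b) (hnb : 2 < (n : ℝ) + b)
    (hg : Dec s g) (hh : Dec s h) (hω : Measurable ω) {K : ℝ} (hK : ∀ x, |ω x| ≤ K * (1 + ‖x‖) ^ b) :
    Integrable fun x => g x * h x * ω x := by
  obtain ⟨C, hC0, hC⟩ := hg.bd
  obtain ⟨D, hD0, hD⟩ := hh.bd
  have h0 : Integrable fun x : Eu n => (1 + ‖x‖) ^ (-(2 * n + b - 2)) :=
    integrable_one_add_norm (by rw [finrank_euclideanSpace_fin]; linarith)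
  refine (h0.const_mul (C * D * K)).mono' ((hg.meas.mul hh.meas).mul hω).aestronglyMeasurable
    (ae_of_all _ fun x => ?_)
  have hx : 0 < 1 + ‖x‖ := by positivity
  rw [norm_mul, norm_mul]
  have e : (1 + ‖x‖) ^ (-(2 * n + b - 2)) = (1 + ‖x‖) ^ (-(2 * s + 1)) * (1 + ‖x‖) ^ (-(2 * s + 1)) *
      (1 + ‖x‖) ^ b := by
    rw [← Real.rpow_add hx, ← Real.rpow_add hx]; congr 1; linarith
  calc _ ≤ (C * (1 + ‖x‖) ^ (-(2 * s + 1))) * (D * (1 + ‖x‖) ^ (-(2 * s + 1))) * (K * (1 + ‖x‖) ^ b) := by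
        refine mul_le_mul (mul_le_mul (hC x) (hD x) (norm_nonneg _) (by positivity)) (hK x)
          (norm_nonneg _) (by positivity)
    _ = _ := by rw [e]; ring

lemma abs_wt_le (hb : 0 ≤ b) (x : Eu n) : |wt ln b x| ≤ 1 * (1 + ‖x‖) ^ b := by
  rw [abs_of_nonneg (wt_nonneg x), one_mul]; exact wt_le hb x

/-- Integration by parts against the weight. -/
lemma ibp (hs : 2 * (s + 1) = (n : ℝ) + b) (hnb : 2 < (n : ℝ) + b) (hb : 1 < b) {V U : Eu n → ℝ}
    {DV DU : Fin n → Eu n → ℝ} (hV : Dec s V) (hU : Dec s U) (hDV : ∀ k, Dec s (DV k))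
    (hDU : ∀ k, Dec s (DU k)) (hVd : ∀ x, HasFDerivAt V (gradCLM fun k => DV k x) x)
    (hUd : ∀ x, HasFDerivAt U (gradCLM fun k => DU k x) x) (j : Fin n) :
    ∫ x, DV j x * U x * wt ln b x = - ∫ x, (V x * DU j x * wt ln b x +
      V x * U x * (if j = ln then b * max (x ln) 0 ^ (b - 1) else 0)) := by
  have hw := measurable_max_rpow (ln := ln) b
  have hw1 := measurable_max_rpow (ln := ln) (b - 1)
  have hgd : ∀ x, HasFDerivAt (fun x => U x * wt ln b x) (gradCLM fun k => DU k x * wt ln b x +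
      U x * (if k = ln then b * max (x ln) 0 ^ (b - 1) else 0)) x := fun x => by
    refine HasFDerivAt.to_gradCLM ((hUd x).mul (hasFDerivAt_wt hb x)) fun k => ?_
    simp only [_root_.add_apply, _root_.smul_apply, gradCLM_single, smul_eq_mul]
    ring
  have i1 := hV.integrable_mul hs hnb hU hw (abs_wt_le (by linarith))
  have i2 := (hDV j).integrable_mul hs hnb hU hw (abs_wt_le (by linarith))
  have i3 := hV.integrable_mul hs hnb (hDU j) hw (abs_wt_le (by linarith))
  have i4 : Integrable fun x => V x * U x * (if j = ln then b * max (x ln) 0 ^ (b - 1) else 0) := by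
    refine hV.integrable_mul (K := b) hs hnb hU ?_ fun x => ?_
    · split_ifs
      · exact hw1.const_mul b
      · exact measurable_const
    · have : 0 ≤ max (x ln) 0 := le_max_right _ _
      split_ifs
      · rw [abs_of_nonneg (by positivity)]
        exact mul_le_mul_of_nonneg_left (dwt_le hb x) (by linarith)
      · rw [abs_zero]; positivity
  have key := integral_mul_fderiv_eq_neg_fderiv_mul_of_integrable (μ := volume) (f := V)
    (g := fun x => U x * wt ln b x) (v := EuclideanSpace.single j 1) ?_ ?_ ?_
    (fun x _ => (hVd x).differentiableAt) (fun x _ => (hgd x).differentiableAt)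
  · simp only [(hVd _).fderiv, (hgd _).fderiv, gradCLM_single] at key
    rw [eq_neg_iff_add_eq_zero, add_comm, ← eq_neg_iff_add_eq_zero]
    simp only [mul_add, ← mul_assoc] at key
    exact key
  · simp only [(hVd _).fderiv, gradCLM_single, ← mul_assoc]; exact i2
  · simp only [(hgd _).fderiv, gradCLM_single, mul_add, ← mul_assoc]
    simp only [mul_assoc] at i3 i4 ⊢
    exact i3.add i4
  · simp only [← mul_assoc]; exact i1

lemma g2_comm (i j : Fin n) : g2 ln ε s i j = g2 ln ε s j i := by
  funext x y τ; unfold g2; rw [if_congr (eq_comm (a := i) (b := j)) rfl rfl]; ring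

lemma g3_swap (i j : Fin n) : g3 ln ε s j j i = g3 ln ε s i j j := by
  funext x y τ; unfold g3
  rw [if_congr (eq_comm (a := i) (b := j)) rfl rfl]; simp only [if_true]; ring

lemma add_smul_single_apply {x : Eu n} {i : Fin n} (hi : i ≠ ln) (t : ℝ) :
    (x + t • EuclideanSpace.single i (1:ℝ)) ln = x ln := by
  simp [hi.symm]

/-- The differentiated equation. -/
lemma pde_deriv (hb : 0 < b) (hε : 0 < ε) (hs0 : 0 ≤ s) (hs : 2 * (s + 1) = (n : ℝ) + b) (hf : BBS f)
    {x : Eu n} (hx : x ∈ Hs ln) {i : Fin n} (hi : i ≠ ln) {DP : Eu n → ℝ}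
    (hP : HasDerivAt (fun t : ℝ => Ik n ln b (gP ln b ε s) f (x + t • EuclideanSpace.single i (1:ℝ)))
      (DP x) 0) :
    ∑ j, Ik n ln b (g3 ln ε s i j j) f x + b / x ln * Ik n ln b (g2 ln ε s i ln) f x = DP x := by
  have hl : HasDerivAt (fun t : ℝ => x + t • EuclideanSpace.single i (1:ℝ)) (EuclideanSpace.single i 1) 0 := by
    simpa using ((hasDerivAt_id (0:ℝ)).smul_const (EuclideanSpace.single i (1:ℝ))).const_add x
  have hg : ∀ {G : Eu n → ℝ} {DG : Fin n → Eu n → ℝ},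
      (∀ x, HasFDerivAt G (gradCLM fun k => DG k x) x) →
      HasDerivAt (fun t : ℝ => G (x + t • EuclideanSpace.single i (1:ℝ))) (DG i x) 0 := by
    intro G DG h
    have h0 := h (x + (0:ℝ) • EuclideanSpace.single i (1:ℝ))
    have := h0.comp_hasDerivAt (0:ℝ) hl
    simpa [gradCLM_single, Function.comp_def] using this
  have h2 := fun j => hg (fun x => Ik_hasFDerivAt hb hε (by positivity : 0 ≤ s + 1)
    (adm_g2 (ln := ln) hε hs0 j j) (fun k => (adm_g3 hε hs0 j j k).mono hε (by linarith))
    (fun x y τ hτ => hasFDerivAt_g2 hε hτ j j) hf x)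
  have h1 := hg (fun x => Ik_hasFDerivAt hb hε (by positivity : 0 ≤ s + 1 / 2)
    (adm_g1 (ln := ln) hε hs0 ln) (fun k => (adm_g2 hε hs0 ln k).mono hε (by linarith))
    (fun x y τ hτ => hasFDerivAt_g1 hε hτ ln) hf x)
  have h3 := (HasDerivAt.fun_sum (u := Finset.univ) fun j _ => h2 j).add (h1.const_mul (b / x ln))
  have h4 := h3.unique (hP.congr_of_eventuallyEq (Eventually.of_forall fun t => ?_))
  · simpa only [g3_swap, g2_comm ln i] using h4
  · have hxt := add_smul_single_apply (x := x) hi t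
    have := pde (ln := ln) hb hε hs0 hs hf (x := x + t • EuclideanSpace.single i (1:ℝ)) (by
      show 0 < (x + t • EuclideanSpace.single i (1:ℝ)) ln; rw [hxt]; exact hx)
    rw [hxt] at this
    simpa using this

end

section

variable {n : ℕ} {ln : Fin n} {b ε m s : ℝ} {f : Eu n → ℝ}

lemma integrable_dwt (hs : 2 * (s + 1) = (n : ℝ) + b) (hnb : 2 < (n : ℝ) + b) (hb : 1 < b)
    {V U : Eu n → ℝ} (hV : Dec s V) (hU : Dec s U) (j : Fin n) :
    Integrable fun x => V x * U x * (if j = ln then b * max (x ln) 0 ^ (b - 1) else 0) := by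
  have hw1 := measurable_max_rpow (ln := ln) (b - 1)
  refine hV.integrable_mul (K := b) hs hnb hU ?_ fun x => ?_
  · split_ifs
    · exact hw1.const_mul b
    · exact measurable_const
  · have : 0 ≤ max (x ln) 0 := le_max_right _ _
    split_ifs
    · rw [abs_of_nonneg (by positivity)]
      exact mul_le_mul_of_nonneg_left (dwt_le hb x) (by linarith)
    · rw [abs_zero]; positivity

lemma integrable_wt (hs : 2 * (s + 1) = (n : ℝ) + b) (hnb : 2 < (n : ℝ) + b) (hb : 1 < b)
    {V U : Eu n → ℝ} (hV : Dec s V) (hU : Dec s U) : Integrable fun x => V x * U x * wt ln b x :=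
  hV.integrable_mul hs hnb hU (measurable_max_rpow (ln := ln) b) (abs_wt_le (by linarith))

lemma hasFDerivAt_gP (hε : 0 < ε) {x y : Eu n} {τ : ℝ} (hτ : τ ∈ Ioo (0:ℝ) 1) :
    HasFDerivAt (fun x => gP ln b ε s x y τ) (gradCLM fun k => -2 * s * ((n : ℝ) + b) * ε *
      g1 ln ε (s + 2) k x y τ) x := by
  refine HasFDerivAt.to_gradCLM ((hasFDerivAt_pw hε hτ).const_mul (-2 * s * ((n : ℝ) + b) * ε)) fun k => ?_
  simp [gradCLM_single]

set_option maxHeartbeats 1000000 in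
lemma energy (hb : 1 < b) (hε : 0 < ε) (hs0 : 0 < s) (hs : 2 * (s + 1) = (n : ℝ) + b) (hf : BBS f)
    {i : Fin n} (hi : i ≠ ln) (j : Fin n) :
    ∫ x, Ik n ln b (g2 ln ε s i j) f x * Ik n ln b (g2 ln ε s i j) f x * wt ln b x ≤
      ∫ x, Ik n ln b (gP ln b ε s) f x * Ik n ln b (gP ln b ε s) f x * wt ln b x := by
  have hb0 : 0 < b := by linarith
  have hnb : 2 < (n : ℝ) + b := by linarith
  set DPk : Fin n → Eu n → Eu n → ℝ → ℝ := fun k x y τ => -2 * s * ((n : ℝ) + b) * ε *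
      g1 ln ε (s + 2) k x y τ with hDPk
  have aP : Adm ln ε (s + 2) (gP ln b ε s) := adm_gP hε
  have aDP : ∀ k, Adm ln ε (s + 2) (DPk k) := fun k =>
    ((adm_g1 hε (by linarith : 0 ≤ s + 2) k).const_mul _).mono hε (by linarith)
  set V0 := Ik n ln b (g1 ln ε s i) f with hV0
  set V : Fin n → Eu n → ℝ := fun j => Ik n ln b (g2 ln ε s i j) f with hV
  set W : Fin n → Fin n → Eu n → ℝ := fun j k => Ik n ln b (g3 ln ε s i j k) f with hW
  set P := Ik n ln b (gP ln b ε s) f with hP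
  set DP : Fin n → Eu n → ℝ := fun k => Ik n ln b (DPk k) f with hDP
  have dV0 : Dec s V0 := (adm_g1 hε hs0.le i).dec hb0 hε hs0.le le_rfl hf
  have dV : ∀ j, Dec s (V j) := fun j => (adm_g2 hε hs0.le i j).dec hb0 hε hs0.le (by linarith) hf
  have dW : ∀ j k, Dec s (W j k) := fun j k => (adm_g3 hε hs0.le i j k).dec hb0 hε hs0.le (by linarith) hf
  have dP : Dec s P := aP.dec hb0 hε hs0.le (by linarith) hf
  have dDP : ∀ k, Dec s (DP k) := fun k => (aDP k).dec hb0 hε hs0.le (by linarith) hf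
  have fV0 : ∀ x, HasFDerivAt V0 (gradCLM fun k => V k x) x := fun x =>
    Ik_hasFDerivAt hb0 hε (by positivity : 0 ≤ s + 1 / 2)
    (adm_g1 (ln := ln) hε hs0.le i) (fun k => (adm_g2 hε hs0.le i k).mono hε (by linarith))
    (fun x y τ hτ => hasFDerivAt_g1 hε hτ i) hf x
  have fV : ∀ j x, HasFDerivAt (V j) (gradCLM fun k => W j k x) x := fun j x =>
    Ik_hasFDerivAt hb0 hε (by positivity : 0 ≤ s + 1)
    (adm_g2 (ln := ln) hε hs0.le i j) (fun k => (adm_g3 hε hs0.le i j k).mono hε (by linarith))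
    (fun x y τ hτ => hasFDerivAt_g2 hε hτ i j) hf x
  have fP : ∀ x, HasFDerivAt P (gradCLM fun k => DP k x) x := fun x =>
    Ik_hasFDerivAt hb0 hε (by positivity : 0 ≤ s + 2) aP aDP
    (fun x y τ hτ => hasFDerivAt_gP hε hτ) hf x
  have hI := fun j => ibp hs hnb hb dV0 (dV j) dV (dW j) fV0 (fV j) j (ln := ln)
  have hI2 := ibp hs hnb hb dV0 dP dV dDP fV0 fP i (ln := ln)
  have hsum : ∑ j, ∫ x, V j x * V j x * wt ln b x = ∫ x, V i x * P x * wt ln b x := by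
    rw [hI2]
    simp only [hI]
    have hia : ∀ j, Integrable fun x => V0 x * W j j x * wt ln b x +
        V0 x * V j x * (if j = ln then b * max (x ln) 0 ^ (b - 1) else 0) := fun j =>
      (integrable_wt hs hnb hb dV0 (dW j j)).add (integrable_dwt hs hnb hb dV0 (dV j) j)
    rw [Finset.sum_neg_distrib, ← integral_finsetSum _ fun j _ => hia j]
    congr 2
    funext x
    rw [if_neg hi, mul_zero, add_zero, Finset.sum_add_distrib]
    simp only [mul_ite, mul_zero, Finset.sum_ite_eq', Finset.mem_univ, if_true]
    by_cases hx : x ∈ Hs ln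
    · have hx0 : 0 < x ln := hx
      have hp := pde_deriv hb0 hε hs0.le hs hf hx hi (DP := DP i) (by
        have hl : HasDerivAt (fun t : ℝ => x + t • EuclideanSpace.single i (1:ℝ)) (EuclideanSpace.single i 1) 0 := by
          simpa using ((hasDerivAt_id (0:ℝ)).smul_const (EuclideanSpace.single i (1:ℝ))).const_add x
        have h0 := fP (x + (0:ℝ) • EuclideanSpace.single i (1:ℝ))
        have := h0.comp_hasDerivAt (0:ℝ) hl
        simpa [gradCLM_single, Function.comp_def] using this)
      have e : b * max (x ln) 0 ^ (b - 1) = b / x ln * wt ln b x := by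
        rw [wt, max_eq_left hx0.le, Real.rpow_sub_one hx0.ne']; ring
      rw [← hp, e, ← Finset.sum_mul, ← Finset.mul_sum]
      simp only [hV, hW]
      ring
    · have e : max (x ln) 0 = 0 := max_eq_right (not_lt.1 hx)
      simp only [wt, e, Real.zero_rpow hb0.ne', Real.zero_rpow (by linarith : b - 1 ≠ 0)]
      simp
  have iV := fun j => integrable_wt (ln := ln) hs hnb hb (dV j) (dV j)
  have iP := integrable_wt (ln := ln) hs hnb hb dP dP
  have iVP := integrable_wt (ln := ln) hs hnb hb (dV i) dP
  have hle : ∫ x, V i x * P x * wt ln b x ≤ 1 / 2 * (∫ x, V i x * V i x * wt ln b x) +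
      1 / 2 * ∫ x, P x * P x * wt ln b x := by
    rw [← integral_const_mul, ← integral_const_mul, ← integral_add ((iV i).const_mul _) (iP.const_mul _)]
    refine integral_mono iVP (((iV i).const_mul _).add (iP.const_mul _)) fun x => ?_
    have hw := wt_nonneg (ln := ln) (b := b) x
    show _ ≤ 1 / 2 * (V i x * V i x * wt ln b x) + 1 / 2 * (P x * P x * wt ln b x)
    nlinarith [mul_nonneg (sq_nonneg (V i x - P x)) hw]
  have hnn : ∀ j, 0 ≤ ∫ x, V j x * V j x * wt ln b x := fun j =>
    integral_nonneg fun x => mul_nonneg (mul_self_nonneg _) (wt_nonneg x)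
  have h1 := Finset.single_le_sum (f := fun j => ∫ x, V j x * V j x * wt ln b x) (fun j _ => hnn j)
    (Finset.mem_univ i)
  have h2 := Finset.single_le_sum (f := fun j => ∫ x, V j x * V j x * wt ln b x) (fun j _ => hnn j)
    (Finset.mem_univ j)
  rw [hsum] at h1 h2
  linarith

lemma lintegral_sq_mub (hb : 0 < b) {g : Eu n → ℝ} (hg : Measurable g)
    (hi : Integrable fun x => g x * g x * wt ln b x) :
    ∫⁻ x, ‖g x‖ₑ ^ (2:ℝ) ∂(mub n ln b) = ENNReal.ofReal (∫ x, g x * g x * wt ln b x) := by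
  rw [lintegral_mub' hb (by fun_prop), ofReal_integral_eq_lintegral_ofReal hi
    (ae_of_all _ fun x => mul_nonneg (mul_self_nonneg _) (wt_nonneg x))]
  refine lintegral_congr fun x => ?_
  rw [mul_comm, ENNReal.ofReal_mul (mul_self_nonneg _), ← ofReal_norm,
    ENNReal.ofReal_rpow_of_nonneg (norm_nonneg _) zero_le_two, Real.norm_eq_abs]
  congr 2
  rw [Real.rpow_two, sq_abs, sq]

lemma energy_lintegral (hb : 1 < b) (hε : 0 < ε) (hs0 : 0 < s) (hs : 2 * (s + 1) = (n : ℝ) + b) (hf : BBS f)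
    {i j : Fin n} (hi : i ≠ ln ∨ j ≠ ln) :
    ∫⁻ x, ‖Ik n ln b (g2 ln ε s i j) f x‖ₑ ^ (2:ℝ) ∂(mub n ln b) ≤
      ∫⁻ x, ‖Ik n ln b (gP ln b ε s) f x‖ₑ ^ (2:ℝ) ∂(mub n ln b) := by
  have hb0 : 0 < b := by linarith
  have hnb : 2 < (n : ℝ) + b := by linarith
  have dV : Dec s (Ik n ln b (g2 ln ε s i j) f) :=
    (adm_g2 hε hs0.le i j).dec hb0 hε hs0.le (by linarith) hf
  have dP : Dec s (Ik n ln b (gP ln b ε s) f) := (adm_gP hε).dec hb0 hε hs0.le (by linarith) hf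
  rw [lintegral_sq_mub hb0 dV.meas (integrable_wt hs hnb hb dV dV),
    lintegral_sq_mub hb0 dP.meas (integrable_wt hs hnb hb dP dP)]
  refine ENNReal.ofReal_le_ofReal ?_
  rcases hi with hi | hj
  · exact energy hb hε hs0 hs hf hi j
  · rw [g2_comm]; exact energy hb hε hs0 hs hf hj i

end

section

variable {n : ℕ} {ln : Fin n} {b ε m s p : ℝ} {f : Eu n → ℝ}

lemma Qf_pos {x y : Eu n} {τ : ℝ} (hx : x ∈ Hs ln) (hy : y ∈ Hs ln) (hτ : τ ∈ Ioo (0:ℝ) 1) :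
    0 < Qf ln x y τ := by
  have h1 : 0 < x ln := hx
  have h2 : 0 < y ln := hy
  have := hτ.1
  unfold Qf; positivity

lemma measurable_Qf_right (x : Eu n) : Measurable fun w : Eu n × ℝ => Qf ln x w.1 w.2 := by
  unfold Qf; fun_prop

lemma ae_Qf_nonneg (x : Eu n) : ∀ᵐ w ∂(rhob n ln b), 0 ≤ Qf ln x w.1 w.2 :=
  (ae_rhob ln b).mono fun w hw => Qf_nonneg ln x w.1 hw.2

lemma schur_Qf (hp : 1 < p) {φ : ℝ → ℝ≥0∞} (hφ : Measurable φ) {A : ℝ≥0∞}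
    (h : ∀ x ∈ Hs ln, ∫⁻ w, φ (Qf ln x w.1 w.2) ∂(rhob n ln b) ≤ A) {F : Eu n → ℝ≥0∞}
    (hF : Measurable F) :
    ∫⁻ x, (∫⁻ w, φ (Qf ln x w.1 w.2) * F w.1 ∂(rhob n ln b)) ^ p ∂(mub n ln b) ≤
      A ^ p * ∫⁻ x, F x ^ p ∂(mub n ln b) := by
  have hm : Measurable fun q : (Eu n × Eu n) × ℝ => φ (Qf ln q.1.1 q.1.2 q.2) :=
    hφ.comp (by unfold Qf; fun_prop)
  have hk : Measurable (Function.uncurry fun x y => ∫⁻ τ, φ (Qf ln x y τ) ∂(kap b)) :=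
    hm.lintegral_prod_right'
  have hx : ∀ x, Measurable fun w : Eu n × ℝ => φ (Qf ln x w.1 w.2) := fun x =>
    hφ.comp (measurable_Qf_right x)
  have h1 : ∀ x ∈ Hs ln, ∫⁻ y, ∫⁻ τ, φ (Qf ln x y τ) ∂(kap b) ∂(mub n ln b) ≤ A := fun x hxs => by
    rw [← lintegral_prod _ (hx x).aemeasurable]; exact h x hxs
  have := schur_test hk (ae_mub ln b) h1 (fun y hy => by simpa only [Qf_comm ln _ y] using h1 y hy) hp hF
  refine le_trans (le_of_eq ?_) this
  congr 1; funext x; congr 1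
  have hmx : Measurable fun w : Eu n × ℝ => φ (Qf ln x w.1 w.2) * F w.1 :=
    (hx x).mul (hF.comp measurable_fst)
  rw [lintegral_prod _ hmx.aemeasurable]
  congr 1; funext y
  exact lintegral_mul_const (F y) ((hx x).of_uncurry_left (f := fun y τ => φ (Qf ln x y τ)) (x := y))

lemma enorm_Ik_le (Φ : Eu n → Eu n → ℝ → ℝ) (f : Eu n → ℝ) (x : Eu n) :
    ‖Ik n ln b Φ f x‖ₑ ≤ ∫⁻ w, ‖Φ x w.1 w.2‖ₑ * ‖f w.1‖ₑ ∂(rhob n ln b) := by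
  refine (enorm_integral_le_lintegral_enorm _).trans_eq ?_
  simp only [enorm_mul]

lemma pw_le_Qf (hε : 0 ≤ ε) (hm : 0 ≤ m) {x y : Eu n} {τ : ℝ} (hQ : 0 < Qf ln x y τ) :
    pw ln ε m x y τ ≤ Qf ln x y τ ^ (-m) :=
  Real.rpow_le_rpow_of_nonpos hQ (by linarith) (by linarith)

/-- The defect kernel is uniformly bounded on `L^p`. -/
lemma gP_Lp (ln : Fin n) (hb : 0 < b) (hs0 : 0 < s) (hs : 2 * (s + 1) = (n : ℝ) + b) : ∃ A : ℝ≥0∞, A ≠ ⊤ ∧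
    ∀ ε, 0 < ε → ∀ p : ℝ, 1 < p → ∀ f, BBS f →
    ∫⁻ x, ‖Ik n ln b (gP ln b ε s) f x‖ₑ ^ p ∂(mub n ln b) ≤ A ^ p * ∫⁻ x, ‖f x‖ₑ ^ p ∂(mub n ln b) := by
  obtain ⟨C, hC0, hC⟩ := rhob_Qf_le ln hb
  have hd : ((n : ℝ) + b) / 2 = s + 1 := by linarith
  rw [hd] at hC
  set c := 2 * s * ((n : ℝ) + b) with hc
  have hc0 : 0 ≤ c := by have : (0:ℝ) ≤ n := Nat.cast_nonneg n; positivity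
  refine ⟨ENNReal.ofReal (c * C) + ENNReal.ofReal (c * (C * ((s + 2) / (s + 2 - (s + 1))))), by finiteness,
    fun ε hε p hp f hf => ?_⟩
  set φ : ℝ → ℝ≥0∞ := fun q => ENNReal.ofReal (c * ε * (q + ε) ^ (-(s + 2))) with hφ
  have hφm : Measurable φ := by fun_prop
  have key : ∀ x ∈ Hs ln, ∫⁻ w, φ (Qf ln x w.1 w.2) ∂(rhob n ln b) ≤
      ENNReal.ofReal (c * C) + ENNReal.ofReal (c * (C * ((s + 2) / (s + 2 - (s + 1))))) := by
    intro x hx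
    have hQm := measurable_Qf_right (ln := ln) x
    have hS : MeasurableSet {w : Eu n × ℝ | Qf ln x w.1 w.2 ≤ ε} := measurableSet_le hQm measurable_const
    rw [← lintegral_add_compl _ hS]
    refine add_le_add ?_ ?_
    · calc ∫⁻ w in {w : Eu n × ℝ | Qf ln x w.1 w.2 ≤ ε}, φ (Qf ln x w.1 w.2) ∂(rhob n ln b)
          ≤ ∫⁻ w in {w : Eu n × ℝ | Qf ln x w.1 w.2 ≤ ε}, ENNReal.ofReal (c * ε * ε ^ (-(s + 2))) ∂(rhob n ln b) := by
            refine lintegral_mono_ae (ae_restrict_of_ae ((ae_Qf_nonneg x).mono fun w hw => ?_))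
            refine ENNReal.ofReal_le_ofReal (mul_le_mul_of_nonneg_left ?_ (by positivity))
            exact Real.rpow_le_rpow_of_nonpos hε (by linarith) (by linarith)
        _ ≤ ENNReal.ofReal (c * ε * ε ^ (-(s + 2))) * ENNReal.ofReal (C * ε ^ (s + 1)) := by
            rw [setLIntegral_const]
            gcongr
            exact hC x hx ε hε
        _ = _ := by
            rw [← ENNReal.ofReal_mul (by positivity)]
            congr 1
            have : ε * ε ^ (-(s + 2)) * ε ^ (s + 1) = 1 := by
              rw [← Real.rpow_one_add' hε.le (by linarith), ← Real.rpow_add hε,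
                show 1 + -(s + 2) + (s + 1) = 0 by ring, Real.rpow_zero]
            linear_combination c * C * this
    · calc ∫⁻ w in {w : Eu n × ℝ | Qf ln x w.1 w.2 ≤ ε}ᶜ, φ (Qf ln x w.1 w.2) ∂(rhob n ln b)
          ≤ ∫⁻ w in {w : Eu n × ℝ | ε ≤ Qf ln x w.1 w.2}, φ (Qf ln x w.1 w.2) ∂(rhob n ln b) :=
            lintegral_mono_set fun w hw => (not_le.1 (show ¬ Qf ln x w.1 w.2 ≤ ε from hw)).le
        _ ≤ ∫⁻ w in {w : Eu n × ℝ | ε ≤ Qf ln x w.1 w.2}, ENNReal.ofReal (c * ε) *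
              ENNReal.ofReal (Qf ln x w.1 w.2 ^ (-(s + 2))) ∂(rhob n ln b) := by
            refine setLIntegral_mono (by fun_prop) fun w hw => ?_
            have hw : ε ≤ Qf ln x w.1 w.2 := hw
            rw [← ENNReal.ofReal_mul (by positivity)]
            refine ENNReal.ofReal_le_ofReal (mul_le_mul_of_nonneg_left ?_ (by positivity))
            exact Real.rpow_le_rpow_of_nonpos (hε.trans_le hw) (by linarith) (by linarith)
        _ ≤ ENNReal.ofReal (c * ε) * ENNReal.ofReal (C * ((s + 2) / (s + 2 - (s + 1))) * ε ^ (s + 1 - (s + 2))) := by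
            rw [lintegral_const_mul _ (by fun_prop)]
            gcongr
            exact lintegral_far hQm (ae_Qf_nonneg x) hC0.le (hC x hx) (by linarith) (by linarith) hε
        _ = _ := by
            rw [← ENNReal.ofReal_mul (by positivity)]
            congr 1
            have : ε * ε ^ (s + 1 - (s + 2)) = 1 := by
              rw [show s + 1 - (s + 2) = -1 by ring, Real.rpow_neg_one, mul_inv_cancel₀ hε.ne']
            linear_combination c * (C * ((s + 2) / (s + 2 - (s + 1)))) * this
  have h := schur_Qf hp hφm key (F := fun x => ‖f x‖ₑ) hf.meas.enorm
  refine le_trans (lintegral_mono fun x => ENNReal.rpow_le_rpow ?_ (by linarith)) h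
  refine (enorm_Ik_le _ _ _).trans (lintegral_mono_ae ((ae_rhob ln b).mono fun w hw => ?_))
  refine mul_le_mul_left ?_ _
  rw [← ofReal_norm, Real.norm_eq_abs]
  refine ENNReal.ofReal_le_ofReal (le_of_eq ?_)
  have := pw_nonneg (ln := ln) (s := s + 2) (x := x) (y := w.1) hε.le hw.2
  rw [gP, show -2 * s * ((n : ℝ) + b) * ε * pw ln ε (s + 2) x w.1 w.2 =
    -(c * ε * pw ln ε (s + 2) x w.1 w.2) by rw [hc]; ring, abs_neg, abs_of_nonneg (by positivity)]
  rfl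

lemma one_add_norm_sq_le_Qf {x y : Eu n} {τ : ℝ} (hx : x ∈ Hs ln) (hy : y ∈ Hs ln)
    (hτ : τ ∈ Ioo (0:ℝ) 1) (hy1 : ‖y‖ ≤ 1) (hQ : 4 ≤ Qf ln x y τ) : (1 + ‖x‖) ^ 2 ≤ 4 * Qf ln x y τ := by
  have h := norm_sq_le_Qf ln hτ (le_of_lt hx) (le_of_lt hy)
  have h1 : ‖x‖ ≤ ‖x - y‖ + ‖y‖ := by simpa using norm_add_le (x - y) y
  nlinarith [sq_nonneg (‖x - y‖ - 2), norm_nonneg x, norm_nonneg (x - y)]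

lemma mub_one_add_norm_lt_top (hb : 0 < b) {r : ℝ} (hr : (n : ℝ) + b < r) :
    ∫⁻ x, ENNReal.ofReal ((1 + ‖x‖) ^ (-r)) ∂(mub n ln b) < ⊤ := by
  rw [lintegral_mub' hb (by fun_prop)]
  have h0 : Integrable fun x : Eu n => (1 + ‖x‖) ^ (-(r - b)) :=
    integrable_one_add_norm (by rw [finrank_euclideanSpace_fin]; linarith)
  refine lt_of_le_of_lt (lintegral_mono fun x => ?_) h0.lintegral_lt_top
  rw [← ENNReal.ofReal_mul (wt_nonneg x)]
  refine ENNReal.ofReal_le_ofReal ?_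
  have hx : 0 < 1 + ‖x‖ := by positivity
  rw [show -(r - b) = b + -r by ring, Real.rpow_add hx]
  exact mul_le_mul_of_nonneg_right (wt_le hb.le x) (by positivity)

/-- `L^p` bound for the potentials of functions supported in the unit ball. -/
lemma pot_Lp (ln : Fin n) (hb : 0 < b) (hs : 2 * (s + 1) = (n : ℝ) + b) (hm : 0 < m) (hms : m < s + 1)
    (hp : 1 < p) (hmp : (n : ℝ) + b < 2 * m * p) : ∃ A : ℝ≥0∞, A ≠ ⊤ ∧
    ∀ f : Eu n → ℝ, Measurable f → (∀ y, f y ≠ 0 → ‖y‖ ≤ 1) →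
    ∫⁻ x, (∫⁻ w, ENNReal.ofReal (Qf ln x w.1 w.2 ^ (-m)) * ‖f w.1‖ₑ ∂(rhob n ln b)) ^ p ∂(mub n ln b) ≤
      A * ∫⁻ x, ‖f x‖ₑ ^ p ∂(mub n ln b) := by
  obtain ⟨C, hC0, hC⟩ := rhob_Qf_le ln hb
  have hd : ((n : ℝ) + b) / 2 = s + 1 := by linarith
  rw [hd] at hC
  set D : ℝ≥0∞ := ENNReal.ofReal (C * ((s + 1) / (s + 1 - m)) * 4 ^ (s + 1 - m)) with hD
  set E := ∫⁻ x, ENNReal.ofReal ((1 + ‖x‖) ^ (-(2 * m * p))) ∂(mub n ln b) with hE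
  have hEt : E < ⊤ := mub_one_add_norm_lt_top hb hmp
  set κ := kap b univ
  have hκ : κ < ⊤ := kap_univ_lt hb
  set B := mub n ln b (Metric.closedBall 0 1)
  have hB : B < ⊤ := mub_closedBall_lt_top ln hb 0 1
  have hpq := Real.HolderConjugate.conjExponent hp
  set q := p.conjExponent
  have hp0 : 0 < p := by linarith
  refine ⟨2 ^ (p - 1) * (D ^ p + (ENNReal.ofReal (4 ^ m)) ^ p * E * (κ * B ^ (1 / q)) ^ p), ?_, fun f hf hf1 => ?_⟩
  · have := hpq.symm.pos
    have h2 : (0:ℝ) ≤ p - 1 := by linarith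
    have h3 : B ^ (1 / q) ≠ ⊤ := ENNReal.rpow_ne_top_of_nonneg (by positivity) hB.ne
    have h4 : (κ * B ^ (1 / q)) ^ p ≠ ⊤ := ENNReal.rpow_ne_top_of_nonneg hp0.le (ENNReal.mul_ne_top hκ.ne h3)
    have h5 : (2:ℝ≥0∞) ^ (p - 1) ≠ ⊤ := ENNReal.rpow_ne_top_of_nonneg h2 (by simp)
    have h6 : D ^ p ≠ ⊤ := ENNReal.rpow_ne_top_of_nonneg hp0.le (by simp [hD])
    have h7 : (ENNReal.ofReal (4 ^ m)) ^ p ≠ ⊤ := ENNReal.rpow_ne_top_of_nonneg hp0.le (by simp)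
    exact ENNReal.mul_ne_top h5 (ENNReal.add_ne_top.2 ⟨h6, ENNReal.mul_ne_top (ENNReal.mul_ne_top h7 hEt.ne) h4⟩)
  set φ : ℝ → ℝ≥0∞ := fun t => (Iic (4:ℝ)).indicator (fun t => ENNReal.ofReal (t ^ (-m))) t with hφ
  have hφm : Measurable φ := Measurable.indicator (by fun_prop) measurableSet_Iic
  set I := ∫⁻ x, ‖f x‖ₑ ^ p ∂(mub n ln b) with hI
  have near := schur_Qf (ln := ln) (b := b) (A := D) hp hφm (fun x hx => by
    have hQm := measurable_Qf_right (ln := ln) x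
    have := lintegral_near hQm (ae_Qf_nonneg (b := b) x) hC0.le (hC x hx) hm hms (by norm_num : (0:ℝ) < 4)
    rw [← lintegral_indicator (measurableSet_le hQm measurable_const)] at this
    exact this) hf.enorm
  set L := ∫⁻ w, ‖f w.1‖ₑ ∂(rhob n ln b) with hL
  have hLle : L ≤ κ * B ^ (1 / q) * I ^ (1 / p) := by
    have h1 : L = (∫⁻ y, ‖f y‖ₑ ∂(mub n ln b)) * κ := by
      rw [hL, lintegral_prod _ (by fun_prop)]
      simp only [lintegral_const]
      exact lintegral_mul_const _ (by fun_prop)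
    have h2 : ∫⁻ y, ‖f y‖ₑ ∂(mub n ln b) ≤ I ^ (1 / p) * B ^ (1 / q) := by
      have h3 : ∀ y, ‖f y‖ₑ = ‖f y‖ₑ * (Metric.closedBall (0 : Eu n) 1).indicator 1 y := by
        intro y
        by_cases hy : f y = 0
        · simp [hy]
        · rw [indicator_of_mem (by simpa using hf1 y hy)]; simp
      rw [lintegral_congr h3]
      refine (ENNReal.lintegral_mul_le_Lp_mul_Lq _ hpq hf.enorm.aemeasurable
        (measurable_one.indicator Metric.isClosed_closedBall.measurableSet).aemeasurable).trans ?_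
      refine mul_le_mul_right (le_of_eq ?_) _
      congr 1
      rw [show B = mub n ln b (Metric.closedBall 0 1) from rfl,
        ← lintegral_indicator_one Metric.isClosed_closedBall.measurableSet]
      refine lintegral_congr fun y => ?_
      by_cases hy : y ∈ Metric.closedBall (0 : Eu n) 1
      · simp only [indicator_of_mem hy, Pi.one_apply, ENNReal.one_rpow]
      · simp only [indicator_of_notMem hy]
        exact ENNReal.zero_rpow_of_pos hpq.symm.pos
    rw [h1]
    calc _ ≤ I ^ (1 / p) * B ^ (1 / q) * κ := by gcongr
      _ = _ := by ring
  have split : ∀ x ∈ Hs ln, ∫⁻ w, ENNReal.ofReal (Qf ln x w.1 w.2 ^ (-m)) * ‖f w.1‖ₑ ∂(rhob n ln b) ≤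
      ∫⁻ w, φ (Qf ln x w.1 w.2) * ‖f w.1‖ₑ ∂(rhob n ln b) +
        ENNReal.ofReal (4 ^ m) * ENNReal.ofReal ((1 + ‖x‖) ^ (-(2 * m))) * L := by
    intro x hx
    have hm1 : Measurable fun w : Eu n × ℝ => φ (Qf ln x w.1 w.2) * ‖f w.1‖ₑ :=
      (hφm.comp (measurable_Qf_right x)).mul (by fun_prop)
    rw [hL, ← lintegral_const_mul _ (by fun_prop), ← lintegral_add_left hm1]
    refine lintegral_mono_ae ((ae_rhob ln b).mono fun w hw => ?_)
    by_cases hy : f w.1 = 0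
    · simp [hy]
    rw [← add_mul]
    refine mul_le_mul_left ?_ _
    by_cases hQ : Qf ln x w.1 w.2 ≤ 4
    · refine le_add_right (le_of_eq ?_)
      simp only [hφ]; rw [indicator_of_mem (mem_Iic.2 hQ)]
    · refine le_add_left ?_
      rw [← ENNReal.ofReal_mul (by positivity)]
      refine ENNReal.ofReal_le_ofReal ?_
      have h1 := one_add_norm_sq_le_Qf hx hw.1 hw.2 (hf1 _ hy) (not_le.1 hQ).le
      have hx0 : 0 < 1 + ‖x‖ := by positivity
      have h2 : (1 + ‖x‖) ^ 2 / 4 ≤ Qf ln x w.1 w.2 := by linarith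
      refine (Real.rpow_le_rpow_of_nonpos (by positivity) h2 (by linarith)).trans_eq ?_
      rw [Real.div_rpow (by positivity) (by norm_num), Real.rpow_neg (by norm_num : (0:ℝ) ≤ 4), div_inv_eq_mul,
        mul_comm, ← Real.rpow_natCast, ← Real.rpow_mul hx0.le]
      congr 2; push_cast; ring
  calc _ ≤ ∫⁻ x, 2 ^ (p - 1) * ((∫⁻ w, φ (Qf ln x w.1 w.2) * ‖f w.1‖ₑ ∂(rhob n ln b)) ^ p +
        (ENNReal.ofReal (4 ^ m) * ENNReal.ofReal ((1 + ‖x‖) ^ (-(2 * m))) * L) ^ p) ∂(mub n ln b) := by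
        refine lintegral_mono_ae ((ae_mub ln b).mono fun x hx => ?_)
        exact (ENNReal.rpow_le_rpow (split x hx) hp0.le).trans
          (ENNReal.rpow_add_le_mul_rpow_add_rpow _ _ hp.le)
    _ = 2 ^ (p - 1) * (∫⁻ x, (∫⁻ w, φ (Qf ln x w.1 w.2) * ‖f w.1‖ₑ ∂(rhob n ln b)) ^ p ∂(mub n ln b) +
        ENNReal.ofReal (4 ^ m) ^ p * E * L ^ p) := by
        rw [lintegral_const_mul', lintegral_add_right]
        · congr 2
          rw [hE, ← lintegral_const_mul _ (by fun_prop), ← lintegral_mul_const _ (by fun_prop)]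
          refine lintegral_congr fun x => ?_
          rw [ENNReal.mul_rpow_of_nonneg _ _ hp0.le, ENNReal.mul_rpow_of_nonneg _ _ hp0.le]
          congr 2
          rw [ENNReal.ofReal_rpow_of_nonneg (by positivity) hp0.le, ← Real.rpow_mul (by positivity)]
          congr 2; ring
        · fun_prop
        · exact ENNReal.rpow_ne_top_of_nonneg (by linarith) (by simp)
    _ ≤ 2 ^ (p - 1) * (D ^ p * I + ENNReal.ofReal (4 ^ m) ^ p * E * (κ * B ^ (1 / q) * I ^ (1 / p)) ^ p) := by
        gcongr
    _ = _ := by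
        rw [ENNReal.mul_rpow_of_nonneg _ (I ^ (1 / p)) hp0.le, ← ENNReal.rpow_mul, one_div_mul_cancel hp0.ne',
          ENNReal.rpow_one]
        ring

end

section

variable {n : ℕ} {ln : Fin n} {b ε m s p : ℝ} {f : Eu n → ℝ}

/-! ### Hörmander's condition -/

lemma sqrt_Qf_le (hε : 0 ≤ ε) (x y c : Eu n) {τ : ℝ} (hτ : τ ∈ Ioo (0:ℝ) 1) :
    √(Qf ln x y τ + ε) ≤ √(Qf ln x c τ + ε) + ‖y - c‖ := by
  have hQ := Qf_nonneg ln x c hτ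
  set S := √(Qf ln x c τ + ε) with hS
  have hS0 : 0 ≤ S := Real.sqrt_nonneg _
  have hS2 : S ^ 2 = Qf ln x c τ + ε := Real.sq_sqrt (by linarith)
  rw [Real.sqrt_le_left (by positivity)]
  rw [Qf_eq] at hS2 ⊢
  obtain ⟨h0, h1⟩ := hτ
  have e1 : ‖x - y‖ ≤ ‖x - c‖ + ‖y - c‖ := by
    have := norm_sub_le (x - c) (y - c); simpa using this
  have e2 : ‖x - reflLn ln y‖ ≤ ‖x - reflLn ln c‖ + ‖y - c‖ := by
    have h := norm_sub_le (x - reflLn ln c) (reflLn ln (y - c))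
    rw [norm_reflLn] at h
    have e : x - reflLn ln y = (x - reflLn ln c) - reflLn ln (y - c) := by
      ext k
      simp only [PiLp.sub_apply, reflLn_apply]
      split_ifs <;> ring
    rwa [e]
  have f1 : ‖x - y‖ ^ 2 ≤ (‖x - c‖ + ‖y - c‖) ^ 2 := by gcongr
  have f2 : ‖x - reflLn ln y‖ ^ 2 ≤ (‖x - reflLn ln c‖ + ‖y - c‖) ^ 2 := by gcongr
  set u := ‖x - c‖
  set v := ‖x - reflLn ln c‖
  set d := ‖y - c‖
  have hd : 0 ≤ d := norm_nonneg _
  have hcs : u * (1 - τ) + v * τ ≤ S := by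
    refine abs_le_of_sq_le_sq' ?_ hS0 |>.2
    rw [hS2]
    nlinarith [mul_nonneg (mul_nonneg h0.le (sub_nonneg.2 h1.le)) (sq_nonneg (u - v))]
  nlinarith [mul_le_mul_of_nonneg_right f1 (sub_nonneg.2 h1.le), mul_le_mul_of_nonneg_right f2 h0.le,
    mul_le_mul_of_nonneg_left hcs hd]

lemma abs_Xf_sub_right (i : Fin n) (x y c : Eu n) {τ : ℝ} (hτ : τ ∈ Ioo (0:ℝ) 1) :
    |Xf ln i x y τ - Xf ln i x c τ| ≤ ‖y - c‖ := by
  have h : |(y - c) i| ≤ ‖y - c‖ := PiLp.norm_apply_le (y - c) i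
  rw [PiLp.sub_apply] at h
  unfold Xf
  split_ifs with hi
  · subst hi
    rw [show x i - y i + 2 * τ * y i - (x i - c i + 2 * τ * c i) = -(1 - 2 * τ) * (y i - c i) by ring, abs_mul]
    have : |-(1 - 2 * τ)| ≤ 1 := by rw [abs_le]; constructor <;> linarith [hτ.1, hτ.2]
    nlinarith [abs_nonneg (y i - c i), abs_nonneg (-(1 - 2 * τ))]
  · rw [show x i - y i + 0 - (x i - c i + 0) = -(y i - c i) by ring, abs_neg]; exact h

lemma abs_Xf_sub_left (i : Fin n) (x y c : Eu n) (τ : ℝ) :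
    |Xf ln i y x τ - Xf ln i c x τ| ≤ ‖y - c‖ := by
  have h : |(y - c) i| ≤ ‖y - c‖ := PiLp.norm_apply_le (y - c) i
  rw [PiLp.sub_apply] at h
  unfold Xf
  rw [add_sub_add_right_eq_sub, sub_sub_sub_cancel_right]
  exact h

lemma abs_rpow_neg_sub_le {a R R' δ : ℝ} (ha : 0 < a) (hR : 0 < R) (hR' : R / 2 ≤ R') (hδ : |R' - R| ≤ δ) :
    |R' ^ (-a) - R ^ (-a)| ≤ a * 2 ^ (a + 1) * δ * R ^ (-a - 1) := by
  have h := (convex_Ici (R / 2)).norm_image_sub_le_of_norm_hasDerivWithin_le (f := fun t : ℝ => t ^ (-a))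
    (f' := fun t => -a * t ^ (-a - 1)) (C := a * (R / 2) ^ (-a - 1))
    (fun t ht => (Real.hasDerivAt_rpow_const (Or.inl (by
      have : R / 2 ≤ t := ht
      linarith))).hasDerivWithinAt)
    (fun t ht => by
      have ht : R / 2 ≤ t := ht
      have ht0 : 0 < t := by linarith
      rw [norm_mul, norm_neg, Real.norm_of_nonneg ha.le, Real.norm_of_nonneg (by positivity)]
      exact mul_le_mul_of_nonneg_left (Real.rpow_le_rpow_of_nonpos (by positivity) ht (by linarith)) ha.le)
    (show R ∈ Ici (R / 2) by rw [mem_Ici]; linarith) hR'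
  rw [Real.norm_eq_abs, Real.norm_eq_abs] at h
  refine h.trans ?_
  rw [Real.div_rpow hR.le (by norm_num), show (2:ℝ) ^ (a + 1) = (2 ^ (-a - 1))⁻¹ by
    rw [← Real.rpow_neg (by norm_num)]; congr 1; ring]
  calc _ ≤ a * (R ^ (-a - 1) / 2 ^ (-a - 1)) * δ := mul_le_mul_of_nonneg_left hδ (by positivity)
    _ = _ := by ring

lemma abs_prod_sub_le {a R R' δ X X' Y Y' : ℝ} (ha : 1 < a) (hR : 0 < R) (hR' : R / 2 ≤ R')
    (hδ : |R' - R| ≤ δ) (hX : |X| ≤ R) (hY : |Y| ≤ R) (hY' : |Y'| ≤ R') (hXX : |X' - X| ≤ δ) (hYY : |Y' - Y| ≤ δ) :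
    |R' ^ (-a) * X' * Y' - R ^ (-a) * X * Y| ≤ (2 ^ (a - 1) + 2 ^ a + a * 2 ^ (a + 1)) * δ * R ^ (1 - a) := by
  have hR0 : 0 < R' := by linarith
  have hδ0 : 0 ≤ δ := (abs_nonneg _).trans hδ
  have h1 : R' ^ (-a) ≤ 2 ^ a * R ^ (-a) := by
    calc R' ^ (-a) ≤ (R / 2) ^ (-a) := Real.rpow_le_rpow_of_nonpos (by positivity) hR' (by linarith)
      _ = _ := by rw [Real.div_rpow hR.le (by norm_num), Real.rpow_neg (by norm_num : (0:ℝ) ≤ 2)]; field_simp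
  have h2 : R' ^ (1 - a) ≤ 2 ^ (a - 1) * R ^ (1 - a) := by
    calc R' ^ (1 - a) ≤ (R / 2) ^ (1 - a) := Real.rpow_le_rpow_of_nonpos (by positivity) hR' (by linarith)
      _ = _ := by
        rw [Real.div_rpow hR.le (by norm_num), show (1 - a) = -(a - 1) by ring,
          Real.rpow_neg (by norm_num : (0:ℝ) ≤ 2)]; field_simp
  have h3 := abs_rpow_neg_sub_le (by linarith : 0 < a) hR hR' hδ
  have hRa : R * R ^ (-a) = R ^ (1 - a) := by
    rw [← Real.rpow_one_add' hR.le (by linarith)]; congr 1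
  have hRa' : R' ^ (-a) * R' = R' ^ (1 - a) := by
    rw [mul_comm, ← Real.rpow_one_add' hR0.le (by linarith)]; congr 1
  have hRb : R * R * R ^ (-a - 1) = R ^ (1 - a) := by
    rw [show 1 - a = 1 + (1 + (-a - 1)) by ring, Real.rpow_add hR, Real.rpow_add hR, Real.rpow_one]; ring
  rw [show R' ^ (-a) * X' * Y' - R ^ (-a) * X * Y =
    (X' - X) * (R' ^ (-a) * Y') + X * ((Y' - Y) * R' ^ (-a)) + X * Y * (R' ^ (-a) - R ^ (-a)) by ring]
  have p1 : |(X' - X) * (R' ^ (-a) * Y')| ≤ δ * (2 ^ (a - 1) * R ^ (1 - a)) := by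
    rw [abs_mul, abs_mul, abs_of_nonneg (by positivity : 0 ≤ R' ^ (-a))]
    refine mul_le_mul hXX ?_ (by positivity) hδ0
    refine le_trans ?_ h2
    rw [← hRa']
    gcongr
  have p2 : |X * ((Y' - Y) * R' ^ (-a))| ≤ δ * (2 ^ a * R ^ (1 - a)) := by
    rw [abs_mul, abs_mul, abs_of_nonneg (by positivity : 0 ≤ R' ^ (-a))]
    calc _ ≤ R * (δ * (2 ^ a * R ^ (-a))) := by gcongr
      _ = _ := by rw [← hRa]; ring
  have p3 : |X * Y * (R' ^ (-a) - R ^ (-a))| ≤ δ * (a * 2 ^ (a + 1) * R ^ (1 - a)) := by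
    rw [abs_mul, abs_mul]
    calc _ ≤ R * R * (a * 2 ^ (a + 1) * δ * R ^ (-a - 1)) := by gcongr
      _ = _ := by rw [← hRb]; ring
  refine (abs_add_three _ _ _).trans ?_
  linear_combination p1 + p2 + p3

lemma pw_eq_sqrt (hε : 0 < ε) {x y : Eu n} {τ : ℝ} (hτ : τ ∈ Ioo (0:ℝ) 1) :
    pw ln ε s x y τ = √(Qf ln x y τ + ε) ^ (-(2 * s)) := by
  rw [pw, Real.sqrt_eq_rpow, ← Real.rpow_mul (Qfe_pos hε hτ).le]; congr 1; ring

/-- The Lipschitz constant for the second derivative kernels. -/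
def lipC (s : ℝ) : ℝ :=
  4 * s * (s + 1) * (2 ^ (2 * (s + 2) - 1) + 2 ^ (2 * (s + 2)) + 2 * (s + 2) * 2 ^ (2 * (s + 2) + 1)) +
    2 * s * (2 * (s + 1) * 2 ^ (2 * (s + 1) + 1))

lemma lipC_nonneg (hs : 0 < s) : 0 ≤ lipC s := by unfold lipC; positivity

lemma abs_g2_sub_le (hε : 0 < ε) (hs : 0 < s) (i j : Fin n) {x y x' y' : Eu n} {τ δ : ℝ} (hτ : τ ∈ Ioo (0:ℝ) 1)
    (hR : √(Qf ln x y τ + ε) / 2 ≤ √(Qf ln x' y' τ + ε))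
    (hδ : |√(Qf ln x' y' τ + ε) - √(Qf ln x y τ + ε)| ≤ δ)
    (hi : |Xf ln i x' y' τ - Xf ln i x y τ| ≤ δ) (hj : |Xf ln j x' y' τ - Xf ln j x y τ| ≤ δ) :
    |g2 ln ε s i j x' y' τ - g2 ln ε s i j x y τ| ≤ lipC s * δ * pw ln ε (s + 3 / 2) x y τ := by
  have hR0 : 0 < √(Qf ln x y τ + ε) := Real.sqrt_pos.2 (Qfe_pos hε hτ)
  have hXi := fun (x y : Eu n) => abs_Xf_le (ln := ln) (x := x) (y := y) hε.le hτ i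
  have hXj := fun (x y : Eu n) => abs_Xf_le (ln := ln) (x := x) (y := y) hε.le hτ j
  simp only [← Real.sqrt_eq_rpow] at hXi hXj
  have h1 := abs_prod_sub_le (a := 2 * (s + 2)) (by linarith) hR0 hR hδ (hXi x y) (hXj x y) (hXj x' y') hi hj
  have h2 := abs_rpow_neg_sub_le (a := 2 * (s + 1)) (by linarith) hR0 hR hδ
  have h3 : |(if i = j then (1:ℝ) else 0) * (√(Qf ln x' y' τ + ε) ^ (-(2 * (s + 1))) -
      √(Qf ln x y τ + ε) ^ (-(2 * (s + 1))))| ≤ _ := abs_delta_mul_le h2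
  rw [show 1 - 2 * (s + 2) = -(2 * (s + 3 / 2)) by ring] at h1
  rw [show -(2 * (s + 1)) - 1 = -(2 * (s + 3 / 2)) by ring] at h3
  unfold g2
  simp only [pw_eq_sqrt hε hτ]
  set P := √(Qf ln x y τ + ε) ^ (-(2 * (s + 3 / 2)))
  rw [show ∀ a b c d e f g h : ℝ, a * b - c * (d * e) - (a * f - c * (d * h)) =
    a * (b - f) - c * (d * (e - h)) from fun a b c d e f g h => by ring]
  · refine (abs_sub _ _).trans ?_
    rw [abs_mul, abs_mul (2 * s), abs_of_nonneg (by positivity : 0 ≤ 4 * s * (s + 1)),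
      abs_of_nonneg (by positivity : 0 ≤ 2 * s), lipC]
    linear_combination (4 * s * (s + 1)) * h1 + 2 * s * h3
  · exact 0

lemma hor_of_bound (ln : Fin n) (hb : 0 < b) (hs0 : 0 < s) (hs : 2 * (s + 1) = (n : ℝ) + b) :
    ∃ A : ℝ≥0∞, A ≠ ⊤ ∧ ∀ Φ : Eu n → Eu n → ℝ → ℝ,
      (∀ x ∈ Hs ln, ∀ y ∈ Hs ln, Integrable (fun τ => Φ x y τ) (kap b)) →
      (∀ x ∈ Hs ln, ∀ y ∈ Hs ln, ∀ c ∈ Hs ln, ∀ τ ∈ Ioo (0:ℝ) 1, ∀ r > 0, ‖y - c‖ ≤ r → 2 * r ≤ ‖x - c‖ →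
        |Φ x y τ - Φ x c τ| ≤ lipC s * r * Qf ln x c τ ^ (-(s + 3 / 2))) →
      ∀ y ∈ Hs ln, ∀ c ∈ Hs ln, ∀ r, dist y c ≤ r →
        ∫⁻ x in (Metric.closedBall c (2 * r))ᶜ, ‖kerI b Φ x y - kerI b Φ x c‖ₑ ∂(mub n ln b) ≤ A := by
  obtain ⟨C, hC0, hC⟩ := rhob_Qf_le ln hb
  have hd : ((n : ℝ) + b) / 2 = s + 1 := by linarith
  rw [hd] at hC
  have hL := lipC_nonneg hs0
  refine ⟨ENNReal.ofReal (lipC s * (C * ((s + 3 / 2) / (s + 3 / 2 - (s + 1)))) / 2), by finiteness,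
    fun Φ hI hΦ y hy c hc r hr => ?_⟩
  rcases (dist_nonneg.trans hr).eq_or_lt with h0 | hr0
  · have : y = c := dist_le_zero.1 (by rwa [← h0] at hr)
    subst this; simp
  rw [dist_eq_norm] at hr
  have hQm := measurable_Qf_right (ln := ln) c
  have hS : MeasurableSet (Metric.closedBall c (2 * r))ᶜ := Metric.isClosed_closedBall.measurableSet.compl
  calc ∫⁻ x in (Metric.closedBall c (2 * r))ᶜ, ‖kerI b Φ x y - kerI b Φ x c‖ₑ ∂(mub n ln b)
      ≤ ∫⁻ x in (Metric.closedBall c (2 * r))ᶜ, ∫⁻ τ, ({w | 4 * r ^ 2 ≤ Qf ln c w.1 w.2}).indicator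
          (fun w => ENNReal.ofReal (lipC s * r) * ENNReal.ofReal (Qf ln c w.1 w.2 ^ (-(s + 3 / 2)))) (x, τ)
          ∂(kap b) ∂(mub n ln b) := by
        refine lintegral_mono_ae ?_
        filter_upwards [ae_restrict_of_ae (ae_mub ln b), ae_restrict_mem hS] with x hx hxS
        have hxc : 2 * r ≤ ‖x - c‖ := by
          rw [mem_compl_iff, Metric.mem_closedBall, not_le, dist_eq_norm] at hxS; exact hxS.le
        unfold kerI
        rw [← integral_sub (hI x hx y hy) (hI x hx c hc)]
        refine (enorm_integral_le_lintegral_enorm _).trans (lintegral_mono_ae ((ae_kap b).mono fun τ hτ => ?_))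
        have hQ : 4 * r ^ 2 ≤ Qf ln c x τ := by
          rw [Qf_comm]
          refine le_trans ?_ (norm_sq_le_Qf ln hτ (le_of_lt hx) (le_of_lt hc))
          nlinarith
        rw [indicator_of_mem (show (x, τ) ∈ {w : Eu n × ℝ | 4 * r ^ 2 ≤ Qf ln c w.1 w.2} from hQ),
          ← ENNReal.ofReal_mul (by positivity), ← ofReal_norm, Real.norm_eq_abs]
        refine ENNReal.ofReal_le_ofReal ?_
        simp only
        rw [Qf_comm ln c]
        exact hΦ x hx y hy c hc τ hτ r hr0 hr hxc
    _ ≤ ∫⁻ x, ∫⁻ τ, ({w | 4 * r ^ 2 ≤ Qf ln c w.1 w.2}).indicator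
          (fun w => ENNReal.ofReal (lipC s * r) * ENNReal.ofReal (Qf ln c w.1 w.2 ^ (-(s + 3 / 2)))) (x, τ)
          ∂(kap b) ∂(mub n ln b) := setLIntegral_le_lintegral _ _
    _ = ENNReal.ofReal (lipC s * r) * ∫⁻ w in {w | 4 * r ^ 2 ≤ Qf ln c w.1 w.2},
          ENNReal.ofReal (Qf ln c w.1 w.2 ^ (-(s + 3 / 2))) ∂(rhob n ln b) := by
        have hm : Measurable fun w : Eu n × ℝ =>
          ENNReal.ofReal (lipC s * r) * ENNReal.ofReal (Qf ln c w.1 w.2 ^ (-(s + 3 / 2))) := by fun_prop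
        have hT : MeasurableSet {w : Eu n × ℝ | 4 * r ^ 2 ≤ Qf ln c w.1 w.2} :=
          measurableSet_le measurable_const hQm
        rw [← lintegral_prod _ (hm.indicator hT).aemeasurable, lintegral_indicator hT,
          lintegral_const_mul _ (by fun_prop)]
    _ ≤ ENNReal.ofReal (lipC s * r) * ENNReal.ofReal (C * ((s + 3 / 2) / (s + 3 / 2 - (s + 1))) *
          (4 * r ^ 2) ^ (s + 1 - (s + 3 / 2))) := by
        gcongr
        exact lintegral_far hQm (ae_Qf_nonneg c) hC0.le (hC c hc) (by linarith) (by linarith) (by positivity)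
    _ = _ := by
        rw [← ENNReal.ofReal_mul (by positivity)]
        congr 1
        rw [show s + 1 - (s + 3 / 2) = -(1 / 2) by ring, Real.rpow_neg (by positivity), ← Real.sqrt_eq_rpow,
          show 4 * r ^ 2 = (2 * r) ^ 2 by ring, Real.sqrt_sq (by positivity)]
        field_simp

lemma Adm.integrable_kap (hb : 0 < b) (hε : 0 < ε) (hm : 0 ≤ m) {Φ : Eu n → Eu n → ℝ → ℝ} (h : Adm ln ε m Φ)
    (x y : Eu n) : Integrable (fun τ => Φ x y τ) (kap b) := by
  have := isFiniteMeasure_kap hb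
  obtain ⟨M, hM0, hM⟩ := h.bounded hε hm
  refine Integrable.of_bound (h.meas.comp (by fun_prop : Measurable fun τ : ℝ => (x, y, τ))).aestronglyMeasurable M
    ((ae_kap b).mono fun τ hτ => hM x y τ hτ)

lemma abs_g2_sub_far (hε : 0 < ε) (hs : 0 < s) (i j : Fin n) {x y c : Eu n} (hx : x ∈ Hs ln)
    (hc : c ∈ Hs ln) {τ r : ℝ} (hτ : τ ∈ Ioo (0:ℝ) 1) (hr0 : 0 < r) (hr : ‖y - c‖ ≤ r) (hxc : 2 * r ≤ ‖x - c‖) :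
    |g2 ln ε s i j x y τ - g2 ln ε s i j x c τ| ≤ lipC s * r * Qf ln x c τ ^ (-(s + 3 / 2)) ∧
    |g2 ln ε s i j y x τ - g2 ln ε s i j c x τ| ≤ lipC s * r * Qf ln x c τ ^ (-(s + 3 / 2)) := by
  have hQ := norm_sq_le_Qf ln hτ (le_of_lt hx) (le_of_lt hc)
  have hQ0 : 0 < Qf ln x c τ := by nlinarith
  have h1 : 2 * r ≤ √(Qf ln x c τ + ε) := Real.le_sqrt_of_sq_le (by nlinarith)
  have h2 := sqrt_Qf_le hε.le (ln := ln) x y c hτ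
  have h3 := sqrt_Qf_le hε.le (ln := ln) x c y hτ
  rw [norm_sub_rev] at h3
  have hδ : |√(Qf ln x y τ + ε) - √(Qf ln x c τ + ε)| ≤ r := by rw [abs_le]; constructor <;> linarith
  have hR : √(Qf ln x c τ + ε) / 2 ≤ √(Qf ln x y τ + ε) := by linarith
  have hle : lipC s * r * pw ln ε (s + 3 / 2) x c τ ≤ lipC s * r * Qf ln x c τ ^ (-(s + 3 / 2)) :=
    mul_le_mul_of_nonneg_left (pw_le_Qf hε.le (by linarith) hQ0) (mul_nonneg (lipC_nonneg hs) hr0.le)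
  constructor
  · exact (abs_g2_sub_le hε hs i j hτ hR hδ ((abs_Xf_sub_right i x y c hτ).trans hr)
      ((abs_Xf_sub_right j x y c hτ).trans hr)).trans hle
  · rw [Qf_comm ln x c, Qf_comm ln x y] at hR hδ
    refine (abs_g2_sub_le hε hs i j hτ hR hδ ((abs_Xf_sub_left i x y c τ).trans hr)
      ((abs_Xf_sub_left j x y c τ).trans hr)).trans ?_
    rw [pw, Qf_comm ln c x]
    exact hle

lemma measurable_uncurry_flip {k : Eu n → Eu n → ℝ} (h : Measurable (Function.uncurry k)) :
    Measurable (Function.uncurry fun x y => k y x) :=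
  h.comp measurable_swap

/-- Uniform `L^p` bounds for all second derivatives except the double normal one. -/
lemma g2_Lp (ln : Fin n) (hb : 1 < b) (hs0 : 0 < s) (hs : 2 * (s + 1) = (n : ℝ) + b) (hp : 1 < p) :
    ∃ A : ℝ≥0∞, A ≠ ⊤ ∧ ∀ ε, 0 < ε → ∀ i j, (i ≠ ln ∨ j ≠ ln) → ∀ f, BBS f →
    ∫⁻ x, ‖Ik n ln b (g2 ln ε s i j) f x‖ₑ ^ p ∂(mub n ln b) ≤ A * ∫⁻ x, ‖f x‖ₑ ^ p ∂(mub n ln b) := by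
  have hb0 : 0 < b := by linarith
  obtain ⟨A1, hA1, h1⟩ := hor_of_bound ln hb0 hs0 hs
  obtain ⟨A2, hA2, h2⟩ := gP_Lp ln hb0 hs0 hs
  have hA : A1 + A2 ^ (2:ℝ) ≠ ⊤ := by finiteness
  obtain ⟨C, hC, h3⟩ := cz_Lp ln hb0 hp hA
  refine ⟨C, hC, fun ε hε i j hij f hf => ?_⟩
  have hadm := adm_g2 (ln := ln) hε hs0.le i j
  have hm : 0 ≤ s + 1 := by linarith
  have hl2 : ∀ g : Eu n → ℝ, BBS g → ∫⁻ x, ‖opk n ln b (kerI b (g2 ln ε s i j)) g x‖ₑ ^ (2:ℝ) ∂(mub n ln b) ≤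
      A2 ^ (2:ℝ) * ∫⁻ x, ‖g x‖ₑ ^ (2:ℝ) ∂(mub n ln b) := fun g hg => by
    simp only [hadm.opk_kerI hb0 hε hm hg]
    exact (energy_lintegral hb hε hs0 hs hg hij).trans (h2 ε hε 2 (by norm_num) g hg)
  obtain ⟨M, hM⟩ := hadm.kerI_bdd hb0 hε hm
  have hmeas := hadm.measurable_kerI (b := b)
  have hmeas' : Measurable (Function.uncurry fun x y => kerI b (g2 ln ε s i j) y x) :=
    measurable_uncurry_flip hmeas
  have k1 : CZKer n ln b (kerI b (g2 ln ε s i j)) (A1 + A2 ^ (2:ℝ)) :=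
    { meas := hmeas
      bdd := ⟨M, fun x _ y _ => hM x y⟩
      l2 := fun g hg => (hl2 g hg).trans (mul_le_mul_left le_add_self _)
      hor := fun y hy c hc r hr => (h1 _ (fun x _ y _ => hadm.integrable_kap hb0 hε hm x y)
        (fun x hx y hy c hc τ hτ r hr0 hr hxc => (abs_g2_sub_far hε hs0 i j hx hc hτ hr0 hr hxc).1) y hy c hc r hr).trans
          le_self_add }
  have k2 : CZKer n ln b (fun x y => kerI b (g2 ln ε s i j) y x) (A1 + A2 ^ (2:ℝ)) :=
    { meas := hmeas'
      bdd := ⟨M, fun x _ y _ => hM y x⟩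
      l2 := fun g hg => by
        have h := cz_Lp_dual ln hb0 (p := 2) (q := 2) Real.HolderConjugate.two_two hmeas'
          ⟨M, fun x _ y _ => hM y x⟩ hl2 hg
        rw [show (2:ℝ) - 1 = 1 by norm_num, ENNReal.rpow_one] at h
        exact h.trans (mul_le_mul_left le_add_self _)
      hor := fun y hy c hc r hr => (h1 (fun x y => g2 ln ε s i j y x)
        (fun x _ y _ => hadm.integrable_kap hb0 hε hm y x)
        (fun x hx y hy c hc τ hτ r hr0 hr hxc => (abs_g2_sub_far hε hs0 i j hx hc hτ hr0 hr hxc).2) y hy c hc r hr).trans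
          le_self_add }
  have := h3 _ k1 k2 f hf
  simpa only [hadm.opk_kerI hb0 hε hm hf] using this

end

section

variable {n : ℕ} {ln : Fin n} {b ε m s p : ℝ} {f : Eu n → ℝ}

/-! ### The Hardy inequality in the normal direction -/

lemma hasFDerivAt_Ik_pw (hb : 0 < b) (hε : 0 < ε) (hs : 0 ≤ s) (hf : BBS f) (x : Eu n) :
    HasFDerivAt (Ik n ln b (pw ln ε s) f) (gradCLM fun k => Ik n ln b (g1 ln ε s k) f x) x :=
  Ik_hasFDerivAt hb hε hs (adm_pw hε s) (fun k => (adm_g1 hε hs k).mono hε (by linarith))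
    (fun _ _ _ hτ => hasFDerivAt_pw hε hτ) hf x

lemma hasFDerivAt_Ik_g1 (hb : 0 < b) (hε : 0 < ε) (hs : 0 ≤ s) (hf : BBS f) (i : Fin n) (x : Eu n) :
    HasFDerivAt (Ik n ln b (g1 ln ε s i) f) (gradCLM fun k => Ik n ln b (g2 ln ε s i k) f x) x :=
  Ik_hasFDerivAt hb hε (by linarith) (adm_g1 hε hs i)
    (fun k => (adm_g2 hε hs i k).mono hε (by linarith : s + 1 / 2 ≤ s + 1))
    (fun _ _ _ hτ => hasFDerivAt_g1 hε hτ i) hf x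

/-- Multiplication of the normal coordinate by `θ`. -/
def scl (ln : Fin n) (θ : ℝ) (x : Eu n) : Eu n := x + ((θ - 1) * x ln) • EuclideanSpace.single ln 1

lemma scl_apply (θ : ℝ) (x : Eu n) (i : Fin n) : scl ln θ x i = if i = ln then θ * x i else x i := by
  unfold scl
  by_cases h : i = ln
  · subst h; simp; ring
  · simp [h]

lemma scl_one (x : Eu n) : scl ln 1 x = x := by simp [scl]

lemma measurable_scl : Measurable fun q : ℝ × Eu n => scl ln q.1 q.2 := by unfold scl; fun_prop

lemma lintegral_scl {θ : ℝ} (hθ : 0 < θ) {F : Eu n → ℝ≥0∞} (hF : Measurable F) :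
    ∫⁻ x, F (scl ln θ x) = ENNReal.ofReal θ⁻¹ * ∫⁻ x, F x := by
  set D : Fin n → ℝ := fun i => if i = ln then θ else 1 with hD
  have hdet : (Matrix.diagonal D).det = θ := by
    rw [Matrix.det_diagonal, Finset.prod_ite_eq' Finset.univ ln (fun _ => θ)]; simp
  have e := PiLp.volume_preserving_toLp (Fin n)
  have h1 : ∀ H : Eu n → ℝ≥0∞, Measurable H → ∫⁻ x, H x = ∫⁻ v : Fin n → ℝ, H (WithLp.toLp 2 v) := fun H hH =>
    (e.lintegral_comp hH).symm
  have hsc : ∀ v : Fin n → ℝ, scl ln θ (WithLp.toLp 2 v) = WithLp.toLp 2 (Matrix.toLin' (Matrix.diagonal D) v) := by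
    intro v; ext i
    simp only [scl_apply, Matrix.toLin'_apply, Matrix.mulVec_diagonal, hD]
    split_ifs <;> simp
  have hF1 : Measurable fun x => F (scl ln θ x) :=
    hF.comp (measurable_scl.comp (measurable_const.prodMk measurable_id))
  have hT : Measurable (Matrix.toLin' (Matrix.diagonal D)) :=
    (LinearMap.continuous_of_finiteDimensional _).measurable
  have hF2 : Measurable fun v : Fin n → ℝ => F (WithLp.toLp 2 v) := hF.comp e.measurable
  rw [h1 _ hF1, h1 _ hF]
  simp only [hsc]
  have h2 := Real.smul_map_diagonal_volume_pi (D := D) (by rw [hdet]; exact hθ.ne')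
  rw [hdet, abs_of_pos hθ] at h2
  conv_rhs => rw [← h2]
  rw [lintegral_smul_measure, lintegral_map hF2 hT, smul_eq_mul, ← mul_assoc, ← ENNReal.ofReal_mul (by positivity),
    inv_mul_cancel₀ hθ.ne', ENNReal.ofReal_one, one_mul]

lemma lintegral_mub_scl (hb : 0 < b) {θ : ℝ} (hθ : 0 < θ) {F : Eu n → ℝ≥0∞} (hF : Measurable F) :
    ∫⁻ x, F (scl ln θ x) ∂(mub n ln b) = ENNReal.ofReal (θ ^ (-b - 1)) * ∫⁻ x, F x ∂(mub n ln b) := by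
  have hF1 : Measurable fun x => F (scl ln θ x) :=
    hF.comp (measurable_scl.comp (measurable_const.prodMk measurable_id))
  have hw : Measurable fun x : Eu n => ENNReal.ofReal (wt ln b x) * F x :=
    ((measurable_max_rpow b).ennreal_ofReal).mul hF
  have hw1 : Measurable fun x : Eu n => ENNReal.ofReal (wt ln b (scl ln θ x)) * F (scl ln θ x) :=
    hw.comp (measurable_scl.comp (measurable_const.prodMk measurable_id))
  have hwt : ∀ x : Eu n, wt ln b (scl ln θ x) = θ ^ b * wt ln b x := fun x => by
    unfold wt
    rw [scl_apply, if_pos rfl, ← Real.mul_rpow hθ.le (le_max_right _ _), mul_max_of_nonneg _ _ hθ.le, mul_zero]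
  rw [lintegral_mub' hb hF1, lintegral_mub' hb hF]
  have h := lintegral_scl (ln := ln) hθ hw
  simp only [hwt] at h hw1
  calc _ = ∫⁻ x, ENNReal.ofReal (θ ^ (-b)) * (ENNReal.ofReal (θ ^ b * wt ln b x) * F (scl ln θ x)) := by
        refine lintegral_congr fun x => ?_
        rw [← mul_assoc, ← ENNReal.ofReal_mul (by positivity), ← mul_assoc, ← Real.rpow_add hθ, neg_add_cancel,
          Real.rpow_zero, one_mul]
    _ = _ := by
        rw [lintegral_const_mul _ hw1, h, ← mul_assoc, ← ENNReal.ofReal_mul (by positivity), ← Real.rpow_neg_one,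
          ← Real.rpow_add hθ]
        rfl

/-- The combination controlled by the equation. -/
def Bn (n : ℕ) (ln : Fin n) (b ε s : ℝ) (f : Eu n → ℝ) (x : Eu n) : ℝ :=
  Ik n ln b (gP ln b ε s) f x - ∑ j ∈ Finset.univ.erase ln, Ik n ln b (g2 ln ε s j j) f x

lemma measurable_Bn (hε : 0 < ε) (hs : 0 ≤ s) (hf : BBS f) : Measurable (Bn n ln b ε s f) :=
  ((adm_gP hε).measurable_Ik hf.meas).sub
    (Finset.measurable_fun_sum _ fun j _ => (adm_g2 hε hs j j).measurable_Ik hf.meas)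

lemma Bn_eq (hb : 0 < b) (hε : 0 < ε) (hs0 : 0 ≤ s) (hs : 2 * (s + 1) = (n : ℝ) + b) (hf : BBS f) {x : Eu n}
    (hx : x ∈ Hs ln) : Bn n ln b ε s f x =
      Ik n ln b (g2 ln ε s ln ln) f x + b / x ln * Ik n ln b (g1 ln ε s ln) f x := by
  rw [Bn, ← pde hb hε hs0 hs hf hx, ← Finset.add_sum_erase _ _ (Finset.mem_univ ln)]; ring

lemma Adm.Ik_bdd (hb : 0 < b) (hε : 0 < ε) (hm : 0 ≤ m) {Φ : Eu n → Eu n → ℝ → ℝ} (h : Adm ln ε m Φ)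
    (hf : BBS f) : ∃ M, ∀ x, |Ik n ln b Φ f x| ≤ M := by
  obtain ⟨M, hM0, hM⟩ := h.bounded hε hm
  have hi : Integrable (fun w : Eu n × ℝ => f w.1) (rhob n ln b) := hf.integrable_rhob hb
  refine ⟨∫ w, M * |f w.1| ∂(rhob n ln b), fun x => ?_⟩
  refine norm_integral_le_of_norm_le (f := fun w : Eu n × ℝ => Φ x w.1 w.2 * f w.1) (hi.abs.const_mul M) ((ae_rhob ln b).mono fun w hw => ?_)
  rw [norm_mul]
  exact mul_le_mul_of_nonneg_right (hM _ _ _ hw.2) (norm_nonneg _)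

lemma Bn_bdd (hb : 0 < b) (hε : 0 < ε) (hs : 0 ≤ s) (hf : BBS f) : ∃ M, ∀ x, |Bn n ln b ε s f x| ≤ M := by
  obtain ⟨M, hM⟩ := (adm_gP (b := b) (ln := ln) (s := s) hε).Ik_bdd hb hε (by linarith) hf
  choose K hK using fun j => (adm_g2 (ln := ln) hε hs j j).Ik_bdd hb hε (by linarith) hf
  refine ⟨M + ∑ j ∈ Finset.univ.erase ln, K j, fun x => (abs_sub _ _).trans (add_le_add (hM x) ?_)⟩
  exact (Finset.abs_sum_le_sum_abs _ _).trans (Finset.sum_le_sum fun j _ => hK j x)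

lemma normal_deriv_eq (hb : 0 < b) (hε : 0 < ε) (hs0 : 0 ≤ s) (hs : 2 * (s + 1) = (n : ℝ) + b) (hf : BBS f)
    {x : Eu n} (hx : x ∈ Hs ln) : Ik n ln b (g1 ln ε s ln) f x / x ln =
      ∫ θ in Ioc (0:ℝ) 1, θ ^ b * Bn n ln b ε s f (scl ln θ x) := by
  have hx0 : 0 < x ln := hx
  set G := Ik n ln b (g1 ln ε s ln) f with hG
  have hd : ∀ θ : ℝ, HasDerivAt (fun θ : ℝ => G (scl ln θ x)) (x ln * Ik n ln b (g2 ln ε s ln ln) f (scl ln θ x)) θ := by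
    intro θ
    have h1 := hasFDerivAt_Ik_g1 (ln := ln) hb hε hs0 hf ln (scl ln θ x)
    have h2 : HasDerivAt (fun θ : ℝ => scl ln θ x) ((x ln) • EuclideanSpace.single ln (1:ℝ)) θ := by
      have h3 : HasDerivAt (fun θ : ℝ => (θ - 1) * x ln) (x ln) θ := by
        simpa using ((hasDerivAt_id θ).sub_const 1).mul_const (x ln)
      exact (h3.smul_const _).const_add x
    have h4 := h1.comp_hasDerivAt θ h2
    rw [map_smul, gradCLM_single, smul_eq_mul] at h4
    exact h4
  have hcont : Continuous fun θ : ℝ => G (scl ln θ x) := continuous_iff_continuousAt.2 fun θ => (hd θ).continuousAt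
  obtain ⟨M, hM⟩ := Bn_bdd (n := n) (ln := ln) (s := s) hb hε hs0 hf
  have h_int : IntervalIntegrable (fun θ : ℝ => x ln * (θ ^ b * Bn n ln b ε s f (scl ln θ x))) volume 0 1 := by
    rw [intervalIntegrable_iff_integrableOn_Ioc_of_le zero_le_one]
    have hmeas : Measurable fun θ : ℝ => x ln * (θ ^ b * Bn n ln b ε s f (scl ln θ x)) := by
      have : Measurable fun θ : ℝ => Bn n ln b ε s f (scl ln θ x) :=
        (measurable_Bn hε hs0 hf).comp (measurable_scl.comp (measurable_id.prodMk measurable_const))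
      fun_prop
    refine Integrable.of_bound hmeas.aestronglyMeasurable (x ln * (1 * M)) ?_
    filter_upwards [ae_restrict_mem measurableSet_Ioc] with θ hθ
    rw [norm_mul, norm_mul, Real.norm_of_nonneg hx0.le, Real.norm_of_nonneg (Real.rpow_nonneg hθ.1.le b)]
    refine mul_le_mul_of_nonneg_left ?_ hx0.le
    exact mul_le_mul (Real.rpow_le_one hθ.1.le hθ.2 hb.le) (hM _) (norm_nonneg _) zero_le_one
  have h := intervalIntegral.integral_eq_sub_of_hasDerivAt_of_le (f := fun θ : ℝ => θ ^ b * G (scl ln θ x))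
    (f' := fun θ : ℝ => x ln * (θ ^ b * Bn n ln b ε s f (scl ln θ x))) zero_le_one
    (((Real.continuous_rpow_const hb.le).mul hcont).continuousOn) (fun θ hθ => by
      have hθ0 : 0 < θ := hθ.1
      have h1 := (Real.hasDerivAt_rpow_const (p := b) (Or.inl hθ0.ne')).mul (hd θ)
      have hS : scl ln θ x ∈ Hs ln := by
        show 0 < scl ln θ x ln
        rw [scl_apply, if_pos rfl]; positivity
      refine h1.congr_deriv ?_
      rw [Bn_eq hb hε hs0 hs hf hS, scl_apply, if_pos rfl, Real.rpow_sub_one hθ0.ne']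
      field_simp
      ring) h_int
  rw [intervalIntegral.integral_const_mul, intervalIntegral.integral_of_le zero_le_one, Real.zero_rpow hb.ne', zero_mul,
    sub_zero, Real.one_rpow, one_mul, scl_one] at h
  rw [← h]; field_simp

lemma lintegral_rpow_le_of_measure_le_one {Ω : Type*} [MeasurableSpace Ω] {ν : Measure Ω} (hν : ν univ ≤ 1)
    (hp : 1 < p) {F : Ω → ℝ≥0∞} (hF : AEMeasurable F ν) : (∫⁻ t, F t ∂ν) ^ p ≤ ∫⁻ t, F t ^ p ∂ν := by
  have hpq := Real.HolderConjugate.conjExponent hp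
  have h := ENNReal.lintegral_mul_le_Lp_mul_Lq ν hpq hF aemeasurable_one (g := 1)
  simp only [mul_one, Pi.one_apply, ENNReal.one_rpow, lintegral_one] at h
  have h1 : ν univ ^ (1 / p.conjExponent) ≤ 1 := ENNReal.rpow_le_one hν (by have := hpq.symm.pos; positivity)
  have h2 : ∫⁻ t, F t ∂ν ≤ (∫⁻ t, F t ^ p ∂ν) ^ (1 / p) := h.trans (mul_le_of_le_one_right' h1)
  calc _ ≤ ((∫⁻ t, F t ^ p ∂ν) ^ (1 / p)) ^ p := ENNReal.rpow_le_rpow h2 (by linarith)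
    _ = _ := by rw [← ENNReal.rpow_mul, one_div_mul_cancel (by linarith), ENNReal.rpow_one]

lemma hardy (hb : 0 < b) (hε : 0 < ε) (hs0 : 0 ≤ s) (hs : 2 * (s + 1) = (n : ℝ) + b) (hp : 1 < p) (hf : BBS f) :
    ∫⁻ x, ‖Ik n ln b (g1 ln ε s ln) f x / x ln‖ₑ ^ p ∂(mub n ln b) ≤
      ENNReal.ofReal (1 / (b * (p - 1))) * ∫⁻ x, ‖Bn n ln b ε s f x‖ₑ ^ p ∂(mub n ln b) := by
  have hp0 : 0 < p := by linarith
  have hB := measurable_Bn (n := n) (ln := ln) (b := b) hε hs0 hf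
  have hBS : Measurable fun q : Eu n × ℝ => Bn n ln b ε s f (scl ln q.2 q.1) :=
    hB.comp (measurable_scl.comp measurable_swap)
  have hF : Measurable fun q : Eu n × ℝ => ENNReal.ofReal (q.2 ^ (b * p)) * ‖Bn n ln b ε s f (scl ln q.2 q.1)‖ₑ ^ p := by
    fun_prop
  calc ∫⁻ x, ‖Ik n ln b (g1 ln ε s ln) f x / x ln‖ₑ ^ p ∂(mub n ln b)
      ≤ ∫⁻ x, (∫⁻ θ in Ioc (0:ℝ) 1, ENNReal.ofReal (θ ^ (b * p)) * ‖Bn n ln b ε s f (scl ln θ x)‖ₑ ^ p)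
          ∂(mub n ln b) := by
        refine lintegral_mono_ae ((ae_mub ln b).mono fun x hx => ?_)
        rw [normal_deriv_eq hb hε hs0 hs hf hx]
        have hm1 : Measurable fun θ : ℝ => θ ^ b * Bn n ln b ε s f (scl ln θ x) := by
          have : Measurable fun θ : ℝ => Bn n ln b ε s f (scl ln θ x) :=
            hB.comp (measurable_scl.comp (measurable_id.prodMk measurable_const))
          fun_prop
        refine (ENNReal.rpow_le_rpow (enorm_integral_le_lintegral_enorm _) hp0.le).trans ?_
        refine (lintegral_rpow_le_of_measure_le_one (by simp) hp hm1.enorm.aemeasurable).trans_eq ?_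
        refine setLIntegral_congr_fun measurableSet_Ioc fun θ hθ => ?_
        rw [enorm_mul, ENNReal.mul_rpow_of_nonneg _ _ hp0.le, Real.enorm_of_nonneg (Real.rpow_nonneg hθ.1.le b),
          ENNReal.ofReal_rpow_of_nonneg (Real.rpow_nonneg hθ.1.le b) hp0.le, ← Real.rpow_mul hθ.1.le]
    _ = ∫⁻ θ in Ioc (0:ℝ) 1, ∫⁻ x, ENNReal.ofReal (θ ^ (b * p)) * ‖Bn n ln b ε s f (scl ln θ x)‖ₑ ^ p ∂(mub n ln b) :=
        lintegral_lintegral_swap hF.aemeasurable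
    _ = ∫⁻ θ in Ioc (0:ℝ) 1, ENNReal.ofReal (θ ^ (b * p - b - 1)) * ∫⁻ x, ‖Bn n ln b ε s f x‖ₑ ^ p ∂(mub n ln b) := by
        refine setLIntegral_congr_fun measurableSet_Ioc fun θ hθ => ?_
        have hm2 : Measurable fun x : Eu n => ‖Bn n ln b ε s f (scl ln θ x)‖ₑ ^ p := by
          have : Measurable fun x : Eu n => Bn n ln b ε s f (scl ln θ x) :=
            hB.comp (measurable_scl.comp (measurable_const.prodMk measurable_id))
          fun_prop
        rw [lintegral_const_mul _ hm2, lintegral_mub_scl hb hθ.1 (F := fun x => ‖Bn n ln b ε s f x‖ₑ ^ p)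
          (hB.enorm.pow_const p), ← mul_assoc, ← ENNReal.ofReal_mul (Real.rpow_nonneg hθ.1.le _), ← Real.rpow_add hθ.1]
        congr 3; ring
    _ = _ := by
        have h1 : 0 < b * (p - 1) := mul_pos hb (by linarith)
        rw [lintegral_mul_const _ (by fun_prop), setLIntegral_congr Ioo_ae_eq_Ioc.symm,
          lintegral_rpow_Ioo (by linarith) zero_le_one, Real.one_rpow]
        congr 3; ring

end

section

variable {n : ℕ} {ln : Fin n} {b ε m s p : ℝ} {f : Eu n → ℝ}

/-! ### Uniform bounds for the regularised potentials -/

lemma eLpNorm_ofReal_eq {Ω E : Type*} [MeasurableSpace Ω] [NormedAddCommGroup E] (hp : 0 < p) (g : Ω → E)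
    (μ : Measure Ω) : eLpNorm g (ENNReal.ofReal p) μ = (∫⁻ x, ‖g x‖ₑ ^ p ∂μ) ^ (1 / p) := by
  rw [eLpNorm_eq_lintegral_rpow_enorm_toReal (by simpa using hp) ENNReal.ofReal_ne_top, ENNReal.toReal_ofReal hp.le]

lemma eLpNorm_le_of_lintegral_le {Ω E E' : Type*} [MeasurableSpace Ω] [NormedAddCommGroup E] [NormedAddCommGroup E']
    (hp : 0 < p) {g : Ω → E} {f : Ω → E'} {μ : Measure Ω} {A : ℝ≥0∞}
    (h : ∫⁻ x, ‖g x‖ₑ ^ p ∂μ ≤ A * ∫⁻ x, ‖f x‖ₑ ^ p ∂μ) :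
    eLpNorm g (ENNReal.ofReal p) μ ≤ A ^ (1 / p) * eLpNorm f (ENNReal.ofReal p) μ := by
  rw [eLpNorm_ofReal_eq hp, eLpNorm_ofReal_eq hp, ← ENNReal.mul_rpow_of_nonneg _ _ (by positivity)]
  exact ENNReal.rpow_le_rpow h (by positivity)

/-- Uniform bound for operators dominated by a potential. -/
lemma Ik_Lp_of_le (ln : Fin n) (hb : 0 < b) (hs : 2 * (s + 1) = (n : ℝ) + b) (hm : 0 < m) (hms : m < s + 1)
    (hp : 1 < p) (hmp : (n : ℝ) + b < 2 * m * p) (c : ℝ) : ∃ A : ℝ≥0∞, A ≠ ⊤ ∧ ∀ Φ : Eu n → Eu n → ℝ → ℝ,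
    (∀ x ∈ Hs ln, ∀ y ∈ Hs ln, ∀ τ ∈ Ioo (0:ℝ) 1, |Φ x y τ| ≤ c * Qf ln x y τ ^ (-m)) →
    ∀ f : Eu n → ℝ, Measurable f → (∀ y, f y ≠ 0 → ‖y‖ ≤ 1) →
      eLpNorm (Ik n ln b Φ f) (ENNReal.ofReal p) (mub n ln b) ≤ A * eLpNorm f (ENNReal.ofReal p) (mub n ln b) := by
  obtain ⟨A, hA, h⟩ := pot_Lp ln hb hs hm hms hp hmp
  have hp0 : 0 < p := by linarith
  have hcp : ENNReal.ofReal c ^ p ≠ ⊤ := ENNReal.rpow_ne_top_of_nonneg hp0.le ENNReal.ofReal_ne_top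
  refine ⟨(ENNReal.ofReal c ^ p * A) ^ (1 / p), ENNReal.rpow_ne_top_of_nonneg (by positivity)
    (ENNReal.mul_ne_top hcp hA), fun Φ hΦ f hf hf1 => eLpNorm_le_of_lintegral_le hp0 ?_⟩
  calc _ ≤ ∫⁻ x, ENNReal.ofReal c ^ p * (∫⁻ w, ENNReal.ofReal (Qf ln x w.1 w.2 ^ (-m)) * ‖f w.1‖ₑ
          ∂(rhob n ln b)) ^ p ∂(mub n ln b) := by
        refine lintegral_mono_ae ((ae_mub ln b).mono fun x hx => ?_)
        have hQ := measurable_Qf_right (ln := ln) x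
        rw [← ENNReal.mul_rpow_of_nonneg _ _ hp0.le]
        refine ENNReal.rpow_le_rpow ?_ hp0.le
        rw [← lintegral_const_mul _ (by fun_prop)]
        refine (enorm_Ik_le _ _ _).trans (lintegral_mono_ae ((ae_rhob ln b).mono fun w hw => ?_))
        have hq := (Qf_pos hx hw.1 hw.2).le
        have h0 := hΦ x hx _ hw.1 _ hw.2
        rw [← mul_assoc, ← ENNReal.ofReal_mul' (by positivity), ← ofReal_norm, Real.norm_eq_abs]
        exact mul_le_mul_left (ENNReal.ofReal_le_ofReal h0) _
    _ ≤ _ := by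
        rw [lintegral_const_mul' _ _ hcp, mul_assoc]
        gcongr
        exact h f hf hf1

lemma abs_g1_le_Qf (hε : 0 ≤ ε) (hs : 0 ≤ s) {x y : Eu n} {τ : ℝ} (hx : x ∈ Hs ln) (hy : y ∈ Hs ln)
    (hτ : τ ∈ Ioo (0:ℝ) 1) (i : Fin n) : |g1 ln ε s i x y τ| ≤ 2 * s * Qf ln x y τ ^ (-(s + 1 / 2)) := by
  have hQ := Qf_pos hx hy hτ
  have h1 := abs_Xf_le (ln := ln) (x := x) (y := y) le_rfl hτ i
  have h2 := pw_le_Qf hε (by linarith : 0 ≤ s + 1) hQ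
  have h3 := pw_nonneg (ln := ln) (s := s + 1) (x := x) (y := y) hε hτ
  rw [add_zero] at h1
  unfold g1
  rw [abs_mul, abs_mul (pw _ _ _ _ _ _), abs_of_nonneg h3, show |-2 * s| = 2 * s by
    rw [neg_mul, abs_neg, abs_of_nonneg (by positivity)]]
  refine mul_le_mul_of_nonneg_left ?_ (by positivity)
  calc _ ≤ Qf ln x y τ ^ (-(s + 1)) * Qf ln x y τ ^ (1 / 2 : ℝ) := by gcongr
    _ = _ := by rw [← Real.rpow_add hQ]; congr 1; ring

lemma measurable_Ik_g2 (hε : 0 < ε) (hs : 0 ≤ s) (hf : BBS f) (i j : Fin n) :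
    Measurable (Ik n ln b (g2 ln ε s i j) f) := (adm_g2 hε hs i j).measurable_Ik hf.meas

lemma measurable_Ik_g1 (hε : 0 < ε) (hs : 0 ≤ s) (hf : BBS f) (i : Fin n) :
    Measurable (Ik n ln b (g1 ln ε s i) f) := (adm_g1 hε hs i).measurable_Ik hf.meas

lemma uniform_bounds (ln : Fin n) (hb : 1 < b) (hs0 : 0 < s) (hs : 2 * (s + 1) = (n : ℝ) + b) (hp : 1 < p)
    (hsp : (n : ℝ) + b < 2 * s * p) : ∃ A : ℝ≥0∞, A ≠ ⊤ ∧ ∀ ε, 0 < ε → ∀ f : Eu n → ℝ, BBS f →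
    (∀ y, f y ≠ 0 → ‖y‖ ≤ 1) →
      eLpNorm (Ik n ln b (pw ln ε s) f) (ENNReal.ofReal p) (mub n ln b) ≤
        A * eLpNorm f (ENNReal.ofReal p) (mub n ln b) ∧
      (∀ i, eLpNorm (Ik n ln b (g1 ln ε s i) f) (ENNReal.ofReal p) (mub n ln b) ≤
        A * eLpNorm f (ENNReal.ofReal p) (mub n ln b)) ∧
      (∀ i j, eLpNorm (Ik n ln b (g2 ln ε s i j) f) (ENNReal.ofReal p) (mub n ln b) ≤
        A * eLpNorm f (ENNReal.ofReal p) (mub n ln b)) ∧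
      eLpNorm (fun x => Ik n ln b (g1 ln ε s ln) f x / x ln) (ENNReal.ofReal p) (mub n ln b) ≤
        A * eLpNorm f (ENNReal.ofReal p) (mub n ln b) := by
  have hb0 : 0 < b := by linarith
  have hp0 : 0 < p := by linarith
  obtain ⟨A0, hA0, h0⟩ := Ik_Lp_of_le ln hb0 hs hs0 (by linarith) hp hsp 1
  obtain ⟨A1, hA1, h1⟩ := Ik_Lp_of_le ln hb0 hs (m := s + 1 / 2) (by linarith) (by linarith) hp
    (hsp.trans (by nlinarith)) (2 * s)
  obtain ⟨A2, hA2, h2⟩ := gP_Lp ln hb0 hs0 hs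
  obtain ⟨A3', hA3', h3'⟩ := g2_Lp ln hb hs0 hs hp
  set A3 := A3' ^ (1 / p)
  have hA3 : A3 ≠ ⊤ := ENNReal.rpow_ne_top_of_nonneg (by positivity) hA3'
  set A4 := A2 + n * A3
  have hA4 : A4 ≠ ⊤ := by
    have h : (n : ℝ≥0∞) ≠ ⊤ := ENNReal.natCast_ne_top n
    finiteness
  set A5 := ENNReal.ofReal (1 / (b * (p - 1))) ^ (1 / p) * A4
  have hA5 : A5 ≠ ⊤ := ENNReal.mul_ne_top
    (ENNReal.rpow_ne_top_of_nonneg (by positivity) ENNReal.ofReal_ne_top) hA4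
  set A6 := A4 + ENNReal.ofReal b * A5
  have hA6 : A6 ≠ ⊤ := ENNReal.add_ne_top.2 ⟨hA4, ENNReal.mul_ne_top ENNReal.ofReal_ne_top hA5⟩
  refine ⟨A0 + A1 + A3 + A5 + A6, by simp only [ENNReal.add_ne_top, ne_eq]; exact ⟨⟨⟨⟨hA0, hA1⟩, hA3⟩, hA5⟩, hA6⟩,
    fun ε hε f hf hf1 => ?_⟩
  set N := eLpNorm f (ENNReal.ofReal p) (mub n ln b)
  have hp1 : 1 ≤ ENNReal.ofReal p := by rw [← ENNReal.ofReal_one]; exact ENNReal.ofReal_le_ofReal hp.le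
  have b0 := h0 (pw ln ε s) (fun x hx y hy τ hτ => by
    rw [one_mul, abs_of_nonneg (pw_nonneg hε.le hτ)]
    exact pw_le_Qf hε.le hs0.le (Qf_pos hx hy hτ)) f hf.meas hf1
  have b1 := fun i => h1 (g1 ln ε s i) (fun x hx y hy τ hτ => abs_g1_le_Qf hε.le hs0.le hx hy hτ i) f hf.meas hf1
  have b2 : eLpNorm (Ik n ln b (gP ln b ε s) f) (ENNReal.ofReal p) (mub n ln b) ≤ A2 * N := by
    have := eLpNorm_le_of_lintegral_le hp0 (h2 ε hε p hp f hf)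
    rwa [← ENNReal.rpow_mul, mul_one_div_cancel hp0.ne', ENNReal.rpow_one] at this
  have b3 : ∀ i j, (i ≠ ln ∨ j ≠ ln) →
      eLpNorm (Ik n ln b (g2 ln ε s i j) f) (ENNReal.ofReal p) (mub n ln b) ≤ A3 * N := fun i j hij =>
    eLpNorm_le_of_lintegral_le hp0 (h3' ε hε i j hij f hf)
  have b4 : eLpNorm (Bn n ln b ε s f) (ENNReal.ofReal p) (mub n ln b) ≤ A4 * N := by
    have hsum : eLpNorm (∑ j ∈ Finset.univ.erase ln, Ik n ln b (g2 ln ε s j j) f) (ENNReal.ofReal p) (mub n ln b) ≤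
        n * (A3 * N) := by
      refine (eLpNorm_sum_le (fun j _ => (measurable_Ik_g2 hε hs0.le hf j j).aestronglyMeasurable) hp1).trans ?_
      refine (Finset.sum_le_sum fun j hj => b3 j j (Or.inl (Finset.ne_of_mem_erase hj))).trans ?_
      rw [Finset.sum_const, nsmul_eq_mul]
      gcongr
      exact (Finset.card_le_univ _).trans_eq (Fintype.card_fin n)
    have hBn : Bn n ln b ε s f = Ik n ln b (gP ln b ε s) f - ∑ j ∈ Finset.univ.erase ln, Ik n ln b (g2 ln ε s j j) f := by
      funext x; simp [Bn, Finset.sum_apply]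
    rw [hBn]
    refine (eLpNorm_sub_le ((adm_gP hε).measurable_Ik hf.meas).aestronglyMeasurable
      (Finset.aestronglyMeasurable_sum _ fun j _ =>
        (measurable_Ik_g2 hε hs0.le hf j j).aestronglyMeasurable) hp1).trans ?_
    calc _ ≤ A2 * N + n * (A3 * N) := add_le_add b2 hsum
      _ = _ := by ring
  have b5 : eLpNorm (fun x => Ik n ln b (g1 ln ε s ln) f x / x ln) (ENNReal.ofReal p) (mub n ln b) ≤ A5 * N := by
    have := eLpNorm_le_of_lintegral_le hp0 (hardy (n := n) (ln := ln) hb0 hε hs0.le hs hp hf)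
    refine this.trans ?_
    rw [mul_assoc]; gcongr
  have b6 : eLpNorm (Ik n ln b (g2 ln ε s ln ln) f) (ENNReal.ofReal p) (mub n ln b) ≤ A6 * N := by
    have hm5 : Measurable fun x : Eu n => Ik n ln b (g1 ln ε s ln) f x / x ln := by
      have := measurable_Ik_g1 (ln := ln) (b := b) hε hs0.le hf ln
      fun_prop
    have hae : Ik n ln b (g2 ln ε s ln ln) f =ᵐ[mub n ln b]
        Bn n ln b ε s f - b • fun x => Ik n ln b (g1 ln ε s ln) f x / x ln := by
      filter_upwards [ae_mub ln b] with x hx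
      rw [Pi.sub_apply, Bn_eq hb0 hε hs0.le hs hf hx, Pi.smul_apply, smul_eq_mul]; ring
    rw [eLpNorm_congr_ae hae]
    refine (eLpNorm_sub_le (measurable_Bn hε hs0.le hf).aestronglyMeasurable
      (hm5.aestronglyMeasurable.const_smul b) hp1).trans ?_
    rw [eLpNorm_const_smul, Real.enorm_of_nonneg hb0.le]
    calc _ ≤ A4 * N + ENNReal.ofReal b * (A5 * N) := by gcongr
      _ = _ := by ring
  refine ⟨b0.trans ?_, fun i => (b1 i).trans ?_, fun i j => ?_, b5.trans ?_⟩
  · gcongr; simp only [add_assoc]; exact le_self_add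
  · gcongr; rw [add_comm A0, add_assoc, add_assoc, add_assoc]; exact le_self_add
  · by_cases hij : i ≠ ln ∨ j ≠ ln
    · refine (b3 i j hij).trans ?_
      gcongr; rw [add_comm (A0 + A1), add_assoc, add_assoc]; exact le_self_add
    · push Not at hij
      rw [hij.1, hij.2]
      refine b6.trans ?_
      gcongr; exact le_add_self
  · gcongr; exact le_add_self.trans le_self_add

/-! ### Difference quotients -/

lemma lintegral_mub_add_le (hb : 0 < b) {F : Eu n → ℝ≥0∞} (hF : Measurable F) (i : Fin n) {a : ℝ} (ha : 0 ≤ a) :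
    ∫⁻ x, F (x + a • EuclideanSpace.single i 1) ∂(mub n ln b) ≤ ∫⁻ x, F x ∂(mub n ln b) := by
  have hF1 : Measurable fun x : Eu n => F (x + a • EuclideanSpace.single i 1) := hF.comp (measurable_id.add_const _)
  rw [lintegral_mub' hb hF1, lintegral_mub' hb hF,
    ← lintegral_add_right_eq_self (fun x => ENNReal.ofReal (wt ln b x) * F x) (a • EuclideanSpace.single i 1)]
  gcongr with x
  unfold wt
  refine Real.rpow_le_rpow (le_max_right _ _) (max_le_max_right _ ?_) hb.le
  rw [PiLp.add_apply, PiLp.smul_apply, smul_eq_mul]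
  have : (0:ℝ) ≤ (EuclideanSpace.single i (1:ℝ) : Eu n) ln := by
    rw [PiLp.single_apply]; split_ifs <;> norm_num
  nlinarith

/-- The `L^p` norm of a difference quotient is controlled by that of the derivative. -/
lemma diffq_Lp (hb : 0 < b) (hp : 1 < p) {v v' : Eu n → ℝ} (i : Fin n) (hv : Measurable v')
    (hbd : ∃ M, ∀ x, |v' x| ≤ M)
    (hd : ∀ x (t : ℝ), HasDerivAt (fun t : ℝ => v (x + t • EuclideanSpace.single i 1))
      (v' (x + t • EuclideanSpace.single i 1)) t) {h : ℝ} (hh : 0 < h) :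
    ∫⁻ x, ‖h⁻¹ * (v (x + h • EuclideanSpace.single i 1) - v x)‖ₑ ^ p ∂(mub n ln b) ≤
      ∫⁻ x, ‖v' x‖ₑ ^ p ∂(mub n ln b) := by
  have hp0 : 0 < p := by linarith
  obtain ⟨M, hM⟩ := hbd
  have hrep : ∀ x, h⁻¹ * (v (x + h • EuclideanSpace.single i 1) - v x) =
      ∫ t in Ioc (0:ℝ) 1, v' (x + (t * h) • EuclideanSpace.single i 1) := by
    intro x
    have hm : Measurable fun t : ℝ => h * v' (x + (t * h) • EuclideanSpace.single i 1) :=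
      (hv.comp (by fun_prop)).const_mul h
    have := intervalIntegral.integral_eq_sub_of_hasDerivAt (a := 0) (b := 1)
      (f := fun t : ℝ => v (x + (t * h) • EuclideanSpace.single i 1))
      (f' := fun t : ℝ => h * v' (x + (t * h) • EuclideanSpace.single i 1)) (fun t _ => by
        have h1 := (hd x (t * h)).comp t ((hasDerivAt_id t).mul_const h)
        rw [one_mul, mul_comm] at h1
        exact h1) (by
        rw [intervalIntegrable_iff_integrableOn_Ioc_of_le zero_le_one]
        refine Integrable.of_bound hm.aestronglyMeasurable (h * M) (Eventually.of_forall fun t => ?_)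
        rw [norm_mul, Real.norm_of_nonneg hh.le]
        exact mul_le_mul_of_nonneg_left (hM _) hh.le)
    rw [intervalIntegral.integral_const_mul, intervalIntegral.integral_of_le zero_le_one, one_mul, zero_mul,
      zero_smul, add_zero] at this
    rw [← this, inv_mul_cancel_left₀ hh.ne']
  have hF : Measurable fun q : Eu n × ℝ => ‖v' (q.1 + (q.2 * h) • EuclideanSpace.single i 1)‖ₑ ^ p :=
    (hv.comp (by fun_prop)).enorm.pow_const p
  calc _ ≤ ∫⁻ x, (∫⁻ t in Ioc (0:ℝ) 1, ‖v' (x + (t * h) • EuclideanSpace.single i 1)‖ₑ ^ p) ∂(mub n ln b) := by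
        refine lintegral_mono fun x => ?_
        simp only
        rw [hrep x]
        have hm1 : Measurable fun t : ℝ => v' (x + (t * h) • EuclideanSpace.single i 1) := hv.comp (by fun_prop)
        refine (ENNReal.rpow_le_rpow (enorm_integral_le_lintegral_enorm _) hp0.le).trans ?_
        exact lintegral_rpow_le_of_measure_le_one (by simp) hp hm1.enorm.aemeasurable
    _ = ∫⁻ t in Ioc (0:ℝ) 1, ∫⁻ x, ‖v' (x + (t * h) • EuclideanSpace.single i 1)‖ₑ ^ p ∂(mub n ln b) :=
        lintegral_lintegral_swap hF.aemeasurable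
    _ ≤ ∫⁻ t in Ioc (0:ℝ) 1, ∫⁻ x, ‖v' x‖ₑ ^ p ∂(mub n ln b) :=
        setLIntegral_mono measurable_const fun t ht =>
          lintegral_mub_add_le hb (hv.enorm.pow_const p) i (mul_nonneg ht.1.le hh.le)
    _ = _ := by simp

end

section

variable {n : ℕ} {ln : Fin n} {b ε m s p : ℝ} {f : Eu n → ℝ}

/-! ### Passing to the limit -/

lemma rpow_neg_sub_le {a r : ℝ} (ha : 0 < a) (hε : 0 ≤ ε) (hr : 0 ≤ r) :
    |(a + ε) ^ (-r) - a ^ (-r)| ≤ (1 + r) * ε ^ (1 / 4 : ℝ) * a ^ (-(r + 1 / 4)) := by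
  set t := ε / a with ht
  have ht0 : 0 ≤ t := by positivity
  have e1 : (a + ε) ^ (-r) = a ^ (-r) * (1 + t) ^ (-r) := by
    rw [← Real.mul_rpow ha.le (by positivity)]
    congr 1
    rw [ht]; field_simp
  have e2 : ε ^ (1 / 4 : ℝ) * a ^ (-(r + 1 / 4)) = a ^ (-r) * t ^ (1 / 4 : ℝ) := by
    rw [ht, Real.div_rpow hε ha.le, neg_add, Real.rpow_add ha, Real.rpow_neg ha.le (1 / 4)]
    ring
  have h1 : (1 + t) ^ (-r) ≤ 1 := Real.rpow_le_one_of_one_le_of_nonpos (by linarith) (by linarith)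
  have h0 : 0 ≤ (1 + t) ^ (-r) := by positivity
  have h2 : 1 - (1 + t) ^ (-r) ≤ (1 + r) * t ^ (1 / 4 : ℝ) := by
    rcases le_total 1 t with h | h
    · have := Real.one_le_rpow h (by norm_num : (0:ℝ) ≤ 1 / 4)
      nlinarith
    · have h3 : t ≤ t ^ (1 / 4 : ℝ) := by
        simpa using Real.rpow_le_rpow_of_exponent_ge' ht0 h (by norm_num) (by norm_num : (1 / 4 : ℝ) ≤ 1)
      have h4 : 1 - r * t ≤ (1 + t) ^ (-r) := by
        rw [Real.rpow_def_of_pos (by linarith)]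
        have h5 := Real.add_one_le_exp (Real.log (1 + t) * -r)
        have h6 := Real.log_le_sub_one_of_pos (by linarith : 0 < 1 + t)
        nlinarith
      nlinarith
  rw [e1, mul_assoc, e2, show a ^ (-r) * (1 + t) ^ (-r) - a ^ (-r) = -(a ^ (-r) * (1 - (1 + t) ^ (-r))) by ring,
    abs_neg, abs_of_nonneg (mul_nonneg (by positivity) (by linarith))]
  calc _ ≤ a ^ (-r) * ((1 + r) * t ^ (1 / 4 : ℝ)) := by gcongr
    _ = _ := by ring

lemma abs_pw_sub_le (hε : 0 ≤ ε) (hs : 0 ≤ s) {x y : Eu n} {τ : ℝ} (hx : x ∈ Hs ln) (hy : y ∈ Hs ln)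
    (hτ : τ ∈ Ioo (0:ℝ) 1) :
    |pw ln ε s x y τ - pw ln 0 s x y τ| ≤ (1 + s) * ε ^ (1 / 4 : ℝ) * Qf ln x y τ ^ (-(s + 1 / 4)) := by
  unfold pw
  rw [add_zero]
  exact rpow_neg_sub_le (Qf_pos hx hy hτ) hε hs

lemma abs_g1_sub_le (hε : 0 ≤ ε) (hs : 0 ≤ s) {x y : Eu n} {τ : ℝ} (hx : x ∈ Hs ln) (hy : y ∈ Hs ln)
    (hτ : τ ∈ Ioo (0:ℝ) 1) (i : Fin n) :
    |g1 ln ε s i x y τ - g1 ln 0 s i x y τ| ≤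
      2 * s * (2 + s) * ε ^ (1 / 4 : ℝ) * Qf ln x y τ ^ (-(s + 3 / 4)) := by
  have hQ := Qf_pos hx hy hτ
  have h1 := abs_Xf_le (ln := ln) (x := x) (y := y) le_rfl hτ i
  have h2 := abs_pw_sub_le (s := s + 1) hε (by linarith) hx hy hτ
  rw [add_zero] at h1
  unfold g1
  rw [← mul_sub, ← sub_mul, abs_mul (-2 * s), abs_mul (_ - _), show |-2 * s| = 2 * s by rw [abs_mul, abs_of_nonneg hs]; norm_num]
  calc _ ≤ 2 * s * (((1 + (s + 1)) * ε ^ (1 / 4 : ℝ) * Qf ln x y τ ^ (-(s + 1 + 1 / 4))) * Qf ln x y τ ^ (1 / 2 : ℝ)) := by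
        gcongr
    _ = 2 * s * (2 + s) * ε ^ (1 / 4 : ℝ) * (Qf ln x y τ ^ (-(s + 1 + 1 / 4)) * Qf ln x y τ ^ (1 / 2 : ℝ)) := by ring
    _ = _ := by
        rw [← Real.rpow_add hQ]; congr 2; ring

/-- Subcritical potentials of bounded compactly supported functions are bounded. -/
lemma pot_bdd (ln : Fin n) (hb : 0 < b) (hm0 : 0 < m) (hm : 2 * m < (n : ℝ) + b) (hf : BBS f) : ∃ K : ℝ, 0 ≤ K ∧
    ∀ x ∈ Hs ln, ∫⁻ w, ENNReal.ofReal (Qf ln x w.1 w.2 ^ (-m)) * ‖f w.1‖ₑ ∂(rhob n ln b) ≤ ENNReal.ofReal K := by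
  obtain ⟨M, hM⟩ := hf.bdd
  obtain ⟨C, hC0, hC⟩ := rhob_Qf_le ln hb
  set B := ENNReal.ofReal M * ENNReal.ofReal (C * ((((n : ℝ) + b) / 2) / (((n : ℝ) + b) / 2 - m)) *
    1 ^ (((n : ℝ) + b) / 2 - m)) + ∫⁻ w, ‖f w.1‖ₑ ∂(rhob n ln b)
  have hB : B ≠ ⊤ := by
    have : ∫⁻ w, ‖f w.1‖ₑ ∂(rhob n ln b) ≠ ⊤ := (hf.integrable_rhob hb).2.ne
    finiteness
  refine ⟨B.toReal, ENNReal.toReal_nonneg, fun x hx => ?_⟩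
  rw [ENNReal.ofReal_toReal hB]
  have hS : MeasurableSet {w : Eu n × ℝ | Qf ln x w.1 w.2 ≤ 1} :=
    measurableSet_le (measurable_Qf_right x) measurable_const
  rw [← lintegral_add_compl _ hS]
  refine add_le_add ?_ ?_
  · calc _ ≤ ∫⁻ w in {w : Eu n × ℝ | Qf ln x w.1 w.2 ≤ 1}, ENNReal.ofReal M * ENNReal.ofReal (Qf ln x w.1 w.2 ^ (-m)) ∂(rhob n ln b) := by
          refine lintegral_mono fun w => ?_
          dsimp only
          rw [mul_comm]
          gcongr
          rw [← ofReal_norm]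
          exact ENNReal.ofReal_le_ofReal (hM _)
      _ ≤ _ := by
          rw [lintegral_const_mul' _ _ ENNReal.ofReal_ne_top]
          gcongr
          exact lintegral_near (measurable_Qf_right x) (ae_Qf_nonneg x) hC0.le (hC x hx) hm0 (by linarith) one_pos
  · calc _ ≤ ∫⁻ w in {w : Eu n × ℝ | Qf ln x w.1 w.2 ≤ 1}ᶜ, ‖f w.1‖ₑ ∂(rhob n ln b) := by
          refine setLIntegral_mono' hS.compl fun w hw => ?_
          have hw : ¬ Qf ln x w.1 w.2 ≤ 1 := hw
          have : ENNReal.ofReal (Qf ln x w.1 w.2 ^ (-m)) ≤ 1 := by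
            rw [ENNReal.ofReal_le_one]
            exact Real.rpow_le_one_of_one_le_of_nonpos (by linarith) (by linarith)
          exact mul_le_of_le_one_left' this
      _ ≤ _ := setLIntegral_le_lintegral _ _

lemma Ik_sub_le {Φ Ψ : Eu n → Eu n → ℝ → ℝ} {δ K : ℝ} (hδ : 0 ≤ δ) (hf : BBS f)
    (hΦ : Measurable fun q : Eu n × Eu n × ℝ => Φ q.1 q.2.1 q.2.2)
    (hΨ : Measurable fun q : Eu n × Eu n × ℝ => Ψ q.1 q.2.1 q.2.2)
    {x : Eu n} (hi : Integrable (fun w : Eu n × ℝ => Φ x w.1 w.2 * f w.1) (rhob n ln b))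
    (h : ∀ y ∈ Hs ln, ∀ τ ∈ Ioo (0:ℝ) 1, |Φ x y τ - Ψ x y τ| ≤ δ * Qf ln x y τ ^ (-m))
    (hK0 : 0 ≤ K)
    (hK : ∫⁻ w, ENNReal.ofReal (Qf ln x w.1 w.2 ^ (-m)) * ‖f w.1‖ₑ ∂(rhob n ln b) ≤ ENNReal.ofReal K) :
    Integrable (fun w : Eu n × ℝ => Ψ x w.1 w.2 * f w.1) (rhob n ln b) ∧
      |Ik n ln b Φ f x - Ik n ln b Ψ f x| ≤ δ * K := by
  have hm1 : Measurable fun w : Eu n × ℝ => Φ x w.1 w.2 := hΦ.of_uncurry_left (f := fun x (w : Eu n × ℝ) => Φ x w.1 w.2)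
  have hm2 : Measurable fun w : Eu n × ℝ => Ψ x w.1 w.2 := hΨ.of_uncurry_left (f := fun x (w : Eu n × ℝ) => Ψ x w.1 w.2)
  have hfm : Measurable fun w : Eu n × ℝ => f w.1 := hf.meas.comp measurable_fst
  have key : ∫⁻ w, ‖Φ x w.1 w.2 * f w.1 - Ψ x w.1 w.2 * f w.1‖ₑ ∂(rhob n ln b) ≤ ENNReal.ofReal (δ * K) := by
    calc _ ≤ ∫⁻ w, ENNReal.ofReal δ * (ENNReal.ofReal (Qf ln x w.1 w.2 ^ (-m)) * ‖f w.1‖ₑ) ∂(rhob n ln b) := by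
          refine lintegral_mono_ae ((ae_rhob ln b).mono fun w hw => ?_)
          rw [← sub_mul, enorm_mul, ← mul_assoc, ← ENNReal.ofReal_mul hδ]
          gcongr
          rw [← ofReal_norm]
          exact ENNReal.ofReal_le_ofReal (h _ hw.1 _ hw.2)
      _ ≤ _ := by
          rw [lintegral_const_mul' _ _ ENNReal.ofReal_ne_top, ENNReal.ofReal_mul hδ]
          gcongr
  have hd : Integrable (fun w : Eu n × ℝ => Φ x w.1 w.2 * f w.1 - Ψ x w.1 w.2 * f w.1) (rhob n ln b) :=
    ⟨((hm1.mul hfm).sub (hm2.mul hfm)).aestronglyMeasurable, key.trans_lt ENNReal.ofReal_lt_top⟩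
  have hi2 : Integrable (fun w : Eu n × ℝ => Ψ x w.1 w.2 * f w.1) (rhob n ln b) :=
    (hi.sub hd).congr (ae_of_all _ fun w => by simp)
  refine ⟨hi2, ?_⟩
  unfold Ik
  rw [← integral_sub hi hi2, ← Real.norm_eq_abs, ← ENNReal.ofReal_le_ofReal_iff (by positivity), ofReal_norm]
  exact (enorm_integral_le_lintegral_enorm _).trans key

end

section

variable {n : ℕ} {ln : Fin n} {b ε m s p : ℝ} {f : Eu n → ℝ}

/-- A sequence of positive regularization parameters tending to `0`. -/
def ep (k : ℕ) : ℝ := 1 / ((k : ℝ) + 1)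

lemma ep_pos (k : ℕ) : 0 < ep k := by unfold ep; positivity

lemma tendsto_ep : Tendsto ep atTop (𝓝 0) := tendsto_one_div_add_atTop_nhds_zero_nat

lemma exists_Ik_pw_sub_le (ln : Fin n) (hb : 0 < b) (hs0 : 0 < s) (hs : 2 * (s + 1) = (n : ℝ) + b) (hf : BBS f) :
    ∃ K, 0 ≤ K ∧ ∀ ε, 0 < ε → ∀ x ∈ Hs ln,
      Integrable (fun w : Eu n × ℝ => pw ln 0 s x w.1 w.2 * f w.1) (rhob n ln b) ∧
        |Ik n ln b (pw ln ε s) f x - Ik n ln b (pw ln 0 s) f x| ≤ K * ε ^ (1 / 4 : ℝ) := by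
  obtain ⟨K, hK0, hK⟩ := pot_bdd (m := s + 1 / 4) ln hb (by linarith) (by linarith) hf
  refine ⟨(1 + s) * K, by positivity, fun ε hε x hx => ?_⟩
  have := Ik_sub_le (m := s + 1 / 4) (δ := (1 + s) * ε ^ (1 / 4 : ℝ)) (by positivity) hf (measurable_pw ε s) (measurable_pw 0 s)
    ((adm_pw hε s).integrable hb hε hs0.le hf x) (fun y hy τ hτ => abs_pw_sub_le hε.le hs0.le hx hy hτ) hK0 (hK x hx)
  exact ⟨this.1, this.2.trans_eq (by ring)⟩

lemma exists_Ik_g1_sub_le (ln : Fin n) (hb : 0 < b) (hs0 : 0 < s) (hs : 2 * (s + 1) = (n : ℝ) + b) (hf : BBS f) (i : Fin n) :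
    ∃ K, 0 ≤ K ∧ ∀ ε, 0 < ε → ∀ x ∈ Hs ln,
        |Ik n ln b (g1 ln ε s i) f x - Ik n ln b (g1 ln 0 s i) f x| ≤ K * ε ^ (1 / 4 : ℝ) := by
  obtain ⟨K, hK0, hK⟩ := pot_bdd (m := s + 3 / 4) ln hb (by linarith) (by linarith) hf
  refine ⟨2 * s * (2 + s) * K, by positivity, fun ε hε x hx => ?_⟩
  have := Ik_sub_le (m := s + 3 / 4) (δ := 2 * s * (2 + s) * ε ^ (1 / 4 : ℝ)) (by positivity) hf (measurable_g1 i) (measurable_g1 i)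
    ((adm_g1 hε hs0.le i).integrable hb hε (by linarith) hf x) (fun y hy τ hτ => abs_g1_sub_le hε.le hs0.le hx hy hτ i) hK0 (hK x hx)
  exact this.2.trans_eq (by ring)

lemma tendsto_mul_ep_rpow (K : ℝ) : Tendsto (fun k => K * ep k ^ (1 / 4 : ℝ)) atTop (𝓝 0) := by
  have := (tendsto_ep.rpow_const (p := 1 / 4) (Or.inr (by norm_num))).const_mul K
  simpa using this

lemma tendstoUniformlyOn_of_abs_sub_le {S : Set (Eu n)} {F : ℝ → Eu n → ℝ} {F0 : Eu n → ℝ} {K : ℝ}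
    (h : ∀ ε, 0 < ε → ∀ x ∈ S, |F ε x - F0 x| ≤ K * ε ^ (1 / 4 : ℝ)) :
    TendstoUniformlyOn (fun k => F (ep k)) F0 atTop S := by
  rw [Metric.tendstoUniformlyOn_iff]
  intro δ hδ
  filter_upwards [(tendsto_mul_ep_rpow K).eventually_lt_const hδ] with k hk x hx
  rw [dist_comm, Real.dist_eq]
  exact (h _ (ep_pos k) x hx).trans_lt hk

lemma tendstoUniformlyOn_Ik_pw (ln : Fin n) (hb : 0 < b) (hs0 : 0 < s) (hs : 2 * (s + 1) = (n : ℝ) + b) (hf : BBS f) :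
    TendstoUniformlyOn (fun k => Ik n ln b (pw ln (ep k) s) f) (Ik n ln b (pw ln 0 s) f) atTop (Hs ln) := by
  obtain ⟨K, -, hK⟩ := exists_Ik_pw_sub_le ln hb hs0 hs hf
  exact tendstoUniformlyOn_of_abs_sub_le (F := fun ε => Ik n ln b (pw ln ε s) f) fun ε hε x hx => (hK ε hε x hx).2

lemma tendstoUniformlyOn_Ik_g1 (ln : Fin n) (hb : 0 < b) (hs0 : 0 < s) (hs : 2 * (s + 1) = (n : ℝ) + b) (hf : BBS f)
    (i : Fin n) :
    TendstoUniformlyOn (fun k => Ik n ln b (g1 ln (ep k) s i) f) (Ik n ln b (g1 ln 0 s i) f) atTop (Hs ln) := by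
  obtain ⟨K, -, hK⟩ := exists_Ik_g1_sub_le ln hb hs0 hs hf i
  exact tendstoUniformlyOn_of_abs_sub_le (F := fun ε => Ik n ln b (g1 ln ε s i) f) hK

lemma gradCLM_sub (v w : Fin n → ℝ) : gradCLM v - gradCLM w = gradCLM fun k => v k - w k := by
  simp [gradCLM, sub_smul]

lemma hasFDerivAt_Ik_pw_zero (hb : 0 < b) (hs0 : 0 < s) (hs : 2 * (s + 1) = (n : ℝ) + b) (hf : BBS f) {x : Eu n}
    (hx : x ∈ Hs ln) :
    HasFDerivAt (Ik n ln b (pw ln 0 s) f) (gradCLM fun k => Ik n ln b (g1 ln 0 s k) f x) x := by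
  refine hasFDerivAt_of_tendstoUniformlyOn (l := atTop) (isOpen_Hs ln)
    (f := fun k => Ik n ln b (pw ln (ep k) s) f)
    (f' := fun k x => gradCLM fun i => Ik n ln b (g1 ln (ep k) s i) f x)
    (g' := fun x => gradCLM fun i => Ik n ln b (g1 ln 0 s i) f x) ?_
    (fun k x _ => hasFDerivAt_Ik_pw hb (ep_pos k) hs0.le hf x)
    (fun x hx => (tendstoUniformlyOn_Ik_pw ln hb hs0 hs hf).tendsto_at hx) hx
  choose K hK0 hK using exists_Ik_g1_sub_le ln hb hs0 hs hf
  rw [Metric.tendstoUniformlyOn_iff]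
  intro δ hδ
  filter_upwards [(tendsto_mul_ep_rpow (∑ i, K i)).eventually_lt_const hδ] with k hk x hx
  rw [dist_comm, dist_eq_norm, gradCLM_sub]
  refine (norm_gradCLM_le _).trans_lt (lt_of_le_of_lt ?_ hk)
  rw [Finset.sum_mul]
  exact Finset.sum_le_sum fun i _ => hK i _ (ep_pos k) x hx

/-- On the half space `Tb f` is the unregularized potential. -/
lemma Tb_eq (ln : Fin n) (hb : 0 < b) (hs0 : 0 < s) (hs : 2 * (s + 1) = (n : ℝ) + b) (hf : BBS f) {x : Eu n}
    (hx : x ∈ Hs ln) : Tb n ln b f x = Db n b * Ik n ln b (pw ln 0 s) f x := by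
  obtain ⟨K, -, hK⟩ := exists_Ik_pw_sub_le ln hb hs0 hs hf
  have hi := (hK 1 one_pos x hx).1
  have := isFiniteMeasure_kap hb
  unfold Ik
  rw [integral_prod _ hi, ← integral_const_mul, mub,
    integral_withDensity_eq_integral_toReal_smul (measurable_wt ln b) (ae_of_all _ fun _ => ENNReal.ofReal_lt_top)]
  refine setIntegral_congr_fun (measurableSet_Hs ln) fun y hy => ?_
  have hy0 : 0 < y ln := hy
  simp only [smul_eq_mul]
  rw [ENNReal.toReal_ofReal (by positivity), integral_mul_const, integral_kap, Kb,
    intervalIntegral.integral_of_le zero_le_one, integral_Ioc_eq_integral_Ioo]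
  have e : ∫ τ in Ioo (0:ℝ) 1, (τ * (1 - τ)) ^ (b / 2 - 1) * pw ln 0 s x y τ =
      ∫ τ in Ioo (0:ℝ) 1, (‖x - y‖ ^ 2 * (1 - τ) + ‖x - reflLn ln y‖ ^ 2 * τ) ^ (-(((n : ℝ) - 2 + b) / 2)) *
      (τ * (1 - τ)) ^ (b / 2 - 1) := by
    refine integral_congr_ae (ae_of_all _ fun τ => ?_)
    simp only [pw]
    rw [← Qf_eq, add_zero, mul_comm, show ((n : ℝ) - 2 + b) / 2 = s by linarith]
  rw [e]
  ring

end

section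

variable {n : ℕ} {ln : Fin n} {b ε m s p : ℝ} {f : Eu n → ℝ}

lemma eLpNorm_le_of_tendsto {q A : ℝ≥0∞} {g : ℕ → Eu n → ℝ} {g0 : Eu n → ℝ} (hg : ∀ k, Measurable (g k))
    (hA : ∀ k, eLpNorm (g k) q (mub n ln b) ≤ A)
    (h : ∀ x ∈ Hs ln, Tendsto (fun k => g k x) atTop (𝓝 (g0 x))) :
    AEStronglyMeasurable g0 (mub n ln b) ∧ eLpNorm g0 q (mub n ln b) ≤ A := by
  have hae : ∀ᵐ x ∂(mub n ln b), Tendsto (fun k => g k x) atTop (𝓝 (g0 x)) := (ae_mub ln b).mono h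
  refine ⟨aestronglyMeasurable_of_tendsto_ae _ (fun k => (hg k).aestronglyMeasurable) hae,
    (Lp.eLpNorm_lim_le_liminf_eLpNorm (fun k => (hg k).aestronglyMeasurable) _ hae).trans ?_⟩
  exact (liminf_le_liminf (Eventually.of_forall hA)).trans_eq (liminf_const _)

lemma enorm_pd_le_liminf (g : Eu n → ℝ) (i : Fin n) (x : Eu n) (hp : 0 < p) :
    ‖pd g i x‖ₑ ^ p ≤ liminf (fun k => ‖(ep k)⁻¹ * (g (x + ep k • EuclideanSpace.single i 1) - g x)‖ₑ ^ p) atTop := by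
  by_cases hd : DifferentiableAt ℝ g x
  · have h1 := (hd.hasFDerivAt.hasLineDerivAt (EuclideanSpace.single i 1)).tendsto_slope_zero
    have h2 : Tendsto ep atTop (𝓝[≠] 0) :=
      tendsto_nhdsWithin_iff.2 ⟨tendsto_ep, Eventually.of_forall fun k => (ep_pos k).ne'⟩
    have h3 : Tendsto (fun k => ‖(ep k)⁻¹ * (g (x + ep k • EuclideanSpace.single i 1) - g x)‖ₑ ^ p) atTop
        (𝓝 (‖pd g i x‖ₑ ^ p)) :=
      (ENNReal.continuous_rpow_const.tendsto _).comp ((continuous_enorm.tendsto _).comp (h1.comp h2))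
    exact h3.liminf_eq.ge
  · rw [pd, fderiv_zero_of_not_differentiableAt hd]
    simp [hp]

lemma eLpNorm_pd_le_of_tendsto (hb : 0 < b) (hp : 1 < p) (i : Fin n) {A : ℝ≥0∞} {g g' : ℕ → Eu n → ℝ} {g0 : Eu n → ℝ}
    (hg : ∀ k, Measurable (g k)) (hg' : ∀ k, Measurable (g' k)) (hbd : ∀ k, ∃ M, ∀ x, |g' k x| ≤ M)
    (hd : ∀ k x (t : ℝ), HasDerivAt (fun t : ℝ => g k (x + t • EuclideanSpace.single i 1))
      (g' k (x + t • EuclideanSpace.single i 1)) t)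
    (hA : ∀ k, eLpNorm (g' k) (ENNReal.ofReal p) (mub n ln b) ≤ A)
    (h : ∀ x ∈ Hs ln, Tendsto (fun k => g k x) atTop (𝓝 (g0 x))) :
    eLpNorm (pd g0 i) (ENNReal.ofReal p) (mub n ln b) ≤ A := by
  have hp0 : 0 < p := by linarith
  have key : ∀ t : ℝ, 0 < t →
      AEStronglyMeasurable (fun x => t⁻¹ * (g0 (x + t • EuclideanSpace.single i 1) - g0 x)) (mub n ln b) ∧
      eLpNorm (fun x => t⁻¹ * (g0 (x + t • EuclideanSpace.single i 1) - g0 x)) (ENNReal.ofReal p) (mub n ln b) ≤ A := by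
    intro t ht
    refine eLpNorm_le_of_tendsto (g := fun k x => t⁻¹ * (g k (x + t • EuclideanSpace.single i 1) - g k x))
      (fun k => ((((hg k).comp (measurable_id.add_const _)).sub (hg k)).const_mul _)) (fun k => ?_) fun x hx => ?_
    · refine le_trans ?_ (hA k)
      rw [eLpNorm_ofReal_eq hp0, eLpNorm_ofReal_eq hp0]
      exact ENNReal.rpow_le_rpow (diffq_Lp hb hp i (hg' k) (hbd k) (hd k) ht) (by positivity)
    · have hx0 : 0 < x ln := hx
      have hx' : x + t • EuclideanSpace.single i 1 ∈ Hs ln := by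
        change 0 < x ln + t * _
        have : (0:ℝ) ≤ (EuclideanSpace.single i 1 : Eu n) ln := by
          simp only [PiLp.single_apply]; split_ifs <;> norm_num
        positivity
      exact ((h _ hx').sub (h x hx)).const_mul _
  rw [eLpNorm_ofReal_eq hp0, one_div, ENNReal.rpow_inv_le_iff hp0]
  calc _ ≤ ∫⁻ x, liminf (fun k => ‖(ep k)⁻¹ * (g0 (x + ep k • EuclideanSpace.single i 1) - g0 x)‖ₑ ^ p) atTop ∂(mub n ln b) :=
        lintegral_mono fun x => enorm_pd_le_liminf g0 i x hp0
    _ ≤ liminf (fun k => ∫⁻ x, ‖(ep k)⁻¹ * (g0 (x + ep k • EuclideanSpace.single i 1) - g0 x)‖ₑ ^ p ∂(mub n ln b)) atTop :=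
        lintegral_liminf_le' fun k => (key _ (ep_pos k)).1.enorm.pow_const _
    _ ≤ liminf (fun _ => A ^ p) (atTop : Filter ℕ) := by
        refine liminf_le_liminf (Eventually.of_forall fun k => ?_)
        have h1 := (key _ (ep_pos k)).2
        rwa [eLpNorm_ofReal_eq hp0, one_div, ENNReal.rpow_inv_le_iff hp0] at h1
    _ = A ^ p := (liminf_const _)

lemma pd_Tb (hb : 0 < b) (hs0 : 0 < s) (hs : 2 * (s + 1) = (n : ℝ) + b) (hf : BBS f) (j : Fin n) {x : Eu n}
    (hx : x ∈ Hs ln) : pd (Tb n ln b f) j x = Db n b * Ik n ln b (g1 ln 0 s j) f x := by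
  have h : Tb n ln b f =ᶠ[𝓝 x] fun x => Db n b * Ik n ln b (pw ln 0 s) f x := by
    filter_upwards [(isOpen_Hs ln).mem_nhds hx] with z hz
    exact Tb_eq ln hb hs0 hs hf hz
  rw [pd, h.fderiv_eq, ((hasFDerivAt_Ik_pw_zero hb hs0 hs hf hx).const_mul (Db n b)).fderiv]
  simp [gradCLM_single]

lemma norm_gradient_le (g : Eu n → ℝ) (x : Eu n) : ‖gradient g x‖ ≤ ∑ j, |pd g j x| := by
  rw [gradient, LinearIsometryEquiv.norm_map, eq_gradCLM (fderiv ℝ g x)]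
  refine (norm_gradCLM_le _).trans_eq ?_
  rfl

lemma eLpNorm_gradient_le {g : Eu n → ℝ} {q B : ℝ≥0∞} {ν : Measure (Eu n)} (hq : 1 ≤ q)
    (h : ∀ i, AEStronglyMeasurable (pd g i) ν ∧ eLpNorm (pd g i) q ν ≤ B) :
    eLpNorm (fun x => gradient g x) q ν ≤ n * B := by
  have hm : ∀ i ∈ Finset.univ, AEStronglyMeasurable (fun x => |pd g i x|) ν := fun i _ => (h i).1.norm
  have hn : ∀ i, eLpNorm (fun x => |pd g i x|) q ν ≤ B := fun i => (eLpNorm_norm (pd g i)).trans_le (h i).2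
  calc _ ≤ eLpNorm (∑ i, fun x => |pd g i x|) q ν := by
        refine eLpNorm_mono_real fun x => ?_
        rw [Finset.sum_apply]
        exact norm_gradient_le _ x
    _ ≤ ∑ i, eLpNorm (fun x => |pd g i x|) q ν := eLpNorm_sum_le hm hq
    _ ≤ ∑ _i : Fin n, B := Finset.sum_le_sum fun i _ => hn i
    _ = _ := by simp

/-- The a priori estimate for each of the terms. -/
lemma Tb_bounds (ln : Fin n) (hb : 1 < b) (hs0 : 0 < s) (hs : 2 * (s + 1) = (n : ℝ) + b) (hp : 1 < p)
    (hsp : (n : ℝ) + b < 2 * s * p) : ∃ A : ℝ≥0∞, A ≠ ⊤ ∧ ∀ f : Eu n → ℝ, BBS f →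
    (∀ y, f y ≠ 0 → ‖y‖ ≤ 1) →
      eLpNorm (Tb n ln b f) (ENNReal.ofReal p) (mub n ln b) ≤
        A * eLpNorm f (ENNReal.ofReal p) (mub n ln b) ∧
      (∀ i, AEStronglyMeasurable (pd (Tb n ln b f) i) (mub n ln b) ∧
        eLpNorm (pd (Tb n ln b f) i) (ENNReal.ofReal p) (mub n ln b) ≤
        A * eLpNorm f (ENNReal.ofReal p) (mub n ln b)) ∧
      (∀ i j, eLpNorm (pd2 (Tb n ln b f) i j) (ENNReal.ofReal p) (mub n ln b) ≤
        A * eLpNorm f (ENNReal.ofReal p) (mub n ln b)) ∧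
      eLpNorm (fun x => pd (Tb n ln b f) ln x / x ln) (ENNReal.ofReal p) (mub n ln b) ≤
        A * eLpNorm f (ENNReal.ofReal p) (mub n ln b) := by
  have hb0 : 0 < b := by linarith
  obtain ⟨A, hA, h⟩ := uniform_bounds ln hb hs0 hs hp hsp
  refine ⟨‖Db n b‖ₑ * A, by finiteness, fun f hf hsupp => ?_⟩
  have hscale : ∀ {v : Eu n → ℝ}, eLpNorm v (ENNReal.ofReal p) (mub n ln b) ≤
      A * eLpNorm f (ENNReal.ofReal p) (mub n ln b) →
      eLpNorm (fun x => Db n b * v x) (ENNReal.ofReal p) (mub n ln b) ≤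
        ‖Db n b‖ₑ * A * eLpNorm f (ENNReal.ofReal p) (mub n ln b) := fun {v} hv => by
    rw [mul_assoc]
    refine (eLpNorm_const_smul (Db n b) v _ _).le.trans ?_
    gcongr
  have hpd : ∀ j, ∀ x ∈ Hs ln, Tendsto (fun k => Db n b * Ik n ln b (g1 ln (ep k) s j) f x) atTop
      (𝓝 (pd (Tb n ln b f) j x)) := fun j x hx => by
    rw [pd_Tb hb0 hs0 hs hf j hx]
    exact ((tendstoUniformlyOn_Ik_g1 ln hb0 hs0 hs hf j).tendsto_at hx).const_mul _
  have hB := fun k => h (ep k) (ep_pos k) f hf hsupp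
  refine ⟨(eLpNorm_le_of_tendsto (g := fun k x => Db n b * Ik n ln b (pw ln (ep k) s) f x)
    (fun k => ((adm_pw (ep_pos k) s).measurable_Ik hf.meas).const_mul _) (fun k => hscale (hB k).1) fun x hx => ?_).2,
    fun i => eLpNorm_le_of_tendsto (fun k => (measurable_Ik_g1 (ep_pos k) hs0.le hf i).const_mul _)
      (fun k => hscale ((hB k).2.1 i)) (hpd i), fun i j => ?_, ?_⟩
  · rw [Tb_eq ln hb0 hs0 hs hf hx]
    exact ((tendstoUniformlyOn_Ik_pw ln hb0 hs0 hs hf).tendsto_at hx).const_mul _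
  · refine eLpNorm_pd_le_of_tendsto hb0 hp i (fun k => (measurable_Ik_g1 (ep_pos k) hs0.le hf j).const_mul _)
      (g' := fun k x => Db n b * Ik n ln b (g2 ln (ep k) s j i) f x)
      (fun k => (measurable_Ik_g2 (ep_pos k) hs0.le hf j i).const_mul _) (fun k => ?_) (fun k x t => ?_)
      (fun k => hscale ((hB k).2.2.1 j i)) (hpd j)
    · obtain ⟨M, hM⟩ := (adm_g2 (ep_pos k) hs0.le j i).Ik_bdd (ln := ln) hb0 (ep_pos k) (by linarith) hf
      refine ⟨|Db n b| * M, fun x => ?_⟩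
      rw [abs_mul]
      exact mul_le_mul_of_nonneg_left (hM x) (abs_nonneg _)
    · have h1 := hasFDerivAt_Ik_g1 (ln := ln) hb0 (ep_pos k) hs0.le hf j (x + t • EuclideanSpace.single i 1)
      have h2 : HasDerivAt (fun t : ℝ => x + t • (EuclideanSpace.single i 1 : Eu n)) (EuclideanSpace.single i 1) t := by
        simpa using ((hasDerivAt_id t).smul_const (EuclideanSpace.single i 1 : Eu n)).const_add x
      refine ((h1.comp_hasDerivAt t h2).const_mul (Db n b)).congr_deriv ?_
      rw [gradCLM_single]
  · refine (eLpNorm_le_of_tendsto (g := fun k x => Db n b * (Ik n ln b (g1 ln (ep k) s ln) f x / x ln))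
      (fun k => ((measurable_Ik_g1 (ep_pos k) hs0.le hf ln).div (by fun_prop)).const_mul _)
      (fun k => hscale (hB k).2.2.2) fun x hx => ?_).2
    simpa only [mul_div_assoc] using (hpd ln x hx).div_const (x ln)

end

end HalfSpaceCZ

theorem stmt17 (n : ℕ) (hn : 2 ≤ n) (ln : Fin n) (hln : (ln : ℕ) = n - 1)
    (b : ℝ) (hb : 1 < b) (p : ℝ)
    (hp : ((n : ℝ) + b) / ((n : ℝ) - 2 + b) < p) :
    ∃ C : ℝ, 0 < C ∧
      ∀ f : Eu n → ℝ, Measurable f → (∃ M : ℝ, ∀ y, |f y| ≤ M) →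
        (∀ y : Eu n, f y ≠ 0 → y ∈ Metric.ball (0 : Eu n) 1) →
        eLpNorm (Tb n ln b f) (ENNReal.ofReal p) (mub n ln b)
          + eLpNorm (fun x => gradient (Tb n ln b f) x) (ENNReal.ofReal p) (mub n ln b)
          + (∑ i : Fin n, ∑ j : Fin n,
              eLpNorm (fun x => pd2 (Tb n ln b f) i j x) (ENNReal.ofReal p) (mub n ln b))
          + eLpNorm (fun x => pd (Tb n ln b f) ln x / x ln) (ENNReal.ofReal p) (mub n ln b)
          ≤ ENNReal.ofReal C * eLpNorm f (ENNReal.ofReal p) (mub n ln b) := by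
  have hn' : (2 : ℝ) ≤ n := by exact_mod_cast hn
  set s : ℝ := ((n : ℝ) + b) / 2 - 1 with hs
  have hs0 : 0 < s := by linarith
  have hs2 : (n : ℝ) - 2 + b = 2 * s := by linarith
  rw [hs2, div_lt_iff₀ (by positivity)] at hp
  have hp1 : 1 < p := by nlinarith
  obtain ⟨A, hA, h⟩ := HalfSpaceCZ.Tb_bounds ln hb hs0 (by linarith) hp1 (by linarith : (n : ℝ) + b < 2 * s * p)
  set T : ℝ≥0∞ := A + n * A + n * (n * A) + A with hT
  have hT' : T ≠ ⊤ := by finiteness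
  refine ⟨T.toReal + 1, by positivity, fun f hf hbd hsupp => ?_⟩
  have hsupp' : ∀ y, f y ≠ 0 → ‖y‖ ≤ 1 := fun y hy => (mem_ball_zero_iff.1 (hsupp y hy)).le
  obtain ⟨h0, h1, h2, h3⟩ := h f ⟨hf, hbd, 1, hsupp'⟩ hsupp'
  set N := eLpNorm f (ENNReal.ofReal p) (mub n ln b)
  have hTle : T ≤ ENNReal.ofReal (T.toReal + 1) := by
    rw [← ENNReal.ofReal_toReal hT']
    exact ENNReal.ofReal_le_ofReal (by simp)
  have hgrad : eLpNorm (fun x => gradient (Tb n ln b f) x) (ENNReal.ofReal p) (mub n ln b) ≤ n * (A * N) :=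
    HalfSpaceCZ.eLpNorm_gradient_le (by simpa using hp1.le) h1
  have hsum : ∑ i : Fin n, ∑ j : Fin n, eLpNorm (fun x => pd2 (Tb n ln b f) i j x) (ENNReal.ofReal p) (mub n ln b) ≤
      n * (n * (A * N)) := by
    calc _ ≤ ∑ _i : Fin n, ∑ _j : Fin n, A * N :=
          Finset.sum_le_sum fun i _ => Finset.sum_le_sum fun j _ => h2 i j
      _ = _ := by simp
  calc _ ≤ A * N + n * (A * N) + n * (n * (A * N)) + A * N := by gcongr
    _ = T * N := by rw [hT]; ring
    _ ≤ _ := by gcongr
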